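/- arXiv:1006.5718 — 6 statements merged into one kernel-verified Lean document; each statement's English description precedes it below -/
import Mathlib

section
/- Let Q₁, Q₂, P₁, P₂ be real n×n matrices satisfying Q₂P₁* − Q₁P₂* = Iₙ. Then the symmetric matrix Q₂Q₂* + Q₁Q₁* is positive definite. -/
open Matrix
noncomputable section
attribute [local instance] Matrix.normedAddCommGroup Matrix.normedSpace

/-- Square real matrices. -/
abbrev Mat (n : ℕ) := Matrix (Fin n) (Fin n) ℝ

/-- cos of a square real matrix, as a power series. -/
noncomputable def mcos {n : ℕ} (X : Mat n) : Mat n :=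
  ∑' k : ℕ, ((-1 : ℝ) ^ k / (Nat.factorial (2 * k) : ℝ)) • X ^ (2 * k)

/-- sin of a square real matrix, as a power series. -/
noncomputable def msin {n : ℕ} (X : Mat n) : Mat n :=
  ∑' k : ℕ, ((-1 : ℝ) ^ k / (Nat.factorial (2 * k + 1) : ℝ)) • X ^ (2 * k + 1)

/-- If `Q₂P₁* − Q₁P₂* = Iₙ`, then `Q₂Q₂* + Q₁Q₁*` is positive definite. -/
theorem posDef_of_wronskian_identity
    (n : ℕ) (hn : 1 ≤ n) (Q₁ P₁ Q₂ P₂ : Mat n)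
    (h : Q₂ * P₁ᵀ - Q₁ * P₂ᵀ = 1) :
    (Q₂ * Q₂ᵀ + Q₁ * Q₁ᵀ).PosDef := by
  refine Matrix.PosDef.of_dotProduct_mulVec_pos ?_ ?_
  · simp [Matrix.IsHermitian, Matrix.conjTranspose_eq_transpose_of_trivial,
      Matrix.transpose_add, Matrix.transpose_mul]
  · intro x hx
    have key : ∀ A : Mat n, x ⬝ᵥ ((A * Aᵀ) *ᵥ x) = (x ᵥ* A) ⬝ᵥ (x ᵥ* A) := by
      intro A
      rw [← Matrix.mulVec_mulVec, Matrix.dotProduct_mulVec, Matrix.mulVec_transpose]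
    have nn : ∀ v : Fin n → ℝ, 0 ≤ v ⬝ᵥ v := fun v =>
      Finset.sum_nonneg fun i _ => mul_self_nonneg (v i)
    rw [star_trivial, Matrix.add_mulVec, dotProduct_add, key, key]
    by_contra hc
    have h2 : x ᵥ* Q₂ = 0 :=
      dotProduct_self_eq_zero.mp (by linarith [nn (x ᵥ* Q₂), nn (x ᵥ* Q₁)])
    have h1 : x ᵥ* Q₁ = 0 :=
      dotProduct_self_eq_zero.mp (by linarith [nn (x ᵥ* Q₂), nn (x ᵥ* Q₁)])
    apply hx
    rw [← Matrix.vecMul_one x, ← h, Matrix.vecMul_sub, ← Matrix.vecMul_vecMul,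
      ← Matrix.vecMul_vecMul, h1, h2]
    simp
end
end

section
/- Let a, b, c, d be real n×n matrices such that ab* = ba* and cd* = dc*, and let N be the 2n×2n block matrix with rows [a, b] and [c, d]. Then (det N)² = (det(ad* − bc*))²; in particular, det N = 0 if and only if det(ad* − bc*) = 0. -/
open Matrix
noncomputable section
attribute [local instance] Matrix.normedAddCommGroup Matrix.normedSpace

/-- The determinant lemma: if `ab* = ba*` and `cd* = dc*`, then
`(det N)² = (det(ad* − bc*))²` for the block matrix `N = [[a,b],[c,d]]`,
and in particular `det N = 0 ↔ det(ad* − bc*) = 0`. -/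
theorem det_block_sq_eq
    (n : ℕ) (hn : 1 ≤ n) (a b c d : Mat n)
    (hab : a * bᵀ = b * aᵀ) (hcd : c * dᵀ = d * cᵀ) :
    (Matrix.fromBlocks a b c d).det ^ 2 = (a * dᵀ - b * cᵀ).det ^ 2 ∧
    ((Matrix.fromBlocks a b c d).det = 0 ↔ (a * dᵀ - b * cᵀ).det = 0) := by
  have key : (Matrix.fromBlocks a b c d).det ^ 2 = (a * dᵀ - b * cᵀ).det ^ 2 := by
    have h : Matrix.fromBlocks a b c d *
        ((J (Fin n) ℝ)ᵀ * (Matrix.fromBlocks a b c d)ᵀ * J (Fin n) ℝ) =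
        Matrix.fromBlocks (a * dᵀ - b * cᵀ) 0 0 (a * dᵀ - b * cᵀ)ᵀ := by
      simp only [J, Matrix.fromBlocks_transpose, Matrix.fromBlocks_multiply]
      congr 1 <;> simp [hab, hcd, sub_eq_add_neg, add_comm]
    have h2 := congrArg Matrix.det h
    rw [Matrix.det_fromBlocks_zero₂₁] at h2
    simp only [Matrix.det_mul, Matrix.det_transpose] at h2
    have h3 := J_det_mul_J_det (Fin n) ℝ
    linear_combination h2 - (Matrix.fromBlocks a b c d).det ^ 2 * h3
  refine ⟨key, ?_⟩
  rw [← sq_eq_zero_iff, key, sq_eq_zero_iff]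
end
end

section
/- Let ε₁, ε₂ ∈ {−1, 1}, ε = ε₁ε₂, let τ₀ ∈ [0,T), and let χ : (τ₀,T) → (l₋₁,l₁) be continuous with εχ strictly decreasing, lim_{τ→τ₀⁺} χ(τ) = l_ε, and lim_{τ→T⁻} εχ(τ) = εl₀ for some l₀ with εl₀ ≥ εl₋ε. Assume: (i) det Q₂(τ,λ) ≠ 0 for all τ ∈ [0,τ₀] and all λ, and for τ ∈ (τ₀,T), det Q₂(τ,λ) = 0 implies ε(λ − χ(τ)) > 0; (ii) for τ ∈ (τ₀,T), if ε(λ − χ(τ)) > 0 then ε₁C₁(τ,λ) and ε₂C₂(τ,λ) are positive definite. Then there exist, for j = 1,…,n, families of continuous functions λ_{j,k} with k ranging over a (possibly empty) subset K_j ⊆ ℤ that is bounded below, each λ_{j,k} defined on an interval (t_{j,k}, T) with t_{j,k} ≥ 0 and taking values in (l₋₁,l₁), such that: ελ_{j,k} is strictly decreasing; lim_{τ→t_{j,k}⁺} λ_{j,k}(τ) = l_ε; ελ_{j,k}(τ) < ελ_{j,k+1}(τ) wherever both are defined; and for every (τ,λ) the dimension of ker Q₂(τ,λ) equals the number of pairs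 (j,k) with λ_{j,k}(τ) = λ. Consequently, if l ∈ (l₋₁,l₁) and t ∈ [0,T) satisfy det Q₂(t,l) ≠ 0, then the number of τ ∈ [0,t) at which Q₂(τ,l) is singular, counted with multiplicity dim ker Q₂(τ,l), is finite and equals the number of pairs (j,k) with t_{j,k} < t and ε(λ_{j,k}(t) − l) < 0. -/
open Matrix
noncomputable section
attribute [local instance] Matrix.normedAddCommGroup Matrix.normedSpace

/-- The standard symplectic matrix `J = [[0, −Iₙ],[Iₙ, 0]]`. -/
noncomputable def Jmat (n : ℕ) : Matrix (Fin n ⊕ Fin n) (Fin n ⊕ Fin n) ℝ :=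
  Matrix.fromBlocks 0 (-1) 1 0

/-- A `2n×2n` real matrix is symplectic if `Φ*JΦ = J`. -/
def IsSymplectic {n : ℕ} (Φ : Matrix (Fin n ⊕ Fin n) (Fin n ⊕ Fin n) ℝ) : Prop :=
  Φᵀ * Jmat n * Φ = Jmat n

section Helpers

open Filter Topology Set

/-! ### Part I : signature of symmetric matrices -/

lemma qf_apply {n : ℕ} (A : Mat n) (v : Fin n → ℝ) :
    A.toQuadraticForm' v = v ⬝ᵥ (A *ᵥ v) := by
  simp [Matrix.toQuadraticForm', LinearMap.BilinMap.toQuadraticMap_apply,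
    Matrix.toLinearMap₂'_apply']

lemma dot_symm {n : ℕ} {A : Mat n} (hA : Aᵀ = A) (u v : Fin n → ℝ) :
    u ⬝ᵥ (A *ᵥ v) = v ⬝ᵥ (A *ᵥ u) := by
  rw [Matrix.dotProduct_mulVec, ← Matrix.mulVec_transpose, hA, dotProduct_comm]

lemma radical_eq_ker {n : ℕ} {A : Mat n} (hA : Aᵀ = A) :
    A.toQuadraticForm'.radical = LinearMap.ker A.mulVecLin := by
  ext m
  rw [QuadraticMap.mem_radical_iff', LinearMap.mem_ker, Matrix.mulVecLin_apply]
  simp only [qf_apply, Matrix.mulVec_add, dotProduct_add, add_dotProduct]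
  constructor
  · rintro ⟨h0, h⟩
    have h1 : (A *ᵥ m) ⬝ᵥ (A *ᵥ m) = 0 := by
      have h2 := h (A *ᵥ m)
      have h3 := dot_symm hA m (A *ᵥ m)
      linarith
    exact dotProduct_self_eq_zero.1 h1
  · intro h
    refine ⟨by simp [h], fun v => ?_⟩
    have h3 := dot_symm hA m v
    rw [h] at h3 ⊢
    simp at h3 ⊢
    linarith

lemma sig_sum {n : ℕ} {A : Mat n} (hA : Aᵀ = A) :
    sigPos A.toQuadraticForm' + sigNeg A.toQuadraticForm'
      + Module.finrank ℝ (LinearMap.ker A.mulVecLin) = n := by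
  rw [← radical_eq_ker hA]
  have := QuadraticForm.sigPos_add_sigNeg_add_radical (Q := A.toQuadraticForm')
  simpa using this

lemma sig_mono {n : ℕ} {A B : Mat n} (hA : Aᵀ = A)
    (hAB : ∀ v : Fin n → ℝ, v ≠ 0 → v ⬝ᵥ (A *ᵥ v) < v ⬝ᵥ (B *ᵥ v)) :
    sigPos A.toQuadraticForm' + Module.finrank ℝ (LinearMap.ker A.mulVecLin)
      ≤ sigPos B.toQuadraticForm' := by
  obtain ⟨V, hV, hpos⟩ := exists_finrank_eq_sigPos_and_posDef A.toQuadraticForm'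
  set R := LinearMap.ker A.mulVecLin with hR
  have hdisj : Disjoint V R := by
    rw [Submodule.disjoint_def]
    intro x hx hxR
    by_contra hne
    have h1 := hpos ⟨x, hx⟩ (by simpa using hne)
    rw [QuadraticMap.restrict_apply, qf_apply] at h1
    have h2 : A *ᵥ x = 0 := by simpa [hR] using hxR
    simp [h2] at h1
  have hdim := Submodule.finrank_sup_add_finrank_inf_eq V R
  rw [hdisj.eq_bot] at hdim
  simp at hdim
  rw [← hV, ← hdim]
  apply le_sigPos_of_posDef
  rintro ⟨x, hx⟩ hne
  rw [QuadraticMap.restrict_apply, qf_apply]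
  have hne' : x ≠ 0 := by simpa using hne
  refine lt_of_le_of_lt ?_ (hAB x hne')
  obtain ⟨v, hv, r, hr, rfl⟩ := Submodule.mem_sup.1 hx
  have hr0 : A *ᵥ r = 0 := by simpa [hR] using hr
  have h3 := dot_symm hA r v
  simp only [Matrix.mulVec_add, add_dotProduct, hr0, add_zero]
  rw [h3, hr0, dotProduct_zero, add_zero]
  by_cases hv0 : v = 0
  · simp [hv0]
  · have h1 := hpos ⟨v, hv⟩ (by simpa using hv0)
    rw [QuadraticMap.restrict_apply, qf_apply] at h1
    exact h1.le

/-- positivity on the unit sphere of a homogeneous quadratic function -/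
lemma pos_of_sphere {n : ℕ} (A : Mat n) (V : Submodule ℝ (Fin n → ℝ))
    (h : ∀ v ∈ Metric.sphere (0 : Fin n → ℝ) 1 ∩ V, 0 < v ⬝ᵥ (A *ᵥ v)) :
    ∀ v ∈ V, v ≠ 0 → 0 < v ⬝ᵥ (A *ᵥ v) := by
  intro v hv hne
  have hnorm : 0 < ‖v‖ := norm_pos_iff.2 hne
  have h1 := h (‖v‖⁻¹ • v) ⟨by simp [norm_smul, hnorm.ne'], V.smul_mem _ hv⟩
  rw [Matrix.mulVec_smul, dotProduct_smul, smul_dotProduct, smul_eq_mul, smul_eq_mul] at h1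
  have h2 : 0 < ‖v‖⁻¹ := inv_pos.2 hnorm
  rw [mul_pos_iff_of_pos_left h2, mul_pos_iff_of_pos_left h2] at h1
  exact h1

lemma eventually_pos {n : ℕ} {X : Type*} [TopologicalSpace X] {G : X → Mat n} {p : X}
    (hG : ContinuousAt G p) (V : Submodule ℝ (Fin n → ℝ))
    (h : ∀ v ∈ V, v ≠ 0 → 0 < v ⬝ᵥ (G p *ᵥ v)) :
    ∀ᶠ q in 𝓝 p, ∀ v ∈ V, v ≠ 0 → 0 < v ⬝ᵥ (G q *ᵥ v) := by
  have hK : IsCompact (Metric.sphere (0 : Fin n → ℝ) 1 ∩ V) :=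
    (isCompact_sphere _ _).inter_right V.closed_of_finiteDimensional
  have := hK.eventually_forall_of_forall_eventually (x₀ := p)
    (P := fun q v => 0 < v ⬝ᵥ (G q *ᵥ v)) ?_
  · filter_upwards [this] with q hq
    exact pos_of_sphere _ _ hq
  · intro v hv
    have hv0 : v ≠ 0 := by
      rintro rfl
      simpa using hv.1
    have hc : ContinuousAt (fun z : X × (Fin n → ℝ) => z.2 ⬝ᵥ (G z.1 *ᵥ z.2)) (p, v) := by
      have h1 : ContinuousAt (fun z : X × (Fin n → ℝ) => G z.1) (p, v) :=
        ContinuousAt.comp (f := Prod.fst) (by exact hG) continuousAt_fst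
      have h2 : Continuous (fun y : Mat n × (Fin n → ℝ) => y.2 ⬝ᵥ (y.1 *ᵥ y.2)) := by
        fun_prop
      exact h2.continuousAt.comp (f := fun z : X × (Fin n → ℝ) => (G z.1, z.2))
        (h1.prodMk continuousAt_snd)
    exact hc.eventually_const_lt (h v hv.2 hv0)

lemma sigPos_lsc {n : ℕ} {X : Type*} [TopologicalSpace X] {G : X → Mat n} {p : X}
    (hG : ContinuousAt G p) :
    ∀ᶠ q in 𝓝 p, sigPos (G p).toQuadraticForm' ≤ sigPos (G q).toQuadraticForm' := by
  obtain ⟨V, hV, hpos⟩ := exists_finrank_eq_sigPos_and_posDef (G p).toQuadraticForm'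
  filter_upwards [eventually_pos hG V (fun v hv hv0 => by
    have h1 := hpos ⟨v, hv⟩ (by simpa using hv0)
    rwa [QuadraticMap.restrict_apply, qf_apply] at h1)] with q hq
  rw [← hV]
  apply le_sigPos_of_posDef
  rintro ⟨x, hx⟩ hne
  rw [QuadraticMap.restrict_apply, qf_apply]
  exact hq x hx (by simpa using hne)

lemma qf_neg {n : ℕ} (A : Mat n) : (-A).toQuadraticForm' = -A.toQuadraticForm' := by
  ext v
  simp [qf_apply, Matrix.neg_mulVec]

lemma sigNeg_lsc {n : ℕ} {X : Type*} [TopologicalSpace X] {G : X → Mat n} {p : X}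
    (hG : ContinuousAt G p) :
    ∀ᶠ q in 𝓝 p, sigNeg (G p).toQuadraticForm' ≤ sigNeg (G q).toQuadraticForm' := by
  have := sigPos_lsc (G := fun q => - G q) hG.neg
  simpa only [qf_neg, sigPos_neg] using this

/-! ### Part II : the local index -/

/-- Local structure of the multiplicity function `d` near `p₀`. -/
def LocalIndex (d : ℝ × ℝ → ℕ) (p₀ : ℝ × ℝ) : Prop :=
  ∃ r > 0, ∃ π π' : ℝ × ℝ → ℕ,
    (∀ p ∈ Metric.ball p₀ r, π p = π' p + d p) ∧
    (∀ p ∈ Metric.ball p₀ r, ∀ q ∈ Metric.ball p₀ r, p ≤ q → p ≠ q → π p ≤ π' q) ∧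
    (∀ p ∈ Metric.ball p₀ r, ∀ᶠ q in 𝓝 p, π' p ≤ π' q ∧ π q ≤ π p)

lemma exists_shift {n : ℕ} (Q P : Mat n) (hsym : Qᵀ * P = Pᵀ * Q)
    (hinj : ∀ w, Q *ᵥ w = 0 → P *ᵥ w = 0 → w = 0) : ∃ c : ℝ, (P + c • Q).det ≠ 0 := by
  by_contra! hcon
  have h1 : ∀ c : ℝ, ∃ w : Fin n → ℝ, w ≠ 0 ∧ (P + c • Q) *ᵥ w = 0 := fun c =>
    Matrix.exists_mulVec_eq_zero_iff.2 (hcon c)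
  choose w hw0 hw using h1
  have hPw : ∀ c, P *ᵥ (w c) = -(c • (Q *ᵥ (w c))) := by
    intro c
    have := hw c
    rw [Matrix.add_mulVec, Matrix.smul_mulVec] at this
    exact eq_neg_of_add_eq_zero_left this
  have hQne : ∀ c, Q *ᵥ (w c) ≠ 0 := by
    intro c h
    exact hw0 c (hinj _ h (by rw [hPw, h]; simp))
  have hsym' : ∀ u v : Fin n → ℝ, (Q *ᵥ u) ⬝ᵥ (P *ᵥ v) = (P *ᵥ u) ⬝ᵥ (Q *ᵥ v) := by
    intro u v
    have e1 : (Q *ᵥ u) ⬝ᵥ (P *ᵥ v) = u ⬝ᵥ ((Qᵀ * P) *ᵥ v) := by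
      rw [← Matrix.mulVec_mulVec, Matrix.dotProduct_mulVec u, Matrix.vecMul_transpose]
    have e2 : (P *ᵥ u) ⬝ᵥ (Q *ᵥ v) = u ⬝ᵥ ((Pᵀ * Q) *ᵥ v) := by
      rw [← Matrix.mulVec_mulVec, Matrix.dotProduct_mulVec u, Matrix.vecMul_transpose]
    rw [e1, e2, hsym]
  have horth : ∀ c c', c ≠ c' → (Q *ᵥ w c) ⬝ᵥ (Q *ᵥ w c') = 0 := by
    intro c c' hne
    have := hsym' (w c) (w c')
    rw [hPw, hPw] at this
    simp only [dotProduct_neg, neg_dotProduct, dotProduct_smul, smul_dotProduct,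
      smul_eq_mul] at this
    have h2 : (c - c') * ((Q *ᵥ w c) ⬝ᵥ (Q *ᵥ w c')) = 0 := by linarith
    rcases mul_eq_zero.1 h2 with h | h
    · exact absurd (sub_eq_zero.1 h) hne
    · exact h
  let f : Fin (n + 1) → EuclideanSpace ℝ (Fin n) :=
    fun i => WithLp.toLp 2 (Q *ᵥ w ((i : ℕ) : ℝ))
  have hli : LinearIndependent ℝ f := by
    apply linearIndependent_of_ne_zero_of_inner_eq_zero (𝕜 := ℝ)
    · intro i h
      apply hQne ((i : ℕ) : ℝ)
      simpa [f] using h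
    · intro i j hij
      have : ((j : ℕ) : ℝ) ≠ ((i : ℕ) : ℝ) := by
        intro h
        apply hij
        ext
        exact_mod_cast h.symm
      simpa [f, EuclideanSpace.inner_eq_star_dotProduct] using horth _ _ this
  have := hli.fintype_card_le_finrank
  simp at this

lemma exists_large {n : ℕ} (W Q : Mat n)
    (h : ∀ w, w ≠ 0 → Q *ᵥ w = 0 → 0 < w ⬝ᵥ (W *ᵥ w)) :
    ∃ c₁ : ℝ, ∀ c ≥ c₁, ∀ w, w ≠ 0 → 0 < w ⬝ᵥ ((W + c • (Qᵀ * Q)) *ᵥ w) := by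
  have hQQ : ∀ w : Fin n → ℝ, w ⬝ᵥ ((Qᵀ * Q) *ᵥ w) = (Q *ᵥ w) ⬝ᵥ (Q *ᵥ w) := by
    intro w
    rw [← Matrix.mulVec_mulVec, Matrix.dotProduct_mulVec w, Matrix.vecMul_transpose]
  have hexp : ∀ (c : ℝ) (w : Fin n → ℝ), w ⬝ᵥ ((W + c • (Qᵀ * Q)) *ᵥ w)
      = w ⬝ᵥ (W *ᵥ w) + c * ((Q *ᵥ w) ⬝ᵥ (Q *ᵥ w)) := by
    intro c w
    rw [Matrix.add_mulVec, Matrix.smul_mulVec, dotProduct_add, dotProduct_smul, hQQ, smul_eq_mul]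
  have hnn : ∀ w : Fin n → ℝ, 0 ≤ (Q *ᵥ w) ⬝ᵥ (Q *ᵥ w) := fun w => by
    simpa using dotProduct_star_self_nonneg (Q *ᵥ w)
  have hmono : ∀ (c c' : ℝ), c ≤ c' → ∀ w : Fin n → ℝ,
      w ⬝ᵥ ((W + c • (Qᵀ * Q)) *ᵥ w) ≤ w ⬝ᵥ ((W + c' • (Qᵀ * Q)) *ᵥ w) := by
    intro c c' hcc w
    rw [hexp, hexp]
    have := mul_le_mul_of_nonneg_right hcc (hnn w)
    linarith
  obtain ⟨k, hk⟩ := (isCompact_sphere (0 : Fin n → ℝ) 1).elim_directed_cover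
    (fun k : ℕ => {w : Fin n → ℝ | 0 < w ⬝ᵥ ((W + (k : ℝ) • (Qᵀ * Q)) *ᵥ w)})
    (fun k => isOpen_lt continuous_const (by fun_prop))
    (by
      intro w hw
      have hw0 : w ≠ 0 := by
        rintro rfl
        simp at hw
      rw [mem_iUnion]
      simp only [mem_ofPred_eq, hexp]
      by_cases hQ : Q *ᵥ w = 0
      · exact ⟨0, by simpa [hQ] using h w hw0 hQ⟩
      · have hp : 0 < (Q *ᵥ w) ⬝ᵥ (Q *ᵥ w) :=
          lt_of_le_of_ne (hnn w) (fun h0 => hQ (dotProduct_self_eq_zero.1 h0.symm))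
        obtain ⟨k, hk⟩ := exists_nat_gt (-(w ⬝ᵥ (W *ᵥ w)) / ((Q *ᵥ w) ⬝ᵥ (Q *ᵥ w)))
        refine ⟨k, ?_⟩
        rw [div_lt_iff₀ hp] at hk
        linarith)
    (directed_of_isDirected_le (fun i j hij w hw =>
      lt_of_lt_of_le hw (hmono _ _ (by exact_mod_cast hij) w)))
  refine ⟨k, fun c hc w hw0 => ?_⟩
  refine lt_of_lt_of_le ?_ (hmono _ _ hc w)
  exact pos_of_sphere _ ⊤ (fun v hv => hk hv.1) w trivial hw0

lemma mulVec_inv_mulVec {n : ℕ} {M : Mat n} (h : M.det ≠ 0) (v : Fin n → ℝ) :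
    M *ᵥ (M⁻¹ *ᵥ v) = v := by
  rw [Matrix.mulVec_mulVec, Matrix.mul_nonsing_inv _ (isUnit_iff_ne_zero.2 h), Matrix.one_mulVec]

lemma continuousAt_matInv {n : ℕ} {X : Type*} [TopologicalSpace X] {M : X → Mat n} {p : X}
    (hM : ContinuousAt M p) (h : (M p).det ≠ 0) : ContinuousAt (fun q => (M q)⁻¹) p := by
  simp only [Matrix.inv_def, Ring.inverse_eq_inv']
  apply ContinuousAt.fun_smul
  · have h1 : ContinuousAt (fun q => (M q).det) p :=
      ContinuousAt.comp (g := Matrix.det) (by fun_prop) hM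
    exact h1.inv₀ h
  · exact ContinuousAt.comp (g := Matrix.adjugate) (continuous_id.matrix_adjugate.continuousAt) hM

lemma sym_quot {n : ℕ} {Q M : Mat n} (hdet : M.det ≠ 0) (hsym : Mᵀ * Q = Qᵀ * M) :
    (Q * M⁻¹)ᵀ = Q * M⁻¹ := by
  have hu := isUnit_iff_ne_zero.2 hdet
  have hu' : IsUnit Mᵀ.det := by rwa [Matrix.det_transpose]
  have h1 : Mᵀ * (Q * M⁻¹) = Qᵀ := by
    rw [← mul_assoc, hsym, mul_assoc, Matrix.mul_nonsing_inv _ hu, mul_one]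
  rw [Matrix.transpose_mul, ← h1, Matrix.transpose_nonsing_inv, ← mul_assoc,
    Matrix.nonsing_inv_mul _ hu', one_mul]

lemma curve_deriv {n : ℕ} {Q M : ℝ → Mat n} {Q' M' : Mat n} {s : ℝ}
    (hQ : HasDerivAt Q Q' s) (hM : HasDerivAt M M' s) (hdet : (M s).det ≠ 0)
    (hsym : (M s)ᵀ * Q s = (Q s)ᵀ * M s) (v : Fin n → ℝ) :
    HasDerivAt (fun t => v ⬝ᵥ ((Q t * (M t)⁻¹) *ᵥ v))
      (((M s)⁻¹ *ᵥ v) ⬝ᵥ (((M s)ᵀ * Q' - (Q s)ᵀ * M') *ᵥ ((M s)⁻¹ *ᵥ v))) s := by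
  set w := (M s)⁻¹ *ᵥ v with hw
  have hMw : M s *ᵥ w = v := mulVec_inv_mulVec hdet v
  have hMc : ContinuousAt M s := hM.continuousAt
  have hdetn : ∀ᶠ t in 𝓝 s, (M t).det ≠ 0 := by
    have : ContinuousAt (fun t => (M t).det) s :=
      ContinuousAt.comp (g := Matrix.det) (by fun_prop) hMc
    exact this.eventually_ne hdet
  replace hQ := hasDerivAt_iff_tendsto_slope.1 hQ
  replace hM := hasDerivAt_iff_tendsto_slope.1 hM
  rw [hasDerivAt_iff_tendsto_slope]
  have hinv : Tendsto (fun t => (M t)⁻¹ *ᵥ v) (𝓝[≠] s) (𝓝 w) := by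
    have h1 : ContinuousAt (fun t => (M t)⁻¹) s := continuousAt_matInv hMc hdet
    have h2 : Continuous (fun A : Mat n => A *ᵥ v) := by fun_prop
    exact ((h2.continuousAt.comp (f := fun t => (M t)⁻¹) h1).tendsto).mono_left nhdsWithin_le_nhds
  have hc : Continuous (fun y : Mat n × Mat n × (Fin n → ℝ) =>
      w ⬝ᵥ (((M s)ᵀ * y.1 - (Q s)ᵀ * y.2.1) *ᵥ y.2.2)) := by fun_prop
  have hlim := (hc.tendsto (Q', M', w)).comp (hQ.prodMk_nhds (hM.prodMk_nhds hinv))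
  refine hlim.congr' ?_
  filter_upwards [self_mem_nhdsWithin, nhdsWithin_le_nhds hdetn] with t hts htdet
  have hMt : M t *ᵥ ((M t)⁻¹ *ᵥ v) = v := mulVec_inv_mulVec htdet v
  simp only [Function.comp, slope_def_module]
  set h := (M t)⁻¹ *ᵥ v with hh
  have hts' : t - s ≠ 0 := sub_ne_zero.2 hts
  rw [← Matrix.mulVec_mulVec, ← Matrix.mulVec_mulVec, ← hw, ← hh]
  have e1 : w ⬝ᵥ (((M s)ᵀ * ((t - s)⁻¹ • (Q t - Q s)) - (Q s)ᵀ * ((t - s)⁻¹ • (M t - M s))) *ᵥ h)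
     = (t - s)⁻¹ * (w ⬝ᵥ (((M s)ᵀ * Q t) *ᵥ h) - w ⬝ᵥ (((Q s)ᵀ * M t) *ᵥ h)) := by
    have : (M s)ᵀ * ((t - s)⁻¹ • (Q t - Q s)) - (Q s)ᵀ * ((t - s)⁻¹ • (M t - M s))
      = (t - s)⁻¹ • ((M s)ᵀ * Q t - (Q s)ᵀ * M t) := by
      rw [Matrix.mul_smul, Matrix.mul_smul, ← smul_sub, mul_sub, mul_sub, hsym]
      congr 1
      abel
    rw [this, Matrix.smul_mulVec, dotProduct_smul, Matrix.sub_mulVec, dotProduct_sub, smul_eq_mul]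
  have e2 : w ⬝ᵥ (((M s)ᵀ * Q t) *ᵥ h) = v ⬝ᵥ (Q t *ᵥ h) := by
    rw [← Matrix.mulVec_mulVec, Matrix.dotProduct_mulVec w, Matrix.vecMul_transpose, hMw]
  have e3 : w ⬝ᵥ (((Q s)ᵀ * M t) *ᵥ h) = v ⬝ᵥ (Q s *ᵥ w) := by
    rw [← Matrix.mulVec_mulVec, hMt, Matrix.dotProduct_mulVec w, Matrix.vecMul_transpose,
      dotProduct_comm]
  rw [e1, e2, e3]
  simp [smul_eq_mul]

lemma finrank_ker_mul_inv {n : ℕ} (Q M : Mat n) (hdet : M.det ≠ 0) :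
    Module.finrank ℝ (LinearMap.ker (Q * M⁻¹).mulVecLin)
      = Module.finrank ℝ (LinearMap.ker Q.mulVecLin) := by
  have h1 := LinearMap.finrank_range_add_finrank_ker (Q * M⁻¹).mulVecLin
  have h2 := LinearMap.finrank_range_add_finrank_ker Q.mulVecLin
  have h3 : (Q * M⁻¹).rank = Q.rank :=
    Matrix.rank_mul_eq_left_of_isUnit_det _ _
      (by rw [Matrix.isUnit_nonsing_inv_det_iff]; exact isUnit_iff_ne_zero.2 hdet)
  unfold Matrix.rank at h3
  omega

/-- Continuity of the directional derivative. -/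
lemma continuousAt_fderiv_dir {n : ℕ} {Q : ℝ × ℝ → Mat n} {p₀ : ℝ × ℝ}
    (hQ : ContDiffAt ℝ 1 Q p₀) (e : ℝ × ℝ) :
    ContinuousAt (fun p => fderiv ℝ Q p e) p₀ := by
  have h1 : ContinuousAt (fderiv ℝ Q) p₀ :=
    (hQ.fderiv_right (m := 0) (by norm_num)).continuousAt
  exact h1.clm_apply continuousAt_const

theorem localIndex_of_matrix {n : ℕ} (Q P : ℝ × ℝ → Mat n) (p₀ : ℝ × ℝ)
    (hQ : ContDiffAt ℝ 1 Q p₀) (hP : ContDiffAt ℝ 1 P p₀)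
    (hsym : ∀ᶠ p in 𝓝 p₀, (Q p)ᵀ * P p = (P p)ᵀ * Q p)
    (hinj : ∀ w, Q p₀ *ᵥ w = 0 → P p₀ *ᵥ w = 0 → w = 0)
    (hpos₁ : ∀ w, w ≠ 0 → Q p₀ *ᵥ w = 0 →
      0 < (P p₀ *ᵥ w) ⬝ᵥ (fderiv ℝ Q p₀ (1, 0) *ᵥ w))
    (hpos₂ : ∀ w, w ≠ 0 → Q p₀ *ᵥ w = 0 →
      0 < (P p₀ *ᵥ w) ⬝ᵥ (fderiv ℝ Q p₀ (0, 1) *ᵥ w)) :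
    LocalIndex (fun p => Module.finrank ℝ (LinearMap.ker (Q p).mulVecLin)) p₀ := by
  obtain ⟨c₀, hc₀⟩ := exists_shift (Q p₀) (P p₀) hsym.self_of_nhds hinj
  set Wr : ℝ × ℝ → ℝ × ℝ → Mat n :=
    fun e p => (P p)ᵀ * fderiv ℝ Q p e - (Q p)ᵀ * fderiv ℝ P p e with hWr
  have hWpos : ∀ e : ℝ × ℝ,
      (∀ w, w ≠ 0 → Q p₀ *ᵥ w = 0 → 0 < (P p₀ *ᵥ w) ⬝ᵥ (fderiv ℝ Q p₀ e *ᵥ w)) →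
      ∀ w, w ≠ 0 → Q p₀ *ᵥ w = 0 → 0 < w ⬝ᵥ (Wr e p₀ *ᵥ w) := by
    intro e he w hw hQw
    have := he w hw hQw
    simp only [hWr]
    rw [Matrix.sub_mulVec, dotProduct_sub, ← Matrix.mulVec_mulVec, ← Matrix.mulVec_mulVec,
      Matrix.dotProduct_mulVec w, Matrix.vecMul_transpose, Matrix.dotProduct_mulVec w,
      Matrix.vecMul_transpose, hQw, zero_dotProduct, sub_zero]
    exact this
  obtain ⟨c₁, hc₁⟩ := exists_large (Wr (1, 0) p₀) (Q p₀) (hWpos _ hpos₁)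
  obtain ⟨c₂, hc₂⟩ := exists_large (Wr (0, 1) p₀) (Q p₀) (hWpos _ hpos₂)
  set c := max c₁ c₂
  set α : ℝ × ℝ → ℝ := fun p => c₀ - c * ((p.1 - p₀.1) + (p.2 - p₀.2)) with hα
  set M : ℝ × ℝ → Mat n := fun p => P p + α p • Q p with hM
  have hαc : Continuous α := by fun_prop
  have hQc := hQ.continuousAt
  have hPc := hP.continuousAt
  have hMp₀ : (M p₀).det ≠ 0 := by simpa [hM, hα] using hc₀
  have hMc : ∀ p, ContinuousAt Q p → ContinuousAt P p → ContinuousAt M p := fun p h1 h2 =>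
    h2.add (hαc.continuousAt.smul h1)
  have hdet : ∀ᶠ p in 𝓝 p₀, (M p).det ≠ 0 := by
    have : ContinuousAt (fun p => (M p).det) p₀ :=
      ContinuousAt.comp (g := Matrix.det) (by fun_prop) (hMc p₀ hQc hPc)
    exact this.eventually_ne hMp₀
  have hev : ∀ e : ℝ × ℝ, (∀ w, w ≠ 0 → 0 < w ⬝ᵥ ((Wr e p₀ + c • ((Q p₀)ᵀ * Q p₀)) *ᵥ w)) →
      ∀ᶠ p in 𝓝 p₀, ∀ w, w ≠ 0 → 0 < w ⬝ᵥ ((Wr e p + c • ((Q p)ᵀ * Q p)) *ᵥ w) := by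
    intro e he
    have h1 := continuousAt_fderiv_dir hQ e
    have h2 := continuousAt_fderiv_dir hP e
    have hcont : ContinuousAt (fun p => Wr e p + c • ((Q p)ᵀ * Q p)) p₀ := by
      have hc : Continuous (fun y : Mat n × Mat n × Mat n × Mat n =>
        (y.1ᵀ * y.2.1 - y.2.2.1ᵀ * y.2.2.2) + c • (y.2.2.1ᵀ * y.2.2.1)) := by fun_prop
      exact hc.continuousAt.comp
        (f := fun p => (P p, fderiv ℝ Q p e, Q p, fderiv ℝ P p e))
        (hPc.prodMk (h1.prodMk (hQc.prodMk h2)))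
    have := eventually_pos hcont ⊤ (fun v _ hv => he v hv)
    filter_upwards [this] with p hp w hw
    exact hp w trivial hw
  have hdiffQ : ∀ᶠ p in 𝓝 p₀, DifferentiableAt ℝ Q p :=
    (hQ.eventually (by simp)).mono fun p hp => hp.differentiableAt (by simp)
  have hdiffP : ∀ᶠ p in 𝓝 p₀, DifferentiableAt ℝ P p :=
    (hP.eventually (by simp)).mono fun p hp => hp.differentiableAt (by simp)
  obtain ⟨r, hr, hball⟩ := Metric.eventually_nhds_iff_ball.1
    (hsym.and (hdet.and ((hev (1, 0) (hc₁ c (le_max_left _ _))).and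
      ((hev (0, 1) (hc₂ c (le_max_right _ _))).and (hdiffQ.and hdiffP)))))
  have hMsym : ∀ p ∈ Metric.ball p₀ r, (M p)ᵀ * Q p = (Q p)ᵀ * M p := by
    intro p hp
    simp only [hM]
    rw [Matrix.transpose_add, add_mul, mul_add, (hball p hp).1, Matrix.transpose_smul,
      Matrix.smul_mul, Matrix.mul_smul]
  have hGsym : ∀ p ∈ Metric.ball p₀ r, (Q p * (M p)⁻¹)ᵀ = Q p * (M p)⁻¹ := fun p hp =>
    sym_quot (hball p hp).2.1 (hMsym p hp)
  have hstep : ∀ e : ℝ × ℝ, e.1 + e.2 = 1 →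
      (∀ p ∈ Metric.ball p₀ r, ∀ w, w ≠ 0 →
        0 < w ⬝ᵥ ((Wr e p + c • ((Q p)ᵀ * Q p)) *ᵥ w)) →
      ∀ p ∈ Metric.ball p₀ r, ∀ t : ℝ, 0 < t → p + t • e ∈ Metric.ball p₀ r → ∀ v, v ≠ 0 →
      v ⬝ᵥ ((Q p * (M p)⁻¹) *ᵥ v)
        < v ⬝ᵥ ((Q (p + t • e) * (M (p + t • e))⁻¹) *ᵥ v) := by
    intro e he1 he p hp t ht hpt v hv
    have hmem : ∀ s ∈ Set.Icc 0 t, p + s • e ∈ Metric.ball p₀ r := by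
      intro s hs
      have hconv := convex_ball p₀ r
      have hst : s / t ∈ Set.Icc (0 : ℝ) 1 :=
        ⟨div_nonneg hs.1 ht.le, (div_le_one ht).2 hs.2⟩
      have := hconv.add_smul_sub_mem hp hpt hst
      convert this using 2
      rw [add_sub_cancel_left, smul_smul, div_mul_cancel₀ _ ht.ne']
    have hder : ∀ s ∈ Set.Icc 0 t, ∃ D > 0, HasDerivAt
        (fun s => v ⬝ᵥ ((Q (p + s • e) * (M (p + s • e))⁻¹) *ᵥ v)) D s := by
      intro s hs
      set q := p + s • e with hq
      obtain ⟨h1, h2, -, -, h5, h6⟩ := hball q (hmem s hs)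
      have hline : HasDerivAt (fun s : ℝ => p + s • e) e s := by
        simpa using ((hasDerivAt_id s).smul_const e).const_add p
      have dQ : HasDerivAt (fun s => Q (p + s • e)) (fderiv ℝ Q q e) s :=
        h5.hasFDerivAt.comp_hasDerivAt s hline
      have dP : HasDerivAt (fun s => P (p + s • e)) (fderiv ℝ P q e) s :=
        h6.hasFDerivAt.comp_hasDerivAt s hline
      have dα : HasDerivAt (fun s => α (p + s • e)) (-c) s := by
        have e1 : (fun s => α (p + s • e))
            = fun s => (c₀ - c * ((p.1 - p₀.1) + (p.2 - p₀.2))) + s * (-c) := by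
          funext s
          simp only [hα, Prod.fst_add, Prod.snd_add, Prod.smul_fst, Prod.smul_snd, smul_eq_mul]
          linear_combination (-c * s) * he1
        rw [e1]
        simpa using ((hasDerivAt_id s).mul_const (-c)).const_add
          (c₀ - c * ((p.1 - p₀.1) + (p.2 - p₀.2)))
      have dM : HasDerivAt (fun s => M (p + s • e))
          (fderiv ℝ P q e + (α q • fderiv ℝ Q q e + (-c) • Q q)) s :=
        dP.add (dα.smul dQ)
      refine ⟨_, ?_, curve_deriv dQ dM h2 (hMsym q (hmem s hs)) v⟩
      have hw : (M q)⁻¹ *ᵥ v ≠ 0 := by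
        intro h0
        apply hv
        rw [← mulVec_inv_mulVec h2 v, h0, Matrix.mulVec_zero]
      have := he q (hmem s hs) _ hw
      convert this using 4
      simp only [hWr, hM, ← hq]
      simp only [Matrix.transpose_add, Matrix.transpose_smul, add_mul, mul_add, Matrix.smul_mul,
        Matrix.mul_smul, neg_smul, mul_neg]
      abel
    have hmono : StrictMonoOn
        (fun s => v ⬝ᵥ ((Q (p + s • e) * (M (p + s • e))⁻¹) *ᵥ v)) (Set.Icc 0 t) := by
      apply strictMonoOn_of_deriv_pos (convex_Icc 0 t)
      · intro s hs
        obtain ⟨D, -, hD⟩ := hder s hs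
        exact hD.continuousAt.continuousWithinAt
      · intro s hs
        obtain ⟨D, hD0, hD⟩ := hder s (interior_subset hs)
        rw [hD.deriv]
        exact hD0
    have := hmono (Set.left_mem_Icc.2 ht.le) (Set.right_mem_Icc.2 ht.le) ht
    simpa using this
  refine ⟨r, hr, fun p => sigPos (Q p * (M p)⁻¹).toQuadraticForm'
    + Module.finrank ℝ (LinearMap.ker (Q p * (M p)⁻¹).mulVecLin),
    fun p => sigPos (Q p * (M p)⁻¹).toQuadraticForm', ?_, ?_, ?_⟩
  · intro p hp
    simp only [finrank_ker_mul_inv _ _ (hball p hp).2.1]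
  · intro p hp q hq hpq hne
    apply sig_mono (hGsym p hp)
    intro v hv
    have hm : ((q.1, p.2) : ℝ × ℝ) ∈ Metric.ball p₀ r := by
      rw [← ball_prod_same] at hp hq ⊢
      exact ⟨hq.1, hp.2⟩
    have s1 : p.1 < q.1 → v ⬝ᵥ ((Q p * (M p)⁻¹) *ᵥ v)
        < v ⬝ᵥ ((Q (q.1, p.2) * (M (q.1, p.2))⁻¹) *ᵥ v) := by
      intro hlt
      have e1 : p + (q.1 - p.1) • ((1, 0) : ℝ × ℝ) = (q.1, p.2) := by ext <;> simp
      have := hstep (1, 0) (by simp) (fun p hp => (hball p hp).2.2.1) p hp (q.1 - p.1)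
        (by linarith) (by rwa [e1]) v hv
      rwa [e1] at this
    have s2 : p.2 < q.2 → v ⬝ᵥ ((Q (q.1, p.2) * (M (q.1, p.2))⁻¹) *ᵥ v)
        < v ⬝ᵥ ((Q q * (M q)⁻¹) *ᵥ v) := by
      intro hlt
      have e1 : (q.1, p.2) + (q.2 - p.2) • ((0, 1) : ℝ × ℝ) = q := by ext <;> simp
      have := hstep (0, 1) (by simp) (fun p hp => (hball p hp).2.2.2.1) (q.1, p.2) hm (q.2 - p.2)
        (by linarith) (by rwa [e1]) v hv
      rwa [e1] at this
    rcases hpq.1.lt_or_eq with h1 | h1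
    · rcases hpq.2.lt_or_eq with h2 | h2
      · exact (s1 h1).trans (s2 h2)
      · have : (q.1, p.2) = q := by ext <;> simp [h2]
        rw [← this]
        simpa using s1 h1
    · rcases hpq.2.lt_or_eq with h2 | h2
      · have : (q.1, p.2) = p := by ext <;> simp [h1]
        rw [this] at s2
        exact s2 h2
      · exact absurd (Prod.ext h1 h2) hne
  · intro p hp
    have hGc : ContinuousAt (fun p => Q p * (M p)⁻¹) p := by
      obtain ⟨h1, h2, -, -, h5, h6⟩ := hball p hp
      exact h5.continuousAt.mul
        (continuousAt_matInv (hMc p h5.continuousAt h6.continuousAt) h2)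
    filter_upwards [sigPos_lsc hGc, sigNeg_lsc hGc, Metric.isOpen_ball.mem_nhds hp] with q h1 h2 hq
    refine ⟨h1, ?_⟩
    have e1 := sig_sum (hGsym p hp)
    have e2 := sig_sum (hGsym q hq)
    omega

/-! ### One-dimensional counting -/

/-- Weighted number of points up to `x`. -/
def cnt (f : ℝ → ℕ) (x : ℝ) : ℕ := ∑ᶠ y ∈ Set.Iic x, f y
/-- Weighted number of points strictly below `x`. -/
def cntp (f : ℝ → ℕ) (x : ℝ) : ℕ := ∑ᶠ y ∈ Set.Iio x, f y

def FinBelow (f : ℝ → ℕ) (x : ℝ) : Prop := (Set.Iic x ∩ Function.support f).Finite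

lemma FinBelow.mono {f : ℝ → ℕ} {x y : ℝ} (h : FinBelow f y) (hxy : x ≤ y) : FinBelow f x :=
  Set.Finite.subset h (by
    rintro z ⟨h1, h2⟩
    exact ⟨le_trans h1 hxy, h2⟩)

lemma cnt_eq {f : ℝ → ℕ} {x : ℝ} (h : FinBelow f x) : cnt f x = cntp f x + f x := by
  unfold cnt cntp
  have : Set.Iic x = insert x (Set.Iio x) := by rw [Set.Iio_insert]
  rw [this, finsum_mem_insert' f (by simp)
    (Set.Finite.subset h (by rintro z ⟨h1, h2⟩; exact ⟨(Set.mem_Iio.1 h1).le, h2⟩)), add_comm]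

lemma cntp_eq {f : ℝ → ℕ} {x y : ℝ} (h : FinBelow f y) (hxy : x < y) :
    cntp f y = cnt f x + ∑ᶠ z ∈ Set.Ioo x y, f z := by
  unfold cnt cntp
  rw [← Set.Iic_union_Ioo_eq_Iio hxy]
  apply finsum_mem_union'
  · rw [Set.disjoint_left]
    intro z h1 h2
    exact absurd h2.1 (not_lt.2 h1)
  · exact h.mono hxy.le
  · exact Set.Finite.subset h (by rintro z ⟨h1, h2⟩; exact ⟨le_of_lt h1.2, h2⟩)

lemma cnt_le_cntp {f : ℝ → ℕ} {x y : ℝ} (h : FinBelow f y) (hxy : x < y) :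
    cnt f x ≤ cntp f y := by
  rw [cntp_eq h hxy]; exact Nat.le_add_right _ _

lemma cntp_eq_cnt {f : ℝ → ℕ} {x y : ℝ} (h : FinBelow f y) (hxy : x < y)
    (h0 : ∀ z ∈ Set.Ioo x y, f z = 0) : cntp f y = cnt f x := by
  rw [cntp_eq h hxy, finsum_mem_eq_zero_of_forall_eq_zero h0, add_zero]

lemma cnt_eq_zero {f : ℝ → ℕ} {x : ℝ} (h0 : ∀ z ≤ x, f z = 0) : cnt f x = 0 :=
  finsum_mem_eq_zero_of_forall_eq_zero h0

/-- jump condition at `x`. -/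
def Jump (f g g' : ℝ → ℕ) (x : ℝ) : Prop :=
  (∀ᶠ y in 𝓝[>] x, f y = 0 ∧ g y = g x) ∧ (∀ᶠ y in 𝓝[<] x, f y = 0 ∧ g y = g' x) ∧
    g x = g' x + f x

lemma jump_of {f g g' : ℝ → ℕ} {x : ℝ}
    (h : ∀ᶠ y in 𝓝 x, g y = g' y + f y ∧ (x < y → g x ≤ g' y) ∧ (y < x → g y ≤ g' x) ∧
      g' x ≤ g' y ∧ g y ≤ g x) : Jump f g g' x := by
  refine ⟨?_, ?_, h.self_of_nhds.1⟩
  · filter_upwards [nhdsWithin_le_nhds h, self_mem_nhdsWithin] with y hy hxy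
    have := hy.2.1 hxy
    omega
  · filter_upwards [nhdsWithin_le_nhds h, self_mem_nhdsWithin] with y hy hxy
    have := hy.2.2.1 hxy
    omega

lemma finBelow_of {f : ℝ → ℕ} {x₀ x : ℝ} (h0 : ∀ z ≤ x₀, f z = 0)
    (h : ∀ y ∈ Set.Icc x₀ x, ∃ g g', Jump f g g' y) : FinBelow f x := by
  have h1 : (Set.Icc x₀ x ∩ Function.support f).Finite := by
    refine (isCompact_Icc (a := x₀) (b := x)).induction_on
      (p := fun s => (s ∩ Function.support f).Finite) (by simp) ?_ ?_ ?_
    · intro s t hst ht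
      exact ht.subset (Set.inter_subset_inter_left _ hst)
    · intro s t hs ht
      rw [Set.union_inter_distrib_right]
      exact hs.union ht
    · intro y hy
      obtain ⟨g, g', hr, hl, -⟩ := h y hy
      refine ⟨{z | z ≠ y → f z = 0}, ?_, ?_⟩
      · apply mem_nhdsWithin_of_mem_nhds
        rw [eventually_nhdsWithin_iff] at hr hl
        filter_upwards [hr, hl] with z h1 h2 hne
        rcases lt_or_gt_of_ne hne with h3 | h3
        · exact (h2 h3).1
        · exact (h1 h3).1
      · refine (Set.finite_singleton y).subset ?_
        rintro z ⟨h1, h2⟩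
        by_contra h3
        exact h2 (h1 h3)
  refine h1.subset ?_
  rintro z ⟨hz1, hz2⟩
  refine ⟨⟨?_, hz1⟩, hz2⟩
  by_contra h3
  exact hz2 (h0 z (not_le.1 h3).le)

lemma cnt_local {f g g' : ℝ → ℕ} {x : ℝ} (hj : Jump f g g' x)
    (hf : ∀ᶠ y in 𝓝 x, FinBelow f y) :
    ∀ᶠ y in 𝓝 x, (cnt f y : ℤ) - g y = cnt f x - g x := by
  obtain ⟨hr, hl, he⟩ := hj
  rw [Filter.eventually_iff_exists_mem] at hf
  obtain ⟨v, hv, hv'⟩ := hf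
  obtain ⟨u, hu, hu'⟩ := mem_nhdsGT_iff_exists_Ioo_subset.1 hr
  obtain ⟨w, hw, hw'⟩ := mem_nhdsLT_iff_exists_Ioo_subset.1 hl
  filter_upwards [hv, Ioo_mem_nhds hw hu] with y hy hyy
  have hfy := hv' y hy
  have hfx := hv' x (mem_of_mem_nhds hv)
  rcases lt_trichotomy x y with h | h | h
  · have h1 := hu' (show y ∈ Set.Ioo x u from ⟨h, hyy.2⟩)
    have h2 := cntp_eq_cnt hfy h (fun z hz => (hu' (show z ∈ Set.Ioo x u from
      ⟨hz.1, hz.2.trans hyy.2⟩)).1)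
    have h3 := cnt_eq hfy
    have := h1.1; have := h1.2
    omega
  · subst h; rfl
  · have h1 := hw' (show y ∈ Set.Ioo w x from ⟨hyy.1, h⟩)
    have h2 := cntp_eq_cnt hfx h (fun z hz => (hw' (show z ∈ Set.Ioo w x from
      ⟨hyy.1.trans hz.1, hz.2⟩)).1)
    have h3 := cnt_eq hfx
    have := h1.1; have := h1.2
    omega

lemma const_of_local {s : Set ℝ} (hs : IsPreconnected s) (G : ℝ → ℤ)
    (h : ∀ x ∈ s, ∀ᶠ y in 𝓝 x, G y = G x) : ∀ x ∈ s, ∀ y ∈ s, G x = G y := by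
  intro x hx y hy
  refine hs.induction₂ (fun x y => G x = G y) ?_ ?_ ?_ hx hy
  · intro x hx
    exact nhdsWithin_le_nhds ((h x hx).mono fun y hy => hy.symm)
  · intro x y z _ _ _ h1 h2
    exact h1.trans h2
  · intro x y _ _ h1
    exact h1.symm

lemma cnt_const {f g g' : ℝ → ℕ} {s : Set ℝ} (hs : IsPreconnected s) (hso : IsOpen s)
    (hj : ∀ x ∈ s, Jump f g g' x) (hf : ∀ x ∈ s, FinBelow f x) :
    ∀ x ∈ s, ∀ y ∈ s, (cnt f x : ℤ) - g x = cnt f y - g y := by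
  apply const_of_local hs (fun x => (cnt f x : ℤ) - g x)
  intro x hx
  exact cnt_local (hj x hx) (Filter.mem_of_superset (hso.mem_nhds hx) hf)

/-! ### The two-dimensional counting function -/

structure Setup (d : ℝ → ℝ → ℕ) (I : Set ℝ) (a b τ₀ : ℝ) : Prop where
  openI : IsOpen I
  lowerI : ∀ t ∈ I, ∀ s ≤ t, s ∈ I
  hab : a < b
  hloc : ∀ τ ∈ I, ∀ x ∈ Set.Ioo a b, LocalIndex (fun p => d p.1 p.2) (τ, x)
  hbot : ∀ t ∈ I, ∃ xt ∈ Set.Ioo a b, ∀ τ ≤ t, ∀ x ≤ xt, d τ x = 0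
  hleft : ∀ τ ≤ τ₀, ∀ x, d τ x = 0

/-- Data of `LocalIndex` on the ball of radius `r`. -/
def IndexOn (d π π' : ℝ × ℝ → ℕ) (p₀ : ℝ × ℝ) (r : ℝ) : Prop :=
    (∀ p ∈ Metric.ball p₀ r, π p = π' p + d p) ∧
    (∀ p ∈ Metric.ball p₀ r, ∀ q ∈ Metric.ball p₀ r, p ≤ q → p ≠ q → π p ≤ π' q) ∧
    (∀ p ∈ Metric.ball p₀ r, ∀ᶠ q in 𝓝 p, π' p ≤ π' q ∧ π q ≤ π p)

lemma IndexOn.mono {d π π' : ℝ × ℝ → ℕ} {p₀ p₁ : ℝ × ℝ} {r s : ℝ} (h : IndexOn d π π' p₀ r)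
    (hs : Metric.ball p₁ s ⊆ Metric.ball p₀ r) : IndexOn d π π' p₁ s :=
  ⟨fun p hp => h.1 p (hs hp), fun p hp q hq => h.2.1 p (hs hp) q (hs hq),
    fun p hp => h.2.2 p (hs hp)⟩

lemma IndexOn.eventually {d π π' : ℝ × ℝ → ℕ} {p₀ : ℝ × ℝ} {r : ℝ} (h : IndexOn d π π' p₀ r)
    {p : ℝ × ℝ} (hp : p ∈ Metric.ball p₀ r) :
    ∀ᶠ q in 𝓝 p, π q = π' q + d q ∧ (p ≤ q → p ≠ q → π p ≤ π' q) ∧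
      (q ≤ p → q ≠ p → π q ≤ π' p) ∧ π' p ≤ π' q ∧ π q ≤ π p := by
  filter_upwards [h.2.2 p hp, Metric.isOpen_ball.mem_nhds hp] with q h1 h2
  exact ⟨h.1 q h2, h.2.1 p hp q h2, h.2.1 q h2 p hp, h1⟩

lemma IndexOn.jump_x {d π π' : ℝ × ℝ → ℕ} {p₀ : ℝ × ℝ} {r : ℝ} (h : IndexOn d π π' p₀ r)
    {τ x : ℝ} (hp : (τ, x) ∈ Metric.ball p₀ r) :
    Jump (fun y => d (τ, y)) (fun y => π (τ, y)) (fun y => π' (τ, y)) x := by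
  apply jump_of
  have hc : ContinuousAt (fun y : ℝ => (τ, y)) x := by fun_prop
  filter_upwards [hc.eventually (h.eventually hp)] with y hy
  refine ⟨hy.1, fun hxy => hy.2.1 ⟨le_rfl, hxy.le⟩ ?_, fun hxy => hy.2.2.1 ⟨le_rfl, hxy.le⟩ ?_,
    hy.2.2.2⟩
  · intro h; exact hxy.ne (congrArg Prod.snd h)
  · intro h; exact hxy.ne (congrArg Prod.snd h)

lemma IndexOn.jump_t {d π π' : ℝ × ℝ → ℕ} {p₀ : ℝ × ℝ} {r : ℝ} (h : IndexOn d π π' p₀ r)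
    {τ x : ℝ} (hp : (τ, x) ∈ Metric.ball p₀ r) :
    Jump (fun s => d (s, x)) (fun s => π (s, x)) (fun s => π' (s, x)) τ := by
  apply jump_of
  have hc : ContinuousAt (fun y : ℝ => (y, x)) τ := by fun_prop
  filter_upwards [hc.eventually (h.eventually hp)] with y hy
  refine ⟨hy.1, fun hxy => hy.2.1 ⟨hxy.le, le_rfl⟩ ?_, fun hxy => hy.2.2.1 ⟨hxy.le, le_rfl⟩ ?_,
    hy.2.2.2⟩
  · intro h; exact hxy.ne (congrArg Prod.fst h)
  · intro h; exact hxy.ne (congrArg Prod.fst h)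

section
variable {d : ℝ → ℝ → ℕ} {I : Set ℝ} {a b τ₀ : ℝ}

lemma Setup.finBelow (h : Setup d I a b τ₀) {τ : ℝ} (hτ : τ ∈ I) {x : ℝ} (hx : x < b) :
    FinBelow (d τ) x := by
  obtain ⟨xt, hxt, h0⟩ := h.hbot τ hτ
  apply finBelow_of (h0 τ le_rfl)
  intro y hy
  obtain ⟨r, hr, π, π', hπ⟩ := h.hloc τ hτ y ⟨hxt.1.trans_le hy.1, hy.2.trans_lt hx⟩
  exact ⟨_, _, IndexOn.jump_x (d := fun p => d p.1 p.2) hπ (Metric.mem_ball_self hr)⟩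

def NN (d : ℝ → ℝ → ℕ) (p : ℝ × ℝ) : ℕ := cnt (d p.1) p.2
def NP (d : ℝ → ℝ → ℕ) (p : ℝ × ℝ) : ℕ := cntp (d p.1) p.2

lemma Setup.NN_eq (h : Setup d I a b τ₀) {p : ℝ × ℝ} (hτ : p.1 ∈ I) (hx : p.2 < b) :
    NN d p = NP d p + d p.1 p.2 := cnt_eq (h.finBelow hτ hx)

def Good (d : ℝ → ℝ → ℕ) (p : ℝ × ℝ) : Prop :=
  ∃ r > 0, IndexOn (fun p => d p.1 p.2) (NN d) (NP d) p r

lemma Good.eventually_nhds {p : ℝ × ℝ} (h : Good d p) : ∀ᶠ q in 𝓝 p, Good d q := by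
  obtain ⟨r, hr, hi⟩ := h
  filter_upwards [Metric.ball_mem_nhds p hr] with q hq
  refine ⟨r - dist q p, by simpa using hq, hi.mono (Metric.ball_subset_ball' (by linarith))⟩

lemma Setup.dom_nhds (h : Setup d I a b τ₀) {p : ℝ × ℝ} (hτ : p.1 ∈ I) (hx : p.2 ∈ Set.Ioo a b) :
    ∀ᶠ q in 𝓝 p, q.1 ∈ I ∧ q.2 ∈ Set.Ioo a b :=
  (h.openI.prod isOpen_Ioo).mem_nhds (show p ∈ I ×ˢ Set.Ioo a b from ⟨hτ, hx⟩)

/-- The key propagation step. -/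
lemma Setup.good_of (h : Setup d I a b τ₀) {τ y y' r : ℝ} (hτ : τ ∈ I) (hy : y ∈ Set.Ioo a b)
    {π π' : ℝ × ℝ → ℕ}
    (hπ : IndexOn (fun p => d p.1 p.2) π π' (τ, y) r) (hr : 0 < r)
    (hdom : ∀ p ∈ Metric.ball ((τ, y) : ℝ × ℝ) r, p.1 ∈ I ∧ p.2 ∈ Set.Ioo a b)
    (hy' : y' ∈ Metric.ball y r) (hg : Good d (τ, y')) : Good d (τ, y) := by
  have hball : Metric.ball ((τ, y) : ℝ × ℝ) r = Metric.ball τ r ×ˢ Metric.ball y r :=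
    (ball_prod_same τ y r).symm
  -- move to a point where `d` vanishes
  obtain ⟨y₁, hy₁, hg₁, hd₁⟩ : ∃ y₁ ∈ Metric.ball y r, Good d (τ, y₁) ∧ d τ y₁ = 0 := by
    have hm : (τ, y') ∈ Metric.ball ((τ, y) : ℝ × ℝ) r := by
      rw [hball]; exact ⟨Metric.mem_ball_self hr, hy'⟩
    have hj := (hπ.jump_x hm).1
    have hc : ContinuousAt (fun y : ℝ => (τ, y)) y' := by fun_prop
    have h1 : ∀ᶠ z in 𝓝[>] y', Good d (τ, z) := nhdsWithin_le_nhds (hc.eventually hg.eventually_nhds)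
    have h2 : ∀ᶠ z in 𝓝[>] y', z ∈ Metric.ball y r :=
      nhdsWithin_le_nhds (Metric.isOpen_ball.mem_nhds hy')
    obtain ⟨z, hz⟩ := (hj.and (h1.and h2)).exists
    exact ⟨z, hz.2.2, hz.2.1, hz.1.1⟩
  have hm₁ : (τ, y₁) ∈ Metric.ball ((τ, y) : ℝ × ℝ) r := by
    rw [hball]; exact ⟨Metric.mem_ball_self hr, hy₁⟩
  -- `NN - π` does not depend on `x` in the ball
  have hV2 : ∀ s ∈ Metric.ball τ r, ∀ x ∈ Metric.ball y r, ∀ x' ∈ Metric.ball y r,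
      (NN d (s, x) : ℤ) - π (s, x) = NN d (s, x') - π (s, x') := by
    intro s hs
    have hm : ∀ x ∈ Metric.ball y r, (s, x) ∈ Metric.ball ((τ, y) : ℝ × ℝ) r := by
      intro x hx; rw [hball]; exact ⟨hs, hx⟩
    exact cnt_const (f := d s) (g := fun x => π (s, x)) (g' := fun x => π' (s, x))
      (convex_ball y r).isPreconnected Metric.isOpen_ball
      (fun x hx => hπ.jump_x (hm x hx))
      (fun x hx => h.finBelow (hdom _ (hm x hx)).1 (hdom _ (hm x hx)).2.2)
  -- `NN - π` is locally constant in `τ`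
  have hloc : ∀ᶠ s in 𝓝 τ, (NN d (s, y₁) : ℤ) - π (s, y₁) = NN d (τ, y₁) - π (τ, y₁) := by
    have hc : ContinuousAt (fun s : ℝ => (s, y₁)) τ := by fun_prop
    obtain ⟨r₁, hr₁, hi₁⟩ := hg₁
    have e1 := hc.eventually (hi₁.eventually (Metric.mem_ball_self hr₁))
    have e2 := hc.eventually (hπ.eventually hm₁)
    have q1 := e1.self_of_nhds.1
    have q2 := e2.self_of_nhds.1
    filter_upwards [e1, e2] with s h1 h2
    simp only at h1 h2 q1 q2
    omega
  obtain ⟨ρ, hρ, hloc⟩ := Metric.eventually_nhds_iff_ball.1 hloc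
  set c : ℤ := NN d (τ, y₁) - π (τ, y₁) with hc
  have hrr : 0 < min r ρ := lt_min hr hρ
  have hsub : Metric.ball ((τ, y) : ℝ × ℝ) (min r ρ) ⊆ Metric.ball ((τ, y) : ℝ × ℝ) r :=
    Metric.ball_subset_ball (min_le_left _ _)
  have hπ₂ := hπ.mono hsub
  have hN : ∀ p ∈ Metric.ball ((τ, y) : ℝ × ℝ) (min r ρ),
      (NN d p : ℤ) = c + π p ∧ (NP d p : ℤ) = c + π' p := by
    intro p hp
    have hp1 := hsub hp
    have hp2 := hp1
    rw [hball] at hp2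
    have hp3 : p.1 ∈ Metric.ball τ ρ := by
      rw [← ball_prod_same] at hp
      exact Metric.ball_subset_ball (min_le_right _ _) hp.1
    have e1 := hV2 p.1 hp2.1 p.2 hp2.2 y₁ hy₁
    have e2 := hloc p.1 hp3
    have e3 := h.NN_eq (hdom p hp1).1 (hdom p hp1).2.2
    have e4 := hπ₂.1 p hp
    simp only [Prod.mk.eta] at e1 e4
    omega
  refine ⟨min r ρ, hrr, ?_, ?_, ?_⟩
  · intro p hp
    exact h.NN_eq (hdom p (hsub hp)).1 (hdom p (hsub hp)).2.2
  · intro p hp q hq hpq hne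
    have e1 := hN p hp
    have e2 := hN q hq
    have e3 := hπ₂.2.1 p hp q hq hpq hne
    omega
  · intro p hp
    filter_upwards [hπ₂.2.2 p hp, Metric.isOpen_ball.mem_nhds hp] with q h1 hq
    have e1 := hN p hp
    have e2 := hN q hq
    omega

lemma Setup.good_bot (h : Setup d I a b τ₀) {τ : ℝ} (hτ : τ ∈ I) :
    ∃ y ∈ Set.Ioo a b, Good d (τ, y) := by
  obtain ⟨t, ht, hlt⟩ : ∃ t ∈ I, τ < t := by
    have h1 := nhdsWithin_le_nhds (s := Set.Ioi τ) (h.openI.mem_nhds hτ)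
    have h2 : ∀ᶠ t in 𝓝[>] τ, t ∈ I := h1
    obtain ⟨t, ht⟩ := (h2.and self_mem_nhdsWithin).exists
    exact ⟨t, ht.1, ht.2⟩
  obtain ⟨x, hx, h0⟩ := h.hbot t ht
  refine ⟨(a + x) / 2, ⟨by linarith [hx.1], by linarith [hx.1, hx.2]⟩, ?_⟩
  set y := (a + x) / 2
  have hyx : y < x := by simp only [y]; linarith [hx.1]
  have hN : ∀ p ∈ Metric.ball ((τ, y) : ℝ × ℝ) (min (t - τ) (x - y)),
      NN d p = 0 ∧ NP d p = 0 ∧ d p.1 p.2 = 0 := by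
    intro p hp
    rw [← ball_prod_same] at hp
    have h1 := Metric.mem_ball.1 hp.1
    have h2 := Metric.mem_ball.1 hp.2
    rw [Real.dist_eq] at h1 h2
    have h3 := (le_abs_self _).trans_lt (h1.trans_le (min_le_left _ _))
    have h4 := (le_abs_self _).trans_lt (h2.trans_le (min_le_right _ _))
    have hp1 : p.1 ≤ t := by linarith
    have hp2 : p.2 ≤ x := by linarith
    refine ⟨cnt_eq_zero fun z hz => h0 _ hp1 _ (hz.trans hp2), ?_, h0 _ hp1 _ hp2⟩
    exact finsum_mem_eq_zero_of_forall_eq_zero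
      fun z hz => h0 _ hp1 _ ((Set.mem_Iio.1 hz).le.trans hp2)
  refine ⟨min (t - τ) (x - y), lt_min (by linarith) (by linarith), ?_, ?_, ?_⟩
  · intro p hp
    have := hN p hp
    simp only; omega
  · intro p hp q hq _ _
    have := hN p hp
    omega
  · intro p hp
    filter_upwards [Metric.isOpen_ball.mem_nhds hp] with q hq
    have := hN p hp
    have := hN q hq
    omega

lemma Setup.good (h : Setup d I a b τ₀) {τ x : ℝ} (hτ : τ ∈ I) (hx : x ∈ Set.Ioo a b) :
    Good d (τ, x) := by
  have hc : Continuous (fun y : ℝ => (τ, y)) := by fun_prop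
  have hopen : IsOpen {y | Good d (τ, y)} := by
    rw [isOpen_iff_mem_nhds]
    intro y hy
    exact hc.continuousAt.eventually (Good.eventually_nhds hy)
  have hsub : Set.Ioo a b ⊆ {y | Good d (τ, y)} := by
    apply isPreconnected_Ioo.subset_of_closure_inter_subset hopen
    · obtain ⟨y, hy, hg⟩ := h.good_bot hτ
      exact ⟨y, hy, hg⟩
    · rintro y ⟨hy1, hy2⟩
      obtain ⟨r, hr, π, π', hπ⟩ := h.hloc τ hτ y hy2
      obtain ⟨r', hr', hdom⟩ := Metric.eventually_nhds_iff_ball.1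
        (h.dom_nhds (p := (τ, y)) hτ hy2)
      have hrr : 0 < min r r' := lt_min hr hr'
      obtain ⟨y', hy', hd⟩ := Metric.mem_closure_iff.1 hy1 (min r r') hrr
      refine h.good_of hτ hy2 (r := min r r')
        (IndexOn.mono (d := fun p => d p.1 p.2) hπ
          (Metric.ball_subset_ball (min_le_left _ _))) hrr
        (fun p hp => hdom p (Metric.ball_subset_ball (min_le_right _ _) hp))
        (by rw [Metric.mem_ball, dist_comm]; exact hd) hy'
  exact hsub hx

lemma Setup.semi (h : Setup d I a b τ₀) {p : ℝ × ℝ} (hτ : p.1 ∈ I) (hx : p.2 ∈ Set.Ioo a b) :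
    ∀ᶠ q in 𝓝 p, NP d p ≤ NP d q ∧ NN d q ≤ NN d p := by
  obtain ⟨r, hr, hi⟩ := h.good hτ hx
  exact hi.2.2 p (Metric.mem_ball_self hr)

lemma Setup.mono_x (h : Setup d I a b τ₀) {τ x y : ℝ} (hτ : τ ∈ I) (hxy : x < y) (hy : y < b) :
    NN d (τ, x) ≤ NP d (τ, y) := cnt_le_cntp (h.finBelow hτ hy) hxy

lemma Setup.NP_le (h : Setup d I a b τ₀) {p : ℝ × ℝ} (hτ : p.1 ∈ I) (hx : p.2 < b) :
    NP d p ≤ NN d p := by have := h.NN_eq hτ hx; omega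

lemma Setup.mono_t (h : Setup d I a b τ₀) {τ τ' x : ℝ} (hτ' : τ' ∈ I) (hlt : τ < τ')
    (hx : x ∈ Set.Ioo a b) : NN d (τ, x) ≤ NP d (τ', x) := by
  have hI : ∀ s ∈ Set.Icc τ τ', s ∈ I := fun s hs => h.lowerI τ' hτ' s hs.2
  have hg : ∀ s : Set.Icc τ τ', ∃ r > 0, IndexOn (fun p => d p.1 p.2) (NN d) (NP d) (s.1, x) r :=
    fun s => h.good (hI s.1 s.2) hx
  choose r hr hi using hg
  obtain ⟨t, ht0, htm, ⟨m, hm⟩, ht⟩ := exists_monotone_Icc_subset_open_cover_Icc hlt.le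
    (c := fun s : Set.Icc τ τ' => {z : Set.Icc τ τ' | z.1 ∈ Metric.ball s.1 (r s)})
    (fun s => Metric.isOpen_ball.preimage continuous_subtype_val)
    (fun s _ => Set.mem_iUnion.2 ⟨s, Metric.mem_ball_self (hr s)⟩)
  have hstep : ∀ k, (t k : ℝ) < t (k + 1) → NN d ((t k : ℝ), x) ≤ NP d ((t (k + 1) : ℝ), x) := by
    intro k hk
    obtain ⟨s, hs⟩ := ht k
    have m1 := hs ⟨le_rfl, htm (Nat.le_succ k)⟩
    have m2 := hs ⟨htm (Nat.le_succ k), le_rfl⟩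
    refine (hi s).2.1 (t k, x) ?_ (t (k + 1), x) ?_ ⟨hk.le, le_rfl⟩ ?_
    · rw [← ball_prod_same]; exact ⟨m1, Metric.mem_ball_self (hr s)⟩
    · rw [← ball_prod_same]; exact ⟨m2, Metric.mem_ball_self (hr s)⟩
    · intro h; exact hk.ne (congrArg Prod.fst h)
  have hind : ∀ k, (t k : ℝ) = τ ∨ NN d (τ, x) ≤ NP d ((t k : ℝ), x) := by
    intro k
    induction k with
    | zero => left; exact ht0
    | succ k ih =>
      have hle : (t k : ℝ) ≤ t (k + 1) := htm (Nat.le_succ k)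
      rcases hle.lt_or_eq with h1 | h1
      · right
        have h2 := hstep k h1
        rcases ih with h3 | h3
        · rwa [h3] at h2
        · exact (h3.trans (h.NP_le (p := ((t k : ℝ), x)) (hI _ (t k).2) hx.2)).trans h2
      · rw [← h1]; exact ih
  have := hind m
  rw [hm m le_rfl] at this
  exact this.resolve_left hlt.ne'

lemma Setup.NN_left (h : Setup d I a b τ₀) {τ x : ℝ} (hτ : τ ≤ τ₀) : NN d (τ, x) = 0 :=
  cnt_eq_zero fun z _ => h.hleft τ hτ z

/-- crossing count in the `τ` direction -/
lemma Setup.cross (h : Setup d I a b τ₀) (hI : τ₀ ∈ I) {t x : ℝ} (ht : t ∈ I)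
    (hx : x ∈ Set.Ioo a b) :
    FinBelow (fun s => d s x) t ∧ cnt (fun s => d s x) t = NN d (t, x) := by
  have hj : ∀ s ∈ I, Jump (fun s => d s x) (fun s => NN d (s, x)) (fun s => NP d (s, x)) s := by
    intro s hs
    obtain ⟨r, hr, hi⟩ := h.good hs hx
    exact hi.jump_t (Metric.mem_ball_self hr)
  have hf : ∀ s ∈ I, FinBelow (fun s => d s x) s := by
    intro s hs
    apply finBelow_of (x₀ := τ₀) (fun z hz => h.hleft z hz x)
    intro y hy
    exact ⟨_, _, hj y (h.lowerI s hs y hy.2)⟩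
  refine ⟨hf t ht, ?_⟩
  have hpre : IsPreconnected I := by
    apply Set.OrdConnected.isPreconnected
    exact ⟨fun u _ v hv w hw => h.lowerI v hv w hw.2⟩
  have := cnt_const hpre h.openI hj hf t ht τ₀ hI
  rw [h.NN_left le_rfl, cnt_eq_zero (fun z hz => h.hleft z hz x)] at this
  omega
end

/-! ### The branches -/

section
variable {d : ℝ → ℝ → ℕ} {I : Set ℝ} {a b τ₀ : ℝ}

/-- set of times at which the `m`-th branch exists -/
def DD (d : ℝ → ℝ → ℕ) (I : Set ℝ) (a b : ℝ) (m : ℕ) : Set ℝ :=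
  {τ | τ ∈ I ∧ ∃ x ∈ Set.Ioo a b, m ≤ NN d (τ, x)}

/-- the `m`-th branch -/
def mu (d : ℝ → ℝ → ℕ) (a b : ℝ) (m : ℕ) (τ : ℝ) : ℝ :=
  sInf {x | x ∈ Set.Ioo a b ∧ m ≤ NN d (τ, x)}

/-- birth time of the `m`-th branch -/
def tm (d : ℝ → ℝ → ℕ) (I : Set ℝ) (a b : ℝ) (m : ℕ) : ℝ := sInf (DD d I a b m)

lemma Setup.NN_mono_x (h : Setup d I a b τ₀) {τ x y : ℝ} (hτ : τ ∈ I) (hxy : x ≤ y) (hy : y < b) :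
    NN d (τ, x) ≤ NN d (τ, y) := by
  rcases hxy.lt_or_eq with h1 | h1
  · exact (h.mono_x hτ h1 hy).trans (h.NP_le (p := (τ, y)) hτ hy)
  · rw [h1]

lemma Setup.mu_spec (h : Setup d I a b τ₀) {m : ℕ} (hm : 1 ≤ m) {τ : ℝ}
    (hD : τ ∈ DD d I a b m) :
    mu d a b m τ ∈ Set.Ioo a b ∧ m ≤ NN d (τ, mu d a b m τ) ∧ NP d (τ, mu d a b m τ) < m := by
  obtain ⟨hτ, x, hx, hmx⟩ := hD
  obtain ⟨xt, hxt, h0⟩ := h.hbot τ hτ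
  set A := {x | x ∈ Set.Ioo a b ∧ m ≤ NN d (τ, x)} with hA
  have hAx : x ∈ A := ⟨hx, hmx⟩
  have hbd : ∀ y ∈ A, xt < y := by
    rintro y ⟨hy1, hy2⟩
    by_contra hc
    have : NN d (τ, y) = 0 := cnt_eq_zero fun z hz => h0 τ le_rfl z (hz.trans (not_lt.1 hc))
    omega
  have hbdd : BddBelow A := ⟨xt, fun y hy => (hbd y hy).le⟩
  have hmu : mu d a b m τ = sInf A := rfl
  have h1 : mu d a b m τ ∈ Set.Ioo a b :=
    ⟨hxt.1.trans_le (le_csInf ⟨x, hAx⟩ fun y hy => (hbd y hy).le),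
      (csInf_le hbdd hAx).trans_lt hx.2⟩
  set y := mu d a b m τ with hy
  have hsemi := h.semi (p := (τ, y)) hτ h1
  have hc : ContinuousAt (fun y : ℝ => (τ, y)) y := by fun_prop
  have hs := hc.eventually hsemi
  have h2 : m ≤ NN d (τ, y) := by
    have hs' : ∀ᶠ z in 𝓝[>] y, NP d (τ, y) ≤ NP d (τ, z) ∧ NN d (τ, z) ≤ NN d (τ, y) :=
      nhdsWithin_le_nhds hs
    have hb : ∀ᶠ z in 𝓝[>] y, z < b := nhdsWithin_le_nhds (Iio_mem_nhds h1.2)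
    obtain ⟨z, hz, hzb, hzy⟩ := (hs'.and (hb.and self_mem_nhdsWithin)).exists
    obtain ⟨w, hw, hwz⟩ := exists_lt_of_csInf_lt ⟨x, hAx⟩ (show sInf A < z from hzy)
    exact (hw.2.trans (h.NN_mono_x hτ hwz.le hzb)).trans hz.2
  refine ⟨h1, h2, ?_⟩
  by_contra hcon
  have hs' : ∀ᶠ z in 𝓝[<] y, NP d (τ, y) ≤ NP d (τ, z) ∧ NN d (τ, z) ≤ NN d (τ, y) :=
    nhdsWithin_le_nhds hs
  have hb : ∀ᶠ z in 𝓝[<] y, a < z := nhdsWithin_le_nhds (Ioi_mem_nhds h1.1)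
  obtain ⟨z, hz, hza, hzy⟩ := (hs'.and (hb.and self_mem_nhdsWithin)).exists
  have hzy' : z < y := hzy
  have hzA : z ∈ A := ⟨⟨hza, hzy'.trans h1.2⟩,
    (not_lt.1 hcon).trans (hz.1.trans (h.NP_le (p := (τ, z)) hτ (hzy'.trans h1.2)))⟩
  exact absurd (csInf_le hbdd hzA) (not_le.2 hzy')

lemma Setup.mu_le_iff (h : Setup d I a b τ₀) {m : ℕ} (hm : 1 ≤ m) {τ : ℝ}
    (hD : τ ∈ DD d I a b m) {y : ℝ} (hy : y < b) :
    mu d a b m τ ≤ y ↔ m ≤ NN d (τ, y) := by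
  obtain ⟨h1, h2, h3⟩ := h.mu_spec hm hD
  constructor
  · intro hle
    exact h2.trans (h.NN_mono_x hD.1 hle hy)
  · intro hle
    by_contra hc
    have := h.mono_x hD.1 (not_le.1 hc) h1.2
    omega

lemma Setup.mu_lt_iff (h : Setup d I a b τ₀) {m : ℕ} (hm : 1 ≤ m) {τ : ℝ}
    (hD : τ ∈ DD d I a b m) {y : ℝ} (hy : y < b) :
    mu d a b m τ < y ↔ m ≤ NP d (τ, y) := by
  obtain ⟨h1, h2, h3⟩ := h.mu_spec hm hD
  constructor
  · intro hle
    exact h2.trans (h.mono_x hD.1 hle hy)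
  · intro hle
    by_contra hc
    rcases (not_lt.1 hc).lt_or_eq with h4 | h4
    · have := h.mono_x hD.1 h4 h1.2
      have := h.NP_le (p := (τ, y)) hD.1 hy
      omega
    · rw [h4] at hle; omega

lemma Setup.DD_bdd (h : Setup d I a b τ₀) {m : ℕ} (hm : 1 ≤ m) :
    ∀ τ ∈ DD d I a b m, τ₀ < τ := by
  rintro τ ⟨_, x, _, hx⟩
  by_contra hc
  have := h.NN_left (x := x) (not_lt.1 hc)
  omega

lemma Setup.mem_DD (h : Setup d I a b τ₀) {m : ℕ} (hm : 1 ≤ m)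
    (hne : (DD d I a b m).Nonempty) {τ : ℝ} (hτ : τ ∈ I) :
    τ ∈ DD d I a b m ↔ tm d I a b m < τ := by
  have hbdd : BddBelow (DD d I a b m) := ⟨τ₀, fun y hy => (h.DD_bdd hm y hy).le⟩
  constructor
  · rintro ⟨-, x, hx, hmx⟩
    obtain ⟨y, hxy, hyb⟩ := exists_between hx.2
    have hy : y ∈ Set.Ioo a b := ⟨hx.1.trans hxy, hyb⟩
    have h1 : m ≤ NP d (τ, y) := hmx.trans (h.mono_x hτ hxy hyb)
    have hc : ContinuousAt (fun s : ℝ => (s, y)) τ := by fun_prop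
    have hs : ∀ᶠ s in 𝓝[<] τ, NP d (τ, y) ≤ NP d (s, y) ∧ NN d (s, y) ≤ NN d (τ, y) :=
      nhdsWithin_le_nhds (hc.eventually (h.semi (p := (τ, y)) hτ hy))
    obtain ⟨s, hs, hsτ⟩ := (hs.and self_mem_nhdsWithin).exists
    have hsτ' : s < τ := hsτ
    have hsI := h.lowerI τ hτ s hsτ'.le
    have hsD : s ∈ DD d I a b m :=
      ⟨hsI, y, hy, h1.trans (hs.1.trans (h.NP_le (p := (s, y)) hsI hyb))⟩
    exact (csInf_le hbdd hsD).trans_lt hsτ'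
  · intro hlt
    obtain ⟨s, ⟨hsI, x, hx, hmx⟩, hs⟩ := exists_lt_of_csInf_lt hne hlt
    exact ⟨hτ, x, hx, hmx.trans ((h.mono_t hτ hs hx).trans (h.NP_le (p := (τ, x)) hτ hx.2))⟩

lemma Setup.le_tm (h : Setup d I a b τ₀) {m : ℕ} (hm : 1 ≤ m)
    (hne : (DD d I a b m).Nonempty) : τ₀ ≤ tm d I a b m :=
  le_csInf hne fun y hy => (h.DD_bdd hm y hy).le

lemma Setup.tm_mem (h : Setup d I a b τ₀) {m : ℕ} (hm : 1 ≤ m)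
    (hne : (DD d I a b m).Nonempty) : tm d I a b m ∈ I := by
  obtain ⟨s, hs⟩ := hne
  exact h.lowerI s hs.1 _ ((h.mem_DD hm ⟨s, hs⟩ hs.1).1 hs).le

lemma Setup.mu_anti (h : Setup d I a b τ₀) {m : ℕ} (hm : 1 ≤ m) :
    StrictAntiOn (mu d a b m) (DD d I a b m) := by
  intro s hs t ht hst
  obtain ⟨h1, h2, h3⟩ := h.mu_spec hm hs
  rw [h.mu_lt_iff hm ht h1.2]
  exact h2.trans (h.mono_t ht.1 hst h1)

lemma Setup.mu_cont (h : Setup d I a b τ₀) {m : ℕ} (hm : 1 ≤ m) :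
    ContinuousOn (mu d a b m) (DD d I a b m) := by
  intro τ hτ
  obtain ⟨h1, h2, h3⟩ := h.mu_spec hm hτ
  refine tendsto_order.2 ⟨?_, ?_⟩
  · intro y hy
    obtain ⟨z, hz1, hz2⟩ := exists_between (max_lt hy h1.1)
    have hz : z ∈ Set.Ioo a b := ⟨(le_max_right _ _).trans_lt hz1, hz2.trans h1.2⟩
    have hc : ContinuousAt (fun s : ℝ => (s, z)) τ := by fun_prop
    have hs := nhdsWithin_le_nhds (s := DD d I a b m)
      (hc.eventually (h.semi (p := (τ, z)) hτ.1 hz))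
    have hlt : ¬ m ≤ NN d (τ, z) := by
      rw [← h.mu_le_iff hm hτ hz.2]; exact not_le.2 hz2
    filter_upwards [hs, self_mem_nhdsWithin] with s hs hsD
    have : ¬ m ≤ NN d (s, z) := by
      intro hc; exact hlt (hc.trans hs.2)
    rw [← h.mu_le_iff hm hsD hz.2] at this
    exact ((le_max_left _ _).trans_lt hz1).trans (not_le.1 this)
  · intro y hy
    obtain ⟨z, hz1, hz2⟩ := exists_between (lt_min hy h1.2)
    have hz : z ∈ Set.Ioo a b := ⟨h1.1.trans hz1, hz2.trans_le (min_le_right _ _)⟩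
    have hc : ContinuousAt (fun s : ℝ => (s, z)) τ := by fun_prop
    have hs := nhdsWithin_le_nhds (s := DD d I a b m)
      (hc.eventually (h.semi (p := (τ, z)) hτ.1 hz))
    have hlt : m ≤ NP d (τ, z) := (h.mu_lt_iff hm hτ hz.2).1 hz1
    filter_upwards [hs, self_mem_nhdsWithin] with s hs hsD
    exact ((h.mu_lt_iff hm hsD hz.2).2 (hlt.trans hs.1)).trans (hz2.trans_le (min_le_left _ _))

lemma Setup.mu_tendsto (h : Setup d I a b τ₀) {m : ℕ} (hm : 1 ≤ m)
    (hne : (DD d I a b m).Nonempty) :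
    Tendsto (mu d a b m) (𝓝[>] (tm d I a b m)) (𝓝 b) := by
  set t := tm d I a b m with ht
  have htI := h.tm_mem hm hne
  have hDev : ∀ᶠ s in 𝓝[>] t, s ∈ DD d I a b m := by
    have h1 : ∀ᶠ s in 𝓝[>] t, s ∈ I := nhdsWithin_le_nhds (h.openI.mem_nhds htI)
    filter_upwards [h1, self_mem_nhdsWithin] with s hs1 hs2
    exact (h.mem_DD hm hne hs1).2 hs2
  refine tendsto_order.2 ⟨?_, ?_⟩
  · intro y hy
    obtain ⟨z, hz1, hz2⟩ := exists_between (max_lt hy h.hab)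
    have hz : z ∈ Set.Ioo a b := ⟨(le_max_right _ _).trans_lt hz1, hz2⟩
    have hc : ContinuousAt (fun s : ℝ => (s, z)) t := by fun_prop
    have hs : ∀ᶠ s in 𝓝[>] t, NP d (t, z) ≤ NP d (s, z) ∧ NN d (s, z) ≤ NN d (t, z) :=
      nhdsWithin_le_nhds (hc.eventually (h.semi (p := (t, z)) htI hz))
    have hlt : ¬ m ≤ NN d (t, z) := by
      intro hcon
      exact lt_irrefl _ ((h.mem_DD hm hne htI).1 ⟨htI, z, hz, hcon⟩)
    filter_upwards [hs, hDev] with s hs hsD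
    have : ¬ m ≤ NN d (s, z) := by
      intro hc; exact hlt (hc.trans hs.2)
    rw [← h.mu_le_iff hm hsD hz.2] at this
    exact ((le_max_left _ _).trans_lt hz1).trans (not_le.1 this)
  · intro y hy
    filter_upwards [hDev] with s hs
    exact (h.mu_spec hm hs).1.2.trans hy

/-- existence predicate of the branch at time `τ`, in terms of `tm`. -/
def Alive (d : ℝ → ℝ → ℕ) (I : Set ℝ) (a b : ℝ) (m : ℕ) (τ : ℝ) : Prop :=
  (DD d I a b m).Nonempty ∧ tm d I a b m < τ

lemma Setup.alive_iff (h : Setup d I a b τ₀) {m : ℕ} (hm : 1 ≤ m) {τ : ℝ} (hτ : τ ∈ I) :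
    Alive d I a b m τ ↔ τ ∈ DD d I a b m :=
  ⟨fun hh => (h.mem_DD hm hh.1 hτ).2 hh.2, fun hh => ⟨⟨τ, hh⟩, (h.mem_DD hm ⟨τ, hh⟩ hτ).1 hh⟩⟩

lemma Setup.branch_eq_iff (h : Setup d I a b τ₀) {m : ℕ} (hm : 1 ≤ m) {τ x : ℝ} (hτ : τ ∈ I)
    (hx : x ∈ Set.Ioo a b) :
    (Alive d I a b m τ ∧ mu d a b m τ = x) ↔ NP d (τ, x) < m ∧ m ≤ NN d (τ, x) := by
  rw [h.alive_iff hm hτ]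
  constructor
  · rintro ⟨h1, rfl⟩
    have := h.mu_spec hm h1
    exact ⟨this.2.2, this.2.1⟩
  · rintro ⟨h1, h2⟩
    have hD : τ ∈ DD d I a b m := ⟨hτ, x, hx, h2⟩
    refine ⟨hD, le_antisymm ((h.mu_le_iff hm hD hx.2).2 h2) ?_⟩
    by_contra hc
    have := (h.mu_lt_iff hm hD hx.2).1 (not_le.1 hc)
    omega

lemma Setup.branch_lt_iff (h : Setup d I a b τ₀) {m : ℕ} (hm : 1 ≤ m) {τ x : ℝ} (hτ : τ ∈ I)
    (hx : x ∈ Set.Ioo a b) :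
    (Alive d I a b m τ ∧ mu d a b m τ < x) ↔ m ≤ NP d (τ, x) := by
  rw [h.alive_iff hm hτ]
  constructor
  · rintro ⟨h1, h2⟩
    exact (h.mu_lt_iff hm h1 hx.2).1 h2
  · intro h1
    have hD : τ ∈ DD d I a b m := ⟨hτ, x, hx, h1.trans (h.NP_le (p := (τ, x)) hτ hx.2)⟩
    exact ⟨hD, (h.mu_lt_iff hm hD hx.2).2 h1⟩

lemma Setup.branch_order (h : Setup d I a b τ₀) {n : ℕ} (hn : 1 ≤ n) (hd : ∀ τ x, d τ x ≤ n)
    {m m' : ℕ} (hm : 1 ≤ m)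
    (hmm : m + n ≤ m') {τ : ℝ} (hτ : τ ∈ I) (h1 : Alive d I a b m τ) (h2 : Alive d I a b m' τ) :
    mu d a b m τ < mu d a b m' τ := by
  have hm' : 1 ≤ m' := by omega
  rw [h.alive_iff hm hτ] at h1
  rw [h.alive_iff hm' hτ] at h2
  obtain ⟨a1, a2, a3⟩ := h.mu_spec hm' h2
  rw [h.mu_lt_iff hm h1 a1.2]
  have := h.NN_eq (p := (τ, mu d a b m' τ)) hτ a1.2
  have := hd τ (mu d a b m' τ)
  simp only at *
  omega

/-- index bijection -/
def idx {n : ℕ} (j : Fin n) (k : ℤ) : ℕ := n * k.toNat + j + 1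

lemma card_idx {n : ℕ} (R : ℕ → Prop) :
    Nat.card {p : Fin n × ℤ // 0 ≤ p.2 ∧ R (idx p.1 p.2)} = Nat.card {m : ℕ // 1 ≤ m ∧ R m ∧ 1 ≤ n} := by
  apply Nat.card_eq_of_bijective
    (fun p => ⟨idx p.1.1 p.1.2, by simp [idx], p.2.2, by have := p.1.1.2; omega⟩)
  constructor
  · rintro ⟨⟨j, k⟩, hk, hR⟩ ⟨⟨j', k'⟩, hk', hR'⟩ heq
    simp only [Subtype.mk.injEq, idx] at heq hk hk'
    have hj := j.2
    have hj' := j'.2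
    have e : (n * k.toNat + j : ℕ) = n * k'.toNat + j' := by omega
    have e1 : (j : ℕ) = j' := by
      have := congrArg (· % n) e
      simpa [Nat.mul_add_mod, Nat.mod_eq_of_lt hj, Nat.mod_eq_of_lt hj'] using this
    have e2 : k.toNat = k'.toNat := by
      rw [e1] at e
      exact Nat.eq_of_mul_eq_mul_left (by omega) (Nat.add_right_cancel e)
    obtain rfl : j = j' := Fin.ext e1
    obtain rfl : k = k' := by omega
    rfl
  · rintro ⟨m, hm, hR, hn⟩
    have hidx : idx (⟨(m - 1) % n, Nat.mod_lt _ hn⟩ : Fin n) (((m - 1) / n : ℕ) : ℤ) = m := by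
      simp only [idx, Int.toNat_natCast]
      rw [Nat.div_add_mod]; omega
    exact ⟨⟨(⟨(m - 1) % n, Nat.mod_lt _ hn⟩, (((m - 1) / n : ℕ) : ℤ)),
      Int.natCast_nonneg _, by rw [hidx]; exact hR⟩, Subtype.ext hidx⟩

lemma card_Ioc_aux (u v : ℕ) (R : ℕ → Prop) (hR : ∀ m, R m ↔ u < m ∧ m ≤ v) :
    Nat.card {m : ℕ // R m} = v - u := by
  rw [← Nat.card_Ioc u v, ← Nat.card_eq_finsetCard]
  exact Nat.card_congr (Equiv.subtypeEquivRight fun m => by rw [hR, Finset.mem_Ioc])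
end

/-! ### Symplectic algebra -/

lemma J_mul_neg_J (n : ℕ) : -(Jmat n) * Jmat n = 1 := by
  simp [Jmat, Matrix.fromBlocks_multiply, Matrix.fromBlocks_neg]

lemma symp_left_inv {n : ℕ} {Φ : Matrix (Fin n ⊕ Fin n) (Fin n ⊕ Fin n) ℝ}
    (h : IsSymplectic Φ) : (-(Jmat n) * (Φᵀ * Jmat n)) * Φ = 1 := by
  rw [Matrix.mul_assoc, h, J_mul_neg_J]

lemma symp_inv_mul {n : ℕ} {Φ : Matrix (Fin n ⊕ Fin n) (Fin n ⊕ Fin n) ℝ}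
    (h : IsSymplectic Φ) : Φ⁻¹ * Φ = 1 := by
  have := symp_left_inv h
  rw [Matrix.inv_eq_left_inv this, this]

lemma symp_blocks {n : ℕ} {Φ : Matrix (Fin n ⊕ Fin n) (Fin n ⊕ Fin n) ℝ}
    (h : IsSymplectic Φ) : Φ.toBlocks₁₁ᵀ * Φ.toBlocks₂₁ = Φ.toBlocks₂₁ᵀ * Φ.toBlocks₁₁ := by
  unfold IsSymplectic at h
  rw [← Matrix.fromBlocks_toBlocks Φ, Jmat, Matrix.fromBlocks_transpose,
    Matrix.fromBlocks_multiply, Matrix.fromBlocks_multiply] at h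
  have := (Matrix.fromBlocks_inj.1 h).1
  simp at this
  exact (eq_of_sub_eq_zero (by rw [← this]; abel)).symm

lemma symp_inj {n : ℕ} {Φ : Matrix (Fin n ⊕ Fin n) (Fin n ⊕ Fin n) ℝ}
    (h : IsSymplectic Φ) (w : Fin n → ℝ) (h1 : Φ.toBlocks₁₁ *ᵥ w = 0)
    (h2 : Φ.toBlocks₂₁ *ᵥ w = 0) : w = 0 := by
  have e : Φ *ᵥ (Sum.elim w 0) = 0 := by
    rw [← Matrix.fromBlocks_toBlocks Φ, Matrix.fromBlocks_mulVec]
    ext i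
    cases i <;> simp [h1, h2]
  have e2 : (Sum.elim w 0 : Fin n ⊕ Fin n → ℝ) = 0 := by
    rw [← Matrix.one_mulVec (Sum.elim w 0 : Fin n ⊕ Fin n → ℝ), ← symp_inv_mul h,
      ← Matrix.mulVec_mulVec, e, Matrix.mulVec_zero]
  ext i
  exact congrFun e2 (Sum.inl i)

lemma deriv_on_ker {n : ℕ} {Φ D : Matrix (Fin n ⊕ Fin n) (Fin n ⊕ Fin n) ℝ}
    (h : IsSymplectic Φ) (w : Fin n → ℝ) (h1 : Φ.toBlocks₁₁ *ᵥ w = 0) :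
    D.toBlocks₁₁ *ᵥ w
      = -((-(Jmat n * (D * Φ⁻¹))).toBlocks₂₂ *ᵥ (Φ.toBlocks₂₁ *ᵥ w)) := by
  set X := D * Φ⁻¹ with hX
  have hD : D = X * Φ := by rw [hX, Matrix.mul_assoc, symp_inv_mul h, Matrix.mul_one]
  have e1 : (-(Jmat n * X)).toBlocks₂₂ = -X.toBlocks₁₂ := by
    conv_lhs => rw [← Matrix.fromBlocks_toBlocks X, Jmat, Matrix.fromBlocks_multiply,
      Matrix.fromBlocks_neg]
    simp
  have e2 : (X * Φ).toBlocks₁₁ = X.toBlocks₁₁ * Φ.toBlocks₁₁ + X.toBlocks₁₂ * Φ.toBlocks₂₁ := by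
    conv_lhs => rw [← Matrix.fromBlocks_toBlocks X, ← Matrix.fromBlocks_toBlocks Φ,
      Matrix.fromBlocks_multiply]
    simp
  rw [hD, e1, e2, Matrix.add_mulVec, ← Matrix.mulVec_mulVec, h1, Matrix.mulVec_zero, zero_add,
    Matrix.neg_mulVec, neg_neg, Matrix.mulVec_mulVec]

lemma finrank_ker_zero_iff {n : ℕ} (Q : Mat n) :
    Module.finrank ℝ (LinearMap.ker Q.mulVecLin) = 0 ↔ Q.det ≠ 0 := by
  rw [Submodule.finrank_eq_zero, LinearMap.ker_eq_bot, Matrix.mulVecLin, ← isUnit_iff_ne_zero,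
    ← Matrix.isUnit_iff_isUnit_det, ← Matrix.mulVec_injective_iff_isUnit]
  rfl

lemma finrank_ker_le {n : ℕ} (Q : Mat n) :
    Module.finrank ℝ (LinearMap.ker Q.mulVecLin) ≤ n := by
  simpa using Submodule.finrank_le (LinearMap.ker Q.mulVecLin)

lemma LocalIndex.congr {d d' : ℝ × ℝ → ℕ} {p : ℝ × ℝ} (h : LocalIndex d p)
    (he : ∀ᶠ q in 𝓝 p, d' q = d q) : LocalIndex d' p := by
  obtain ⟨r, hr, π, π', h1, h2, h3⟩ := h
  obtain ⟨s, hs, he⟩ := Metric.eventually_nhds_iff_ball.1 he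
  have s1 : Metric.ball p (min r s) ⊆ Metric.ball p r := Metric.ball_subset_ball (min_le_left _ _)
  have s2 : Metric.ball p (min r s) ⊆ Metric.ball p s := Metric.ball_subset_ball (min_le_right _ _)
  exact ⟨min r s, lt_min hr hs, π, π', fun q hq => by rw [he q (s2 hq), h1 q (s1 hq)],
    fun q hq q' hq' => h2 q (s1 hq) q' (s1 hq'), fun q hq => h3 q (s1 hq)⟩

lemma LocalIndex.of_zero {d : ℝ × ℝ → ℕ} {p : ℝ × ℝ}
    (he : ∀ᶠ q in 𝓝 p, d q = 0) : LocalIndex d p := by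
  have : LocalIndex (fun _ => 0) p := ⟨1, one_pos, fun _ => 0, fun _ => 0, by simp, by simp, by simp⟩
  exact this.congr he

/-- block extraction as continuous linear maps -/
def blk₁₁ (n : ℕ) : Matrix (Fin n ⊕ Fin n) (Fin n ⊕ Fin n) ℝ →L[ℝ] Mat n :=
  LinearMap.toContinuousLinearMap
    { toFun := Matrix.toBlocks₁₁, map_add' := fun _ _ => rfl, map_smul' := fun _ _ => rfl }

def blk₂₁ (n : ℕ) : Matrix (Fin n ⊕ Fin n) (Fin n ⊕ Fin n) ℝ →L[ℝ] Mat n :=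
  LinearMap.toContinuousLinearMap
    { toFun := Matrix.toBlocks₂₁, map_add' := fun _ _ => rfl, map_smul' := fun _ _ => rfl }

lemma localIndex_singular {n : ℕ}
    (Φ : ℝ → ℝ → Matrix (Fin n ⊕ Fin n) (Fin n ⊕ Fin n) ℝ)
    (Dτ Dμ : Matrix (Fin n ⊕ Fin n) (Fin n ⊕ Fin n) ℝ)
    (ε₁ ε₂ ε : ℝ) (hε₁ : ε₁ * ε₁ = 1) (hε : ε = ε₁ * ε₂) (τ x : ℝ)
    (hΦ : ContDiffAt ℝ 1 (fun p : ℝ × ℝ => Φ p.1 p.2) (τ, ε * x))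
    (hsymp : ∀ᶠ p : ℝ × ℝ in 𝓝 (τ, ε * x), IsSymplectic (Φ p.1 p.2))
    (hτ : HasDerivAt (fun σ => Φ σ (ε * x)) Dτ τ)
    (hμ : HasDerivAt (fun μ => Φ τ μ) Dμ (ε * x))
    (hC₁ : (ε₁ • (-(Jmat n * (Dτ * (Φ τ (ε * x))⁻¹))).toBlocks₂₂).PosDef)
    (hC₂ : (ε₂ • (-(Jmat n * (Dμ * (Φ τ (ε * x))⁻¹))).toBlocks₂₂).PosDef) :
    LocalIndex (fun p => Module.finrank ℝ
      (LinearMap.ker ((Φ p.1 (ε * p.2)).toBlocks₁₁).mulVecLin)) (τ, x) := by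
  set F : ℝ × ℝ → Matrix (Fin n ⊕ Fin n) (Fin n ⊕ Fin n) ℝ := fun p => Φ p.1 (ε * p.2) with hF
  have hg : ContDiff ℝ 1 (fun p : ℝ × ℝ => (p.1, ε * p.2)) := by fun_prop
  have hFc : ContDiffAt ℝ 1 F (τ, x) :=
    ContDiffAt.comp (f := fun p : ℝ × ℝ => (p.1, ε * p.2)) (τ, x) hΦ hg.contDiffAt
  have hFd : HasFDerivAt F (fderiv ℝ F (τ, x)) (τ, x) :=
    (hFc.differentiableAt (by simp)).hasFDerivAt
  have hs := hsymp.self_of_nhds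
  simp only at hs
  have hF1 : fderiv ℝ F (τ, x) (1, 0) = Dτ := by
    have h1 : HasDerivAt (fun s : ℝ => (s, x)) ((1, 0) : ℝ × ℝ) τ :=
      (hasDerivAt_id τ).prodMk (hasDerivAt_const τ x)
    have h3 : HasDerivAt (fun s : ℝ => F (s, x)) (fderiv ℝ F (τ, x) (1, 0)) τ :=
      HasFDerivAt.comp_hasDerivAt (l := F) (f := fun s : ℝ => (s, x)) τ hFd h1
    exact h3.unique hτ
  have hF2 : fderiv ℝ F (τ, x) (0, 1) = ε • Dμ := by
    have h1 : HasDerivAt (fun s : ℝ => (τ, s)) ((0, 1) : ℝ × ℝ) x :=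
      (hasDerivAt_const x τ).prodMk (hasDerivAt_id x)
    have h2 : HasDerivAt (fun s : ℝ => ε * s) ε x := by
      simpa using (hasDerivAt_id x).const_mul ε
    have h3 : HasDerivAt (fun s : ℝ => F (τ, s)) (fderiv ℝ F (τ, x) (0, 1)) x :=
      HasFDerivAt.comp_hasDerivAt (l := F) (f := fun s : ℝ => (τ, s)) x hFd h1
    exact h3.unique (hμ.scomp x h2)
  have hQd : HasFDerivAt (fun p => (F p).toBlocks₁₁) ((blk₁₁ n).comp (fderiv ℝ F (τ, x))) (τ, x) :=
    (blk₁₁ n).hasFDerivAt.comp (τ, x) hFd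
  have hQ1 : fderiv ℝ (fun p => (F p).toBlocks₁₁) (τ, x) (1, 0) = Dτ.toBlocks₁₁ := by
    rw [hQd.fderiv, ContinuousLinearMap.comp_apply, hF1]; rfl
  have hQ2 : fderiv ℝ (fun p => (F p).toBlocks₁₁) (τ, x) (0, 1) = ε • Dμ.toBlocks₁₁ := by
    rw [hQd.fderiv, ContinuousLinearMap.comp_apply, hF2]; rfl
  have hQ : ContDiffAt ℝ 1 (fun p => (F p).toBlocks₁₁) (τ, x) :=
    (blk₁₁ n).contDiff.contDiffAt.comp (τ, x) hFc
  have hP : ContDiffAt ℝ 1 (fun p => (-ε₁) • (F p).toBlocks₂₁) (τ, x) :=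
    ((blk₂₁ n).contDiff.contDiffAt.comp (τ, x) hFc).const_smul (-ε₁)
  have hε₁0 : ε₁ ≠ 0 := by rintro rfl; simp at hε₁
  have hPne : ∀ w, w ≠ 0 → (F (τ, x)).toBlocks₁₁ *ᵥ w = 0 → (F (τ, x)).toBlocks₂₁ *ᵥ w ≠ 0 :=
    fun w hw h1 h2 => hw (symp_inj hs w h1 h2)
  refine localIndex_of_matrix (fun p => (F p).toBlocks₁₁) (fun p => (-ε₁) • (F p).toBlocks₂₁)
    (τ, x) hQ hP ?_ ?_ ?_ ?_
  · have hc : ContinuousAt (fun p : ℝ × ℝ => (p.1, ε * p.2)) (τ, x) := by fun_prop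
    filter_upwards [hc.eventually hsymp] with p hp
    rw [Matrix.mul_smul, Matrix.transpose_smul, Matrix.smul_mul, symp_blocks hp]
  · intro w h1 h2
    rw [Matrix.smul_mulVec] at h2
    exact symp_inj hs w h1 ((smul_eq_zero.1 h2).resolve_left (neg_ne_zero.2 hε₁0))
  · intro w hw h1
    rw [hQ1, deriv_on_ker hs w h1]
    have := hC₁.dotProduct_mulVec_pos (hPne w hw h1)
    simp only [star_trivial, Matrix.smul_mulVec, dotProduct_smul, smul_eq_mul, hF,
      smul_dotProduct, dotProduct_neg] at this ⊢
    linarith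
  · intro w hw h1
    rw [hQ2, Matrix.smul_mulVec ε, deriv_on_ker hs w h1]
    have := hC₂.dotProduct_mulVec_pos (hPne w hw h1)
    simp only [star_trivial, Matrix.smul_mulVec, dotProduct_smul, smul_eq_mul, hF,
      smul_dotProduct, dotProduct_neg] at this ⊢
    have hc : ε₁ * ε = ε₂ := by rw [hε, ← mul_assoc, hε₁, one_mul]
    rw [← hc] at this
    linarith

end Helpers

set_option maxHeartbeats 2000000

/-- Theorem 2: the eigenvalue branches implicitly defined by `det Q₂(τ,λ) = 0`. -/
theorem eigenvalue_branches_of_det_Q₂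
    (n : ℕ) (hn : 1 ≤ n) (T : EReal) (hT : 0 < T)
    (S : Set ℝ) (hS : S = {τ : ℝ | 0 ≤ τ ∧ (τ : EReal) < T})
    (lm1 l1 : ℝ) (hl : lm1 < l1) (L : Set ℝ) (hL : L = Set.Ioo lm1 l1)
    (Φ : ℝ → ℝ → Matrix (Fin n ⊕ Fin n) (Fin n ⊕ Fin n) ℝ)
    (hsymp : ∀ τ ∈ S, ∀ l ∈ L, IsSymplectic (Φ τ l))
    (hΦ : ContDiffOn ℝ 1 (fun p : ℝ × ℝ => Φ p.1 p.2) (S ×ˢ L))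
    (Φτ Φμ : ℝ → ℝ → Matrix (Fin n ⊕ Fin n) (Fin n ⊕ Fin n) ℝ)
    (hΦτ : ∀ τ ∈ S, ∀ l ∈ L, HasDerivWithinAt (fun σ => Φ σ l) (Φτ τ l) S τ)
    (hΦμ : ∀ τ ∈ S, ∀ l ∈ L, HasDerivWithinAt (fun μ => Φ τ μ) (Φμ τ l) L l)
    (Q₂ : ℝ → ℝ → Mat n) (hQ₂def : ∀ τ l, Q₂ τ l = (Φ τ l).toBlocks₁₁)
    (C₁ C₂ : ℝ → ℝ → Mat n)
    (hC₁def : ∀ τ l, C₁ τ l = (-(Jmat n * (Φτ τ l * (Φ τ l)⁻¹))).toBlocks₂₂)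
    (hC₂def : ∀ τ l, C₂ τ l = (-(Jmat n * (Φμ τ l * (Φ τ l)⁻¹))).toBlocks₂₂)
    (hC₁smooth : ContDiffOn ℝ 1 (fun p : ℝ × ℝ => C₁ p.1 p.2) (S ×ˢ L))
    (hC₂smooth : ContDiffOn ℝ 1 (fun p : ℝ × ℝ => C₂ p.1 p.2) (S ×ˢ L))
    (ε₁ ε₂ ε : ℝ) (hε₁ : ε₁ = 1 ∨ ε₁ = -1) (hε₂ : ε₂ = 1 ∨ ε₂ = -1)
    (hε : ε = ε₁ * ε₂)
    (lε lmε : ℝ)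
    (hlε : (ε = 1 → lε = l1 ∧ lmε = lm1) ∧ (ε = -1 → lε = lm1 ∧ lmε = l1))
    (τ₀ : ℝ) (hτ₀0 : 0 ≤ τ₀) (hτ₀T : (τ₀ : EReal) < T)
    (Sχ : Set ℝ) (hSχ : Sχ = {τ : ℝ | τ₀ < τ ∧ (τ : EReal) < T})
    (χ : ℝ → ℝ) (hχc : ContinuousOn χ Sχ) (hχmem : ∀ τ ∈ Sχ, χ τ ∈ L)
    (hχanti : StrictAntiOn (fun τ => ε * χ τ) Sχ)
    (hχτ₀ : Filter.Tendsto χ (nhdsWithin τ₀ (Set.Ioi τ₀)) (nhds lε))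
    (l₀ : ℝ) (hl₀ : ε * lmε ≤ ε * l₀)
    (hχT : Filter.Tendsto (fun τ => ε * χ τ)
      (Filter.comap (fun τ : ℝ => (τ : EReal)) (nhdsWithin T (Set.Iio T)))
      (nhds (ε * l₀)))
    (hQ₂left : ∀ τ, 0 ≤ τ → τ ≤ τ₀ → ∀ l ∈ L, (Q₂ τ l).det ≠ 0)
    (hQ₂zero : ∀ τ ∈ Sχ, ∀ l ∈ L, (Q₂ τ l).det = 0 → 0 < ε * (l - χ τ))
    (hCsign : ∀ τ ∈ Sχ, ∀ l ∈ L, 0 < ε * (l - χ τ) →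
      (ε₁ • C₁ τ l).PosDef ∧ (ε₂ • C₂ τ l).PosDef) :
    ∃ K : Fin n → Set ℤ, ∃ tt : Fin n → ℤ → ℝ, ∃ lam : Fin n → ℤ → ℝ → ℝ,
      (∀ j, BddBelow (K j)) ∧
      (∀ j, ∀ k ∈ K j,
        0 ≤ tt j k ∧
        ContinuousOn (lam j k) {τ : ℝ | tt j k < τ ∧ (τ : EReal) < T} ∧
        (∀ τ, tt j k < τ → (τ : EReal) < T → lam j k τ ∈ L) ∧
        StrictAntiOn (fun τ => ε * lam j k τ) {τ : ℝ | tt j k < τ ∧ (τ : EReal) < T} ∧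
        Filter.Tendsto (lam j k) (nhdsWithin (tt j k) (Set.Ioi (tt j k))) (nhds lε)) ∧
      (∀ j, ∀ k ∈ K j, ∀ k' ∈ K j, k < k' →
        ∀ τ, tt j k < τ → tt j k' < τ → (τ : EReal) < T →
          ε * lam j k τ < ε * lam j k' τ) ∧
      (∀ τ ∈ S, ∀ l ∈ L,
        Module.finrank ℝ (LinearMap.ker (Q₂ τ l).mulVecLin) =
          Nat.card {p : Fin n × ℤ // p.2 ∈ K p.1 ∧ tt p.1 p.2 < τ ∧ lam p.1 p.2 τ = l}) ∧
      (∀ l ∈ L, ∀ t : ℝ, 0 ≤ t → (t : EReal) < T → (Q₂ t l).det ≠ 0 →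
        {τ : ℝ | 0 ≤ τ ∧ τ < t ∧ (Q₂ τ l).det = 0}.Finite ∧
        ∑ᶠ τ ∈ {τ : ℝ | 0 ≤ τ ∧ τ < t ∧ (Q₂ τ l).det = 0},
            Module.finrank ℝ (LinearMap.ker (Q₂ τ l).mulVecLin) =
          Nat.card {p : Fin n × ℤ //
            p.2 ∈ K p.1 ∧ tt p.1 p.2 < t ∧ ε * (lam p.1 p.2 t - l) < 0}) := by
  
  have hε1 : ε = 1 ∨ ε = -1 := by
    rcases hε₁ with h | h <;> rcases hε₂ with h' | h' <;> simp [hε, h, h']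
  have hεε : ε * ε = 1 := by rcases hε1 with h | h <;> simp [h]
  have hε₁ε₁ : ε₁ * ε₁ = 1 := by rcases hε₁ with h | h <;> simp [h]
  have hinv : ∀ l : ℝ, ε * (ε * l) = l := fun l => by rw [← mul_assoc, hεε, one_mul]
  obtain ⟨a, ha⟩ : ∃ a, a = ε * lmε := ⟨_, rfl⟩
  obtain ⟨b, hb⟩ : ∃ b, b = ε * lε := ⟨_, rfl⟩
  have hmem : ∀ x, ε * x ∈ L ↔ x ∈ Set.Ioo a b := by
    intro x
    rw [hL, ha, hb, Set.mem_Ioo, Set.mem_Ioo]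
    rcases hε1 with h | h
    · obtain ⟨h1, h2⟩ := hlε.1 h
      rw [h, h1, h2]; simp
    · obtain ⟨h1, h2⟩ := hlε.2 h
      rw [h, h1, h2]
      constructor <;> rintro ⟨h3, h4⟩ <;> constructor <;> linarith
  have hmem' : ∀ l, ε * l ∈ Set.Ioo a b ↔ l ∈ L := fun l => by rw [← hmem, hinv]
  have hab : a < b := by
    rw [ha, hb]
    rcases hε1 with h | h
    · obtain ⟨h1, h2⟩ := hlε.1 h
      rw [h, h1, h2]; linarith
    · obtain ⟨h1, h2⟩ := hlε.2 h
      rw [h, h1, h2]; linarith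
  have hsgn : ∀ x s, 0 < ε * (ε * x - χ s) ↔ ε * χ s < x := by
    intro x s
    rw [mul_sub, hinv, sub_pos]
  have hLo : IsOpen L := by rw [hL]; exact isOpen_Ioo
  obtain ⟨I, hI⟩ : ∃ I : Set ℝ, I = {τ : ℝ | (τ : EReal) < T} := ⟨_, rfl⟩
  have hIo : IsOpen I := by
    rw [hI]
    exact isOpen_Iio.preimage continuous_coe_real_ereal
  have hIm : ∀ τ, τ ∈ I ↔ (τ : EReal) < T := fun τ => by rw [hI]; rfl
  have hIl : ∀ t ∈ I, ∀ s ≤ t, s ∈ I := by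
    intro t ht s hst
    rw [hIm] at ht ⊢
    exact (EReal.coe_le_coe_iff.2 hst).trans_lt ht
  have hSm : ∀ τ, τ ∈ S ↔ 0 ≤ τ ∧ τ ∈ I := fun τ => by rw [hS, hIm]; rfl
  have hSχm : ∀ τ, τ ∈ Sχ ↔ τ₀ < τ ∧ τ ∈ I := fun τ => by rw [hSχ, hIm]; rfl
  have hτ₀I : τ₀ ∈ I := (hIm _).2 hτ₀T
  classical
  obtain ⟨d, hd⟩ : ∃ d : ℝ → ℝ → ℕ, d = fun τ x => if τ₀ < τ ∧ x ∈ Set.Ioo a b then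
    Module.finrank ℝ (LinearMap.ker (Q₂ τ (ε * x)).mulVecLin) else 0 := ⟨_, rfl⟩
  have hdpos : ∀ τ x, τ₀ < τ → x ∈ Set.Ioo a b →
      d τ x = Module.finrank ℝ (LinearMap.ker (Q₂ τ (ε * x)).mulVecLin) := by
    intro τ x h1 h2
    rw [hd]; exact if_pos ⟨h1, h2⟩
  have hdzero : ∀ τ x, (τ₀ < τ → x ∈ Set.Ioo a b → (Q₂ τ (ε * x)).det ≠ 0) → d τ x = 0 := by
    intro τ x h1
    by_cases h2 : τ₀ < τ ∧ x ∈ Set.Ioo a b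
    · rw [hdpos τ x h2.1 h2.2, finrank_ker_zero_iff]
      exact h1 h2.1 h2.2
    · rw [hd]; exact if_neg h2
  have hdn : ∀ τ x, d τ x ≤ n := by
    intro τ x
    rw [hd]
    simp only
    split_ifs
    · exact finrank_ker_le _
    · exact Nat.zero_le _
  have hdl : ∀ τ ∈ S, ∀ l ∈ L,
      Module.finrank ℝ (LinearMap.ker (Q₂ τ l).mulVecLin) = d τ (ε * l) := by
    intro τ hτ l hl
    rcases le_or_gt τ τ₀ with h | h
    · rw [hdzero τ _ (fun h' => absurd h' (not_lt.2 h)), finrank_ker_zero_iff]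
      exact hQ₂left τ ((hSm τ).1 hτ).1 h l hl
    · rw [hdpos τ _ h ((hmem' l).2 hl), hinv]
  have hleft : ∀ τ ≤ τ₀, ∀ x, d τ x = 0 := fun τ h x =>
    hdzero τ x (fun h' => absurd h' (not_lt.2 h))
  have hset : Setup d I a b τ₀ := by
    refine ⟨hIo, hIl, hab, ?_, ?_, hleft⟩
    · intro τ hτ x hx
      rcases lt_trichotomy τ τ₀ with h | h | h
      · apply LocalIndex.of_zero
        have hc : ContinuousAt (fun p : ℝ × ℝ => p.1) (τ, x) := by fun_prop
        filter_upwards [hc.eventually (Iio_mem_nhds h)] with q hq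
        exact hleft _ (le_of_lt hq) _
      · subst h
        apply LocalIndex.of_zero
        obtain ⟨z, hxz, hzb⟩ := exists_between hx.2
        have h1 : Filter.Tendsto (fun s => ε * χ s) (nhdsWithin τ (Set.Ioi τ)) (nhds b) := by
          rw [hb]; exact hχτ₀.const_mul ε
        have h2 := h1.eventually (Ioi_mem_nhds hzb)
        rw [eventually_nhdsWithin_iff] at h2
        have hc : ContinuousAt (fun p : ℝ × ℝ => p.1) (τ, x) := by fun_prop
        have hc2 : ContinuousAt (fun p : ℝ × ℝ => p.2) (τ, x) := by fun_prop
        filter_upwards [hc.eventually h2, hc2.eventually (Iio_mem_nhds hxz),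
          hc.eventually (hIo.mem_nhds hτ)] with q h3 h4 h5
        apply hdzero
        intro h6 h7 h8
        have h9 := hQ₂zero q.1 ((hSχm _).2 ⟨h6, h5⟩) _ ((hmem _).2 h7) h8
        rw [hsgn] at h9
        have h10 : z < ε * χ q.1 := h3 h6
        have h11 : q.2 < z := h4
        linarith
      · have hτS : S ∈ nhds τ := by
          filter_upwards [hIo.mem_nhds hτ, Ioi_mem_nhds h] with s h1 h2
          exact (hSm s).2 ⟨hτ₀0.trans (le_of_lt h2), h1⟩
        have hxL := (hmem x).2 hx
        have hLn := hLo.mem_nhds hxL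
        have hτS' := mem_of_mem_nhds hτS
        have hnh : S ×ˢ L ∈ nhds ((τ, ε * x) : ℝ × ℝ) := prod_mem_nhds hτS hLn
        have hΦa := hΦ.contDiffAt hnh
        by_cases hdet : (Q₂ τ (ε * x)).det = 0
        · have hχs : τ ∈ Sχ := (hSχm τ).2 ⟨h, hτ⟩
          have hC := hCsign τ hχs _ hxL (hQ₂zero τ hχs _ hxL hdet)
          rw [hC₁def, hC₂def] at hC
          have hli := localIndex_singular Φ (Φτ τ (ε * x)) (Φμ τ (ε * x)) ε₁ ε₂ ε hε₁ε₁ hε τ x hΦa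
            (by
              filter_upwards [hnh] with p hp
              exact hsymp _ hp.1 _ hp.2)
            ((hΦτ τ hτS' _ hxL).hasDerivAt hτS) ((hΦμ τ hτS' _ hxL).hasDerivAt hLn) hC.1 hC.2
          refine hli.congr ?_
          have hc : ContinuousAt (fun p : ℝ × ℝ => p.1) (τ, x) := by fun_prop
          have hc2 : ContinuousAt (fun p : ℝ × ℝ => p.2) (τ, x) := by fun_prop
          filter_upwards [hc.eventually (Ioi_mem_nhds h),
            hc2.eventually (isOpen_Ioo.mem_nhds hx)] with q h1 h2
          rw [hdpos _ _ h1 h2, hQ₂def]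
        · apply LocalIndex.of_zero
          have hc : ContinuousAt (fun p : ℝ × ℝ => (p.1, ε * p.2)) (τ, x) := by fun_prop
          have h1 : ContinuousAt (fun p : ℝ × ℝ => (Q₂ p.1 (ε * p.2)).det) (τ, x) := by
            have h2 : ContinuousAt (fun p : ℝ × ℝ => Φ p.1 (ε * p.2)) (τ, x) :=
              ContinuousAt.comp (f := fun p : ℝ × ℝ => (p.1, ε * p.2)) (x := (τ, x))
                hΦa.continuousAt hc
            have h3 : Continuous (fun M : Matrix (Fin n ⊕ Fin n) (Fin n ⊕ Fin n) ℝ =>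
                (M.toBlocks₁₁).det) := (blk₁₁ n).continuous.matrix_det
            have h4 := h3.continuousAt.comp h2
            refine h4.congr (Filter.Eventually.of_forall fun p => ?_)
            simp only [hQ₂def, Function.comp]
          filter_upwards [h1.eventually_ne hdet] with q hq
          exact hdzero _ _ fun _ _ => hq
    · intro t ht
      rcases le_or_gt t τ₀ with h | h
      · refine ⟨(a + b) / 2, ⟨by linarith, by linarith⟩, fun τ hτ x _ => hleft τ (hτ.trans h) x⟩
      · have hts : t ∈ Sχ := (hSχm t).2 ⟨h, ht⟩
        refine ⟨ε * χ t, (hmem' _).2 (hχmem t hts), ?_⟩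
        intro τ hτ x hx
        apply hdzero
        intro h1 h2 h3
        have hτs : τ ∈ Sχ := (hSχm τ).2 ⟨h1, hIl t ht τ hτ⟩
        have h4 := hQ₂zero τ hτs _ ((hmem _).2 h2) h3
        rw [hsgn] at h4
        have h5 : ε * χ t ≤ ε * χ τ := hχanti.antitoneOn hτs hts hτ
        linarith
  have hidx1 : ∀ (j : Fin n) (k : ℤ), 1 ≤ idx j k := fun j k => by simp [idx]
  have hDDeq : ∀ m, 1 ≤ m → (DD d I a b m).Nonempty →
      {τ : ℝ | tm d I a b m < τ ∧ (τ : EReal) < T} = DD d I a b m := by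
    intro m hm hne
    ext τ
    constructor
    · rintro ⟨h1, h2⟩
      exact (hset.mem_DD hm hne ((hIm τ).2 h2)).2 h1
    · intro h1
      exact ⟨(hset.mem_DD hm hne h1.1).1 h1, (hIm τ).1 h1.1⟩
  refine ⟨fun j => {k | 0 ≤ k ∧ (DD d I a b (idx j k)).Nonempty},
    fun j k => tm d I a b (idx j k), fun j k τ => ε * mu d a b (idx j k) τ, ?_, ?_, ?_, ?_, ?_⟩
  · intro j
    exact ⟨0, fun k hk => hk.1⟩
  · rintro j k ⟨hk0, hne⟩
    have hm := hidx1 j k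
    refine ⟨hτ₀0.trans (hset.le_tm hm hne), ?_, ?_, ?_, ?_⟩
    · rw [hDDeq _ hm hne]
      exact (hset.mu_cont hm).const_mul ε |>.congr fun _ _ => rfl
    · intro τ h1 h2
      rw [hmem]
      exact (hset.mu_spec hm ((hset.mem_DD hm hne ((hIm τ).2 h2)).2 h1)).1
    · rw [hDDeq _ hm hne]
      simp only [hinv]
      exact hset.mu_anti hm
    · have := (hset.mu_tendsto hm hne).const_mul ε
      have hbε : ε * b = lε := by rw [hb, hinv]
      rwa [hbε] at this
  · rintro j k ⟨hk0, hne⟩ k' ⟨hk0', hne'⟩ hkk τ h1 h2 h3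
    simp only [hinv]
    refine hset.branch_order hn hdn (hidx1 j k) ?_ ((hIm τ).2 h3) ⟨hne, h1⟩ ⟨hne', h2⟩
    simp only [idx]
    have h4 : k.toNat + 1 ≤ k'.toNat := by omega
    have h5 := Nat.mul_le_mul_left n h4
    rw [Nat.mul_add] at h5
    omega
  · intro τ hτ l hl
    have hτI := ((hSm τ).1 hτ).2
    have hx := (hmem' l).2 hl
    rw [hdl τ hτ l hl]
    have e1 : Nat.card {p : Fin n × ℤ // p.2 ∈ {k | 0 ≤ k ∧ (DD d I a b (idx p.1 k)).Nonempty} ∧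
        tm d I a b (idx p.1 p.2) < τ ∧ ε * mu d a b (idx p.1 p.2) τ = l}
        = Nat.card {p : Fin n × ℤ // 0 ≤ p.2 ∧
          (fun m => Alive d I a b m τ ∧ mu d a b m τ = ε * l) (idx p.1 p.2)} := by
      refine Nat.card_congr (Equiv.subtypeEquivRight fun p => ?_)
      have e2 : ε * mu d a b (idx p.1 p.2) τ = l ↔ mu d a b (idx p.1 p.2) τ = ε * l := by
        constructor
        · intro h; rw [← h, hinv]
        · intro h; rw [h, hinv]
      simp only [Set.mem_ofPred_eq, Alive, e2]
      exact ⟨fun h => ⟨h.1.1, ⟨h.1.2, h.2.1⟩, h.2.2⟩, fun h => ⟨⟨h.1, h.2.1.1⟩, h.2.1.2, h.2.2⟩⟩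
    refine Eq.trans ?_ e1.symm
    rw [card_idx (fun m => Alive d I a b m τ ∧ mu d a b m τ = ε * l), card_Ioc_aux (NP d (τ, ε * l)) (NN d (τ, ε * l))]
    · have := hset.NN_eq (p := (τ, ε * l)) hτI hx.2
      simp only at this
      omega
    · intro m
      constructor
      · rintro ⟨h1, h2, -⟩
        exact (hset.branch_eq_iff h1 hτI hx).1 h2
      · intro h2
        have h1 : 1 ≤ m := by omega
        exact ⟨h1, (hset.branch_eq_iff h1 hτI hx).2 h2, hn⟩
  · intro l hl t ht0 htT hdet
    have htI := (hIm t).2 htT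
    have hx := (hmem' l).2 hl
    obtain ⟨hfin, hcnt⟩ := hset.cross hτ₀I htI hx
    have hSt : ∀ s, 0 ≤ s → s ≤ t → s ∈ S := fun s h0 hs => (hSm s).2 ⟨h0, hIl t htI s hs⟩
    have hdt : d t (ε * l) = 0 := by
      rw [← hdl t (hSt t ht0 le_rfl) l hl, finrank_ker_zero_iff]
      exact hdet
    have hAeq : {τ : ℝ | 0 ≤ τ ∧ τ < t ∧ (Q₂ τ l).det = 0}
        = Set.Iic t ∩ Function.support (fun s => d s (ε * l)) := by
      ext s
      simp only [Set.mem_ofPred_eq, Set.mem_inter_iff, Set.mem_Iic, Function.mem_support]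
      constructor
      · rintro ⟨h0, h1, h2⟩
        refine ⟨h1.le, ?_⟩
        rw [← hdl s (hSt s h0 h1.le) l hl, Ne, finrank_ker_zero_iff]
        exact not_not.2 h2
      · rintro ⟨h1, h2⟩
        have h0 : 0 ≤ s := by
          by_contra hc
          exact h2 (hleft s ((not_le.1 hc).le.trans hτ₀0) _)
        refine ⟨h0, lt_of_le_of_ne h1 ?_, ?_⟩
        · rintro rfl
          exact h2 hdt
        · rw [← hdl s (hSt s h0 h1) l hl, Ne, finrank_ker_zero_iff] at h2
          exact not_not.1 h2
    refine ⟨by rw [hAeq]; exact hfin, ?_⟩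
    have e0 : ∑ᶠ τ ∈ {τ : ℝ | 0 ≤ τ ∧ τ < t ∧ (Q₂ τ l).det = 0},
        Module.finrank ℝ (LinearMap.ker (Q₂ τ l).mulVecLin) = NN d (t, ε * l) := by
      rw [← hcnt, cnt, ← finsum_mem_inter_support (fun s => d s (ε * l)), ← hAeq]
      exact finsum_mem_congr rfl fun s hs => hdl s (hSt s hs.1 hs.2.1.le) l hl
    have e1 : Nat.card {p : Fin n × ℤ // p.2 ∈ {k | 0 ≤ k ∧ (DD d I a b (idx p.1 k)).Nonempty} ∧
        tm d I a b (idx p.1 p.2) < t ∧ ε * (ε * mu d a b (idx p.1 p.2) t - l) < 0}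
        = Nat.card {p : Fin n × ℤ // 0 ≤ p.2 ∧
          (fun m => Alive d I a b m t ∧ mu d a b m t < ε * l) (idx p.1 p.2)} := by
      refine Nat.card_congr (Equiv.subtypeEquivRight fun p => ?_)
      have e2 : ε * (ε * mu d a b (idx p.1 p.2) t - l) < 0
          ↔ mu d a b (idx p.1 p.2) t < ε * l := by
        rw [mul_sub, hinv, sub_neg]
      simp only [Set.mem_ofPred_eq, Alive, e2]
      exact ⟨fun h => ⟨h.1.1, ⟨h.1.2, h.2.1⟩, h.2.2⟩, fun h => ⟨⟨h.1, h.2.1.1⟩, h.2.1.2, h.2.2⟩⟩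
    refine e0.trans (Eq.trans ?_ e1.symm)
    rw [card_idx (fun m => Alive d I a b m t ∧ mu d a b m t < ε * l), card_Ioc_aux 0 (NP d (t, ε * l))]
    · have := hset.NN_eq (p := (t, ε * l)) htI hx.2
      simp only at this
      omega
    · intro m
      constructor
      · rintro ⟨h1, h2, -⟩
        exact ⟨h1, (hset.branch_lt_iff h1 htI hx).1 h2⟩
      · rintro ⟨h1, h2⟩
        exact ⟨h1, (hset.branch_lt_iff h1 htI hx).2 h2, hn⟩
end
end

section
/- Assume C is of class C¹ and C(τ) is positive definite for every τ. Let N be a symmetric real n×n matrix and set Q₁ = Q_s and Q₂ = Q_c + Q_s N. Let r, φ be C¹ matrix-valued functions on [0,T) with det r(τ) ≠ 0, φ(τ) symmetric, φ(0) = 0, Q₂(τ) = r(τ)·cos φ(τ) and Q₁(τ) = r(τ)·sin φ(τ), and let φ₁,…,φₙ be C¹ functions with φⱼ(0) = 0 and φⱼ′(τ) > 0 for all τ, such that for each τ the eigenvalues of φ(τ), with multiplicity, are φ₁(τ),…,φₙ(τ). Let t ∈ (0,T) with Q₂(t) invertible, for each j let μⱼ be the unique integer with −π/2 + μⱼπ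 < φⱼ(t) < π/2 + μⱼπ, and set μ = μ₁ + ⋯ + μₙ. Then Q₂(τ) is singular for only finitely many τ ∈ [0,t], and μ = Σ_{τ∈[0,t]} dim ker Q₂(τ), i.e. μ equals the number of τ ∈ [0,t] at which Q₂(τ) is singular, counted with multiplicity dim ker Q₂(τ). -/
open Matrix
noncomputable section
attribute [local instance] Matrix.normedAddCommGroup Matrix.normedSpace

lemma aux_mcos_conj {n : ℕ} (U V : Mat n) (hVU : V * U = 1) (d : Fin n → ℝ) :
    mcos (U * diagonal d * V) = U * diagonal (fun i => Real.cos (d i)) * V := by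
  have hpow : ∀ k : ℕ, (U * diagonal d * V) ^ (k) = U * diagonal (fun i => d i ^ k) * V ∨ k = 0 := by
    intro k
    induction k with
    | zero => right; rfl
    | succ k ih =>
      left
      rcases ih with ih | ih
      · rw [pow_succ, ih]
        calc U * diagonal (fun i => d i ^ k) * V * (U * diagonal d * V)
            = U * diagonal (fun i => d i ^ k) * (V * U) * diagonal d * V := by
              simp only [Matrix.mul_assoc]
          _ = _ := by
              rw [hVU, Matrix.mul_one, Matrix.mul_assoc U, diagonal_mul_diagonal]
              simp only [pow_succ]
      · subst ih; simp
  have hUV : U * V = 1 := mul_eq_one_comm.mp hVU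
  have hpow' : ∀ k : ℕ, (U * diagonal d * V) ^ (k) = U * diagonal (fun i => d i ^ k) * V := by
    intro k
    rcases hpow k with h | h
    · exact h
    · subst h; simp [hUV]
  have h1 : HasSum (fun k : ℕ => (fun i => ((-1 : ℝ) ^ k / (Nat.factorial (2 * k) : ℝ)) * d i ^ (2 * k)))
      (fun i => Real.cos (d i)) := by
    rw [Pi.hasSum]
    intro i
    have := Real.hasSum_cos (d i)
    convert this using 2
    ring
  have h2 := h1.matrix_diagonal
  have h3 := (h2.mul_left U).mul_right V
  unfold mcos
  refine HasSum.tsum_eq ?_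
  have hfun : (fun k : ℕ => ((-1 : ℝ) ^ k / (Nat.factorial (2 * k) : ℝ)) •
      (U * diagonal d * V) ^ (2 * k)) = fun k : ℕ => U * diagonal (fun i =>
        ((-1 : ℝ) ^ k / (Nat.factorial (2 * k) : ℝ)) * d i ^ (2 * k)) * V := by
    funext k
    rw [hpow', ← Matrix.smul_mul, ← Matrix.mul_smul, ← diagonal_smul]
    rfl
  rw [hfun]
  exact h3

lemma aux_finrank {n : ℕ} (R X : Mat n) (hR : R.det ≠ 0) (hX : Xᵀ = X) (e : Fin n → ℝ)
    (hch : X.charpoly = ∏ j, (Polynomial.X - Polynomial.C (e j))) :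
    Module.finrank ℝ (LinearMap.ker (R * mcos X).mulVecLin) =
      (Finset.univ.filter (fun j => Real.cos (e j) = 0)).card := by
  have hH : X.IsHermitian := by
    rw [Matrix.IsHermitian, conjTranspose_eq_transpose_of_trivial, hX]
  set U : Mat n := (hH.eigenvectorUnitary : Mat n)
  set d : Fin n → ℝ := hH.eigenvalues
  have hspec : X = U * diagonal d * star U := by
    have := hH.spectral_theorem
    rw [Unitary.conjStarAlgAut_apply] at this
    simpa using this
  have hUU : star U * U = 1 := Unitary.coe_star_mul_self hH.eigenvectorUnitary
  have hUU' : U * star U = 1 := mul_eq_one_comm.mp hUU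
  have hroots : Finset.univ.val.map e = Finset.univ.val.map d := by
    have h1 := hH.roots_charpoly_eq_eigenvalues
    rw [hch] at h1
    have h2 : (∏ j, (Polynomial.X - Polynomial.C (e j))) =
        ((Finset.univ.val.map e).map (fun a => Polynomial.X - Polynomial.C a)).prod := by
      rw [Multiset.map_map]; rfl
    rw [h2, Polynomial.roots_multiset_prod_X_sub_C] at h1
    simpa using h1
  have hcard : (Finset.univ.filter (fun j => Real.cos (e j) = 0)).card
      = (Finset.univ.filter (fun j => Real.cos (d j) = 0)).card := by
    have := congrArg (Multiset.countP (fun x => Real.cos x = 0)) hroots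
    rw [Multiset.countP_map, Multiset.countP_map] at this
    exact this
  have hrank : (R * mcos X).rank = Fintype.card {i // Real.cos (d i) ≠ 0} := by
    rw [rank_mul_eq_right_of_isUnit_det _ _ (isUnit_iff_ne_zero.mpr hR)]
    rw [hspec, aux_mcos_conj U (star U) hUU d,
      rank_mul_eq_left_of_isUnit_det _ _ (isUnit_det_of_left_inverse hUU'),
      rank_mul_eq_right_of_isUnit_det _ _ (isUnit_det_of_left_inverse hUU), rank_diagonal]
  have hrn := LinearMap.finrank_range_add_finrank_ker (R * mcos X).mulVecLin
  change (R * mcos X).rank + _ = _ at hrn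
  rw [hrank, Module.finrank_fin_fun, Fintype.card_subtype] at hrn
  have h4 := Finset.card_filter_add_card_filter_not (s := (Finset.univ : Finset (Fin n)))
    (fun i => Real.cos (d i) = 0)
  rw [Finset.card_univ, Fintype.card_fin] at h4
  simp only [ne_eq] at hrn
  rw [hcard]
  omega

lemma aux_count (f : ℝ → ℝ) (t : ℝ) (ht : 0 < t) (hc : ContinuousOn f (Set.Icc 0 t))
    (hm : StrictMonoOn f (Set.Icc 0 t)) (h0 : f 0 = 0) (m : ℤ)
    (h1 : -(Real.pi / 2) + m * Real.pi < f t) (h2 : f t < Real.pi / 2 + m * Real.pi) :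
    {τ : ℝ | τ ∈ Set.Icc 0 t ∧ Real.cos (f τ) = 0}.Finite ∧
    (({τ : ℝ | τ ∈ Set.Icc 0 t ∧ Real.cos (f τ) = 0}.ncard : ℕ) : ℤ) = m := by
  have hpi := Real.pi_pos
  have l0 : (0:ℝ) ∈ Set.Icc 0 t := ⟨le_rfl, ht.le⟩
  have lt : t ∈ Set.Icc 0 t := ⟨ht.le, le_rfl⟩
  have hft : 0 < f t := by rw [← h0]; exact hm l0 lt ht
  have hm0 : 0 ≤ m := by
    have : (-1 : ℝ) < m := by nlinarith
    have : (-1 : ℤ) < m := by exact_mod_cast this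
    omega
  set Z := {τ : ℝ | τ ∈ Set.Icc 0 t ∧ Real.cos (f τ) = 0}
  let g : ℤ → ℝ := fun k => (2 * k + 1) * Real.pi / 2
  have hg : Function.Injective g := by
    intro a b hab
    have hab' : (2 * (a:ℝ) + 1) * Real.pi / 2 = (2 * b + 1) * Real.pi / 2 := hab
    have : (a : ℝ) = b := by
      have : ((a:ℝ) - b) * Real.pi = 0 := by linarith
      rcases mul_eq_zero.mp this with h | h <;> linarith
    exact_mod_cast this
  have hinj : Set.InjOn f Z := fun a ha b hb h => hm.injOn ha.1 hb.1 h
  have himg : f '' Z = g '' (Finset.Ico 0 m : Finset ℤ) := by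
    ext x
    constructor
    · rintro ⟨τ, ⟨hτ, hcos⟩, rfl⟩
      obtain ⟨k, hk⟩ := Real.cos_eq_zero_iff.mp hcos
      have ha : 0 ≤ f τ := by rw [← h0]; exact hm.monotoneOn l0 hτ hτ.1
      have hb : f τ ≤ f t := hm.monotoneOn hτ lt hτ.2
      refine ⟨k, ?_, hk.symm⟩
      have e1 : (-1 : ℝ) < k := by nlinarith
      have e2 : (k : ℝ) < m := by nlinarith
      have e1' : (-1 : ℤ) < k := by exact_mod_cast e1
      have e2' : k < m := by exact_mod_cast e2
      simp; omega
    · rintro ⟨k, hk, rfl⟩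
      simp only [Finset.coe_Ico, Set.mem_Ico] at hk
      have e1 : (0:ℝ) ≤ k := by exact_mod_cast hk.1
      have e2 : (k : ℝ) + 1 ≤ m := by exact_mod_cast hk.2
      have : g k ∈ Set.Icc (f 0) (f t) := by
        rw [h0]
        constructor
        · simp only [g]; positivity
        · simp only [g]; nlinarith
      obtain ⟨τ, hτ, hτe⟩ := intermediate_value_Icc ht.le hc this
      exact ⟨τ, ⟨hτ, by rw [hτe]; exact Real.cos_eq_zero_iff.mpr ⟨k, rfl⟩⟩, hτe⟩
  constructor
  · apply Set.Finite.of_finite_image _ hinj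
    rw [himg]
    exact (Finset.finite_toSet _).image _
  · rw [← Set.ncard_image_of_injOn hinj, himg, Set.ncard_image_of_injective _ hg,
      Set.ncard_coe_finset]
    simp [hm0]

/-- The Morse index formula: with `Q₂ = Q_c + Q_s N`, the index `μ` computed from
the polar angle eigenvalues equals the number of times `Q₂(τ)` is singular on
`[0,t]`, counted with multiplicity `dim ker Q₂(τ)`. -/
theorem morse_index_eq_sum_dim_ker
    (n : ℕ) (hn : 1 ≤ n) (T : EReal) (hT : 0 < T)
    (S : Set ℝ) (hS : S = {τ : ℝ | 0 ≤ τ ∧ (τ : EReal) < T})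
    (A B C : ℝ → Mat n)
    (hAc : ContinuousOn A S) (hBc : ContinuousOn B S)
    (hC1 : ContDiffOn ℝ 1 C S)
    (hAsymm : ∀ τ ∈ S, (A τ)ᵀ = A τ) (hCsymm : ∀ τ ∈ S, (C τ)ᵀ = C τ)
    (hCpos : ∀ τ ∈ S, (C τ).PosDef)
    (Qc Pc Qs Ps : ℝ → Mat n)
    (hQc : ∀ τ ∈ S, HasDerivWithinAt Qc (B τ * Qc τ + C τ * Pc τ) S τ)
    (hPc : ∀ τ ∈ S, HasDerivWithinAt Pc (-(A τ * Qc τ) - (B τ)ᵀ * Pc τ) S τ)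
    (hQs : ∀ τ ∈ S, HasDerivWithinAt Qs (B τ * Qs τ + C τ * Ps τ) S τ)
    (hPs : ∀ τ ∈ S, HasDerivWithinAt Ps (-(A τ * Qs τ) - (B τ)ᵀ * Ps τ) S τ)
    (hQc0 : Qc 0 = 1) (hPs0 : Ps 0 = 1) (hQs0 : Qs 0 = 0) (hPc0 : Pc 0 = 0)
    (N : Mat n) (hN : Nᵀ = N)
    (Q₁ Q₂ : ℝ → Mat n)
    (hQ₁def : ∀ τ, Q₁ τ = Qs τ) (hQ₂def : ∀ τ, Q₂ τ = Qc τ + Qs τ * N)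
    (r φ : ℝ → Mat n) (φe dφe : Fin n → ℝ → ℝ)
    (hr1 : ContDiffOn ℝ 1 r S) (hφ1 : ContDiffOn ℝ 1 φ S)
    (hrdet : ∀ τ ∈ S, (r τ).det ≠ 0) (hφsymm : ∀ τ ∈ S, (φ τ)ᵀ = φ τ)
    (hφ0 : φ 0 = 0)
    (hpolar : ∀ τ ∈ S, Q₂ τ = r τ * mcos (φ τ) ∧ Q₁ τ = r τ * msin (φ τ))
    (hφe1 : ∀ j, ContDiffOn ℝ 1 (φe j) S)
    (hφe0 : ∀ j, φe j 0 = 0)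
    (hφe' : ∀ j, ∀ τ ∈ S, HasDerivWithinAt (φe j) (dφe j τ) S τ ∧ 0 < dφe j τ)
    (hcharpoly : ∀ τ ∈ S,
      (φ τ).charpoly = ∏ j, (Polynomial.X - Polynomial.C (φe j τ)))
    (t : ℝ) (ht : 0 < t) (htT : (t : EReal) < T)
    (hQ₂t : (Q₂ t).det ≠ 0)
    (μs : Fin n → ℤ)
    (hμs : ∀ j, -(Real.pi / 2) + μs j * Real.pi < φe j t ∧
      φe j t < Real.pi / 2 + μs j * Real.pi)
    (μ : ℤ) (hμ : μ = ∑ j, μs j) :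
    {τ : ℝ | τ ∈ Set.Icc 0 t ∧ (Q₂ τ).det = 0}.Finite ∧
    μ = ∑ᶠ τ ∈ {τ : ℝ | τ ∈ Set.Icc 0 t ∧ (Q₂ τ).det = 0},
        (Module.finrank ℝ (LinearMap.ker (Q₂ τ).mulVecLin) : ℤ) := by
  have hIcc : Set.Icc 0 t ⊆ S := by
    intro τ hτ
    rw [hS]
    exact ⟨hτ.1, lt_of_le_of_lt (by exact_mod_cast hτ.2) htT⟩
  have hdim : ∀ τ ∈ Set.Icc 0 t, Module.finrank ℝ (LinearMap.ker (Q₂ τ).mulVecLin) =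
      (Finset.univ.filter (fun j => Real.cos (φe j τ) = 0)).card := by
    intro τ hτ
    rw [(hpolar τ (hIcc hτ)).1]
    exact aux_finrank _ _ (hrdet τ (hIcc hτ)) (hφsymm τ (hIcc hτ)) _ (hcharpoly τ (hIcc hτ))
  have hcount : ∀ j, {τ : ℝ | τ ∈ Set.Icc 0 t ∧ Real.cos (φe j τ) = 0}.Finite ∧
      (({τ : ℝ | τ ∈ Set.Icc 0 t ∧ Real.cos (φe j τ) = 0}.ncard : ℕ) : ℤ) = μs j := by
    intro j
    have hcont : ContinuousOn (φe j) (Set.Icc 0 t) := (hφe1 j).continuousOn.mono hIcc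
    refine aux_count (φe j) t ht hcont ?_ (hφe0 j) _ (hμs j).1 (hμs j).2
    refine strictMonoOn_of_hasDerivWithinAt_pos (f' := dφe j) (convex_Icc 0 t) hcont ?_ ?_
    · intro x hx
      exact ((hφe' j x (hIcc (interior_subset hx))).1).mono (interior_subset.trans hIcc)
    · intro x hx
      exact (hφe' j x (hIcc (interior_subset hx))).2
  have hdet : ∀ τ ∈ Set.Icc 0 t, ((Q₂ τ).det = 0 ↔ ∃ j, Real.cos (φe j τ) = 0) := by
    intro τ hτ
    have h1 := hdim τ hτ
    have h2 : (Q₂ τ).det = 0 ↔ Module.finrank ℝ (LinearMap.ker (Q₂ τ).mulVecLin) ≠ 0 := by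
      rw [← Matrix.exists_mulVec_eq_zero_iff, Ne, Submodule.finrank_eq_zero, Submodule.eq_bot_iff]
      simp only [LinearMap.mem_ker, Matrix.mulVecLin_apply]
      push Not
      exact ⟨fun ⟨v, a, b⟩ => ⟨v, b, a⟩, fun ⟨v, a, b⟩ => ⟨v, b, a⟩⟩
    rw [h2, h1, Finset.card_ne_zero]
    constructor
    · rintro ⟨j, hj⟩
      exact ⟨j, by simpa using hj⟩
    · rintro ⟨j, hj⟩
      exact ⟨j, by simpa using hj⟩
  have hfin : {τ : ℝ | τ ∈ Set.Icc 0 t ∧ (Q₂ τ).det = 0}.Finite := by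
    refine (Set.finite_iUnion (fun j => (hcount j).1)).subset ?_
    rintro τ ⟨hτ, hd⟩
    obtain ⟨j, hj⟩ := (hdet τ hτ).mp hd
    exact Set.mem_iUnion.mpr ⟨j, hτ, hj⟩
  refine ⟨hfin, ?_⟩
  rw [finsum_mem_eq_finite_toFinset_sum _ hfin, hμ]
  have hs : ∀ τ ∈ hfin.toFinset, (Module.finrank ℝ (LinearMap.ker (Q₂ τ).mulVecLin) : ℤ) =
      ∑ j, if Real.cos (φe j τ) = 0 then (1:ℤ) else 0 := by
    intro τ hτ
    rw [Set.Finite.mem_toFinset] at hτ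
    rw [hdim τ hτ.1, Finset.sum_boole]
  rw [Finset.sum_congr rfl hs, Finset.sum_comm]
  refine Finset.sum_congr rfl fun j _ => ?_
  rw [Finset.sum_boole, ← (hcount j).2, ← Set.ncard_coe_finset]
  congr 2
  ext τ
  simp only [Finset.coe_filter, Set.Finite.mem_toFinset, Set.mem_setOf_eq]
  constructor
  · rintro ⟨h, hj⟩
    exact ⟨⟨h, (hdet τ h).mpr ⟨j, hj⟩⟩, hj⟩
  · rintro ⟨⟨h, _⟩, hj⟩
    exact ⟨h, hj⟩
end
end

section
/- Assume C₀ = cIₙ, D = dIₙ, E = eIₙ and δ = θIₙ for real constants c, d, e, θ with c > 0 and e > 0, and fix t ∈ (0,T). Then there exist matrix-valued functions r(τ,λ), φ(τ,λ) on [0,t] × ℝ, jointly continuous, with det r(τ,λ) ≠ 0, φ(τ,λ) symmetric, Q₂ = r·cos φ and Q₁ = r·sin φ, and a symmetric n×n matrix φ⁻, independent of τ, all of whose eigenvalues are integer multiples of π, such that for every τ ∈ (0,t]: the largest eigenvalue of φ(τ,λ) tends to −∞ as λ → +∞, and φ(τ,λ) → φ⁻ (entrywise) as λ → −∞. -/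
open Matrix
noncomputable section
attribute [local instance] Matrix.normedAddCommGroup Matrix.normedSpace

/-- The generator of the scalar system with coefficients c and (d - l e). -/
def slGen (c d e l : ℝ) : (ℝ × ℝ) →L[ℝ] (ℝ × ℝ) :=
  c • ((ContinuousLinearMap.inl ℝ ℝ ℝ).comp (ContinuousLinearMap.snd ℝ ℝ ℝ)) +
    (d - l * e) • ((ContinuousLinearMap.inr ℝ ℝ ℝ).comp (ContinuousLinearMap.fst ℝ ℝ ℝ))

/-- The scalar flow. -/
def slFlow (c d e τ l : ℝ) : (ℝ × ℝ) →L[ℝ] (ℝ × ℝ) :=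
  NormedSpace.exp (τ • slGen c d e l)

lemma slGen_apply (c d e l : ℝ) (x : ℝ × ℝ) :
    slGen c d e l x = (c * x.2, (d - l * e) * x.1) := by
  simp [slGen]

lemma slFlow_cont (c d e : ℝ) (x : ℝ × ℝ) :
    Continuous (fun p : ℝ × ℝ => slFlow c d e p.1 p.2 x) := by
  let : NormedAlgebra ℚ ((ℝ × ℝ) →L[ℝ] (ℝ × ℝ)) := NormedAlgebra.restrictScalars ℚ ℝ _
  have h1 : Continuous (fun p : ℝ × ℝ => p.1 • slGen c d e p.2) := by
    unfold slGen
    fun_prop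
  have h2 : Continuous (fun p : ℝ × ℝ => slFlow c d e p.1 p.2) :=
    NormedSpace.exp_continuous.comp h1
  exact h2.clm_apply continuous_const

lemma slFlow_deriv (c d e l τ : ℝ) (x : ℝ × ℝ) :
    HasDerivAt (fun σ => slFlow c d e σ l x) (slGen c d e l (slFlow c d e τ l x)) τ := by
  have h := hasDerivAt_exp_smul_const' (𝕂 := ℝ) (slGen c d e l) τ
  have h2 := h.clm_apply (hasDerivAt_const τ x)
  simpa [slFlow] using h2

lemma slFlow_zero (c d e l : ℝ) (x : ℝ × ℝ) : slFlow c d e 0 l x = x := by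
  simp [slFlow]

lemma slFlow_ne (c d e τ l : ℝ) (x : ℝ × ℝ) (hx : x ≠ 0) : slFlow c d e τ l x ≠ 0 := by
  let : NormedAlgebra ℚ ((ℝ × ℝ) →L[ℝ] (ℝ × ℝ)) := NormedAlgebra.restrictScalars ℚ ℝ _
  obtain ⟨y, hy⟩ := (NormedSpace.isUnit_exp (τ • slGen c d e l))
  intro h
  apply hx
  have : (y⁻¹ : ((ℝ × ℝ) →L[ℝ] (ℝ × ℝ))ˣ).val (y.val x) = x := by
    rw [← mul_apply_eq_comp]; simp
  rw [← this, hy]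
  unfold slFlow at h
  rw [h]; simp

lemma slFlow_deriv1 (c d e l τ : ℝ) (x : ℝ × ℝ) :
    HasDerivAt (fun σ => (slFlow c d e σ l x).1) (c * (slFlow c d e τ l x).2) τ := by
  have h := (slFlow_deriv c d e l τ x).fst
  rwa [slGen_apply] at h

lemma slFlow_deriv2 (c d e l τ : ℝ) (x : ℝ × ℝ) :
    HasDerivAt (fun σ => (slFlow c d e σ l x).2) ((d - l * e) * (slFlow c d e τ l x).1) τ := by
  have h := (slFlow_deriv c d e l τ x).snd
  rwa [slGen_apply] at h

/-- Uniqueness for the system, with values in any normed space. -/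
lemma sl_unique {F : Type*} [NormedAddCommGroup F] [NormedSpace ℝ F] (c m t : ℝ)
    (u v u' v' : ℝ → F)
    (hu : ∀ τ ∈ Set.Icc 0 t, HasDerivWithinAt u (c • v τ) (Set.Icc 0 t) τ)
    (hv : ∀ τ ∈ Set.Icc 0 t, HasDerivWithinAt v (m • u τ) (Set.Icc 0 t) τ)
    (hu' : ∀ τ ∈ Set.Icc 0 t, HasDerivWithinAt u' (c • v' τ) (Set.Icc 0 t) τ)
    (hv' : ∀ τ ∈ Set.Icc 0 t, HasDerivWithinAt v' (m • u' τ) (Set.Icc 0 t) τ)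
    (h0 : u 0 = u' 0) (h1 : v 0 = v' 0) :
    ∀ τ ∈ Set.Icc 0 t, u τ = u' τ ∧ v τ = v' τ := by
  let A : (F × F) →L[ℝ] (F × F) :=
    c • ((ContinuousLinearMap.inl ℝ F F).comp (ContinuousLinearMap.snd ℝ F F)) +
    m • ((ContinuousLinearMap.inr ℝ F F).comp (ContinuousLinearMap.fst ℝ F F))
  have hA : ∀ x : F × F, A x = (c • x.2, m • x.1) := by
    intro x; simp [A]
  have key : Set.EqOn (fun τ => (u τ, v τ)) (fun τ => (u' τ, v' τ)) (Set.Icc 0 t) := by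
    have hIci : ∀ {f : ℝ → F × F} {f' : F × F}, ∀ τ ∈ Set.Ico 0 t,
        HasDerivWithinAt f f' (Set.Icc 0 t) τ → HasDerivWithinAt f f' (Set.Ici τ) τ := by
      intro f f' τ hτ h
      refine HasDerivWithinAt.mono_of_mem_nhdsWithin h ?_
      exact Filter.mem_of_superset (Icc_mem_nhdsGE hτ.2) (Set.Icc_subset_Icc_left hτ.1)
    refine ODE_solution_unique (v := fun _ => A) (K := ‖A‖₊) (fun _ => A.lipschitz) ?_ ?_ ?_ ?_ ?_
    · intro τ hτ
      exact ((hu τ hτ).continuousWithinAt).prodMk ((hv τ hτ).continuousWithinAt)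
    · intro τ hτ
      apply hIci τ hτ
      rw [hA]
      exact (hu τ ⟨hτ.1, hτ.2.le⟩).prodMk (hv τ ⟨hτ.1, hτ.2.le⟩)
    · intro τ hτ
      exact ((hu' τ hτ).continuousWithinAt).prodMk ((hv' τ hτ).continuousWithinAt)
    · intro τ hτ
      apply hIci τ hτ
      rw [hA]
      exact (hu' τ ⟨hτ.1, hτ.2.le⟩).prodMk (hv' τ ⟨hτ.1, hτ.2.le⟩)
    · simp [h0, h1]
  intro τ hτ
  have := key hτ
  simpa using this

/-- Continuous logarithm of a non-vanishing family of curves. -/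
lemma exists_cont_log (z z' : ℝ → ℝ → ℂ) (z0 : ℂ)
    (hz : Continuous (fun p : ℝ × ℝ => z p.1 p.2))
    (hz' : Continuous (fun p : ℝ × ℝ => z' p.1 p.2))
    (hd : ∀ l τ, HasDerivAt (fun σ => z σ l) (z' τ l) τ)
    (hne : ∀ τ l, z τ l ≠ 0) (h0 : ∀ l, z 0 l = z0) :
    ∃ L : ℝ → ℝ → ℂ, Continuous (fun p : ℝ × ℝ => L p.1 p.2) ∧
      (∀ l, L 0 l = Complex.log z0) ∧
      (∀ l τ, HasDerivAt (fun σ => L σ l) (z' τ l / z τ l) τ) ∧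
      (∀ τ l, z τ l = Complex.exp (L τ l)) := by
  have hcont : Continuous (fun p : ℝ × ℝ => z' p.1 p.2 / z p.1 p.2) :=
    hz'.div hz (fun p => hne _ _)
  have hder : ∀ l τ, HasDerivAt (fun σ => Complex.log z0 + ∫ s in (0:ℝ)..σ, z' s l / z s l)
      (z' τ l / z τ l) τ := by
    intro l τ
    have hc : Continuous (fun s => z' s l / z s l) :=
      hcont.comp (continuous_id.prodMk continuous_const)
    exact (hc.integral_hasStrictDerivAt 0 τ).hasDerivAt.const_add _
  refine ⟨fun τ l => Complex.log z0 + ∫ s in (0:ℝ)..τ, z' s l / z s l, ?_, ?_, hder, ?_⟩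
  · refine continuous_const.add ?_
    refine intervalIntegral.continuous_parametric_intervalIntegral_of_continuous
      (f := fun (p : ℝ × ℝ) s => z' s p.2 / z s p.2) (s := fun p => p.1) ?_ continuous_fst
    exact hcont.comp (continuous_snd.prodMk (continuous_snd.comp continuous_fst))
  · intro l; simp
  · intro τ l
    have hz0 : z0 ≠ 0 := h0 l ▸ hne 0 l
    set L : ℝ → ℂ := fun τ => Complex.log z0 + ∫ s in (0:ℝ)..τ, z' s l / z s l with hL
    have hL' : ∀ τ, HasDerivAt L (z' τ l / z τ l) τ := hder l
    have hG : ∀ τ, HasDerivAt (fun σ => z σ l * Complex.exp (-L σ)) 0 τ := by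
      intro τ
      have h1 := (hd l τ).mul ((hL' τ).neg.cexp)
      refine HasDerivAt.congr_deriv h1 ?_
      have := hne τ l
      field_simp
      ring
    have hc := is_const_of_deriv_eq_zero (fun s => (hG s).differentiableAt)
      (fun s => (hG s).deriv) τ 0
    have hL0 : L 0 = Complex.log z0 := by simp [hL]
    rw [hL0, h0, Complex.exp_neg, Complex.exp_neg, Complex.exp_log hz0,
      mul_inv_cancel₀ hz0] at hc
    have he := Complex.exp_ne_zero (L τ)
    field_simp at hc
    exact hc

/-- Comparison of a continuous logarithm with the principal logarithm. -/
lemma log_compare (L z z' : ℝ → ℂ) (τ κ : ℝ) (hτ : 0 ≤ τ) (w0 : ℂ) (hw : w0 ≠ 0)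
    (hL : ∀ σ, HasDerivAt L (z' σ / z σ) σ) (hz : ∀ σ, HasDerivAt z (z' σ) σ)
    (hne : ∀ σ, z σ ≠ 0)
    (hs : ∀ σ ∈ Set.Icc 0 τ, z σ * Complex.exp ((κ * σ : ℝ) * Complex.I) / w0
      ∈ Complex.slitPlane) :
    L τ + (κ * τ : ℝ) * Complex.I
        - Complex.log (z τ * Complex.exp ((κ * τ : ℝ) * Complex.I) / w0)
      = L 0 - Complex.log (z 0 / w0) := by
  have hk : ∀ σ : ℝ, HasDerivAt (fun σ : ℝ => ((κ * σ : ℝ) : ℂ) * Complex.I)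
      ((κ : ℂ) * Complex.I) σ := by
    intro σ
    have h1 : HasDerivAt (fun σ : ℝ => κ * σ) κ σ := by
      simpa using (hasDerivAt_id σ).const_mul κ
    exact h1.ofReal_comp.mul_const _
  have hG : ∀ σ ∈ Set.Icc 0 τ, HasDerivAt (fun σ : ℝ => L σ + ((κ * σ : ℝ) : ℂ) * Complex.I
      - Complex.log (z σ * Complex.exp ((κ * σ : ℝ) * Complex.I) / w0)) 0 σ := by
    intro σ hσ
    have h1 := ((hz σ).mul ((hk σ).cexp)).div_const w0
    have h2 := h1.clog_real (hs σ hσ)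
    refine HasDerivAt.congr_deriv (((hL σ).add (hk σ)).sub h2) ?_
    have := hne σ
    have he := Complex.exp_ne_zero ((κ * σ : ℝ) * Complex.I)
    simp only [Pi.mul_apply]
    field_simp
    ring
  have := constant_of_has_deriv_right_zero
    (fun σ hσ => (hG σ hσ).continuousAt.continuousWithinAt)
    (fun σ hσ => (hG σ ⟨hσ.1, hσ.2.le⟩).hasDerivWithinAt) τ ⟨hτ, le_rfl⟩
  simpa using this

/-- The rotating frame is constant for `c m = -k²`. -/
lemma rot_const (c m k : ℝ) (hc : 0 < c) (hk : k ^ 2 = -(c * m)) (u v : ℝ → ℝ)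
    (hu : ∀ σ, HasDerivAt u (c * v σ) σ) (hv : ∀ σ, HasDerivAt v (m * u σ) σ) (τ : ℝ) :
    ((v τ : ℂ) - ((k / c * u τ : ℝ) : ℂ) * Complex.I) * Complex.exp ((k * τ : ℝ) * Complex.I)
      = (v 0 : ℂ) - ((k / c * u 0 : ℝ) : ℂ) * Complex.I := by
  have hkk : ∀ σ : ℝ, HasDerivAt (fun σ : ℝ => ((k * σ : ℝ) : ℂ) * Complex.I)
      ((k : ℂ) * Complex.I) σ := by
    intro σ
    have h1 : HasDerivAt (fun σ : ℝ => k * σ) k σ := by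
      simpa using (hasDerivAt_id σ).const_mul k
    exact h1.ofReal_comp.mul_const _
  have hG : ∀ σ, HasDerivAt (fun σ : ℝ => ((v σ : ℂ) - ((k / c * u σ : ℝ) : ℂ) * Complex.I) *
      Complex.exp ((k * σ : ℝ) * Complex.I)) 0 σ := by
    intro σ
    have h1 := ((hv σ).ofReal_comp.sub ((((hu σ).const_mul (k / c)).ofReal_comp).mul_const
      Complex.I)).mul ((hkk σ).cexp)
    refine HasDerivAt.congr_deriv h1 ?_
    have hc' : (c : ℂ) ≠ 0 := by exact_mod_cast hc.ne'
    have hk' : (k : ℂ) ^ 2 = -(c * m) := by exact_mod_cast hk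
    simp only [Pi.sub_apply]
    generalize Complex.exp ((k * σ : ℝ) * Complex.I) = E
    push_cast
    field_simp
    linear_combination (-(Complex.I ^ 2) * (u σ : ℂ) * E) * hk' +
      (c * m * u σ * E) * Complex.I_sq
  have hcst := is_const_of_deriv_eq_zero (fun s => (hG s).differentiableAt)
      (fun s => (hG s).deriv) τ 0
  simpa using hcst

/-- The quotient of the two frames avoids the negative real axis. -/
lemma quot_slit (θ q u v : ℝ) (hq : 0 < q) (hne : u ≠ 0 ∨ v ≠ 0) :
    (((v + θ * u : ℝ) : ℂ) - (u : ℂ) * Complex.I) /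
      ((v : ℂ) - ((q * u : ℝ) : ℂ) * Complex.I) ∈ Complex.slitPlane := by
  have hN : 0 < v ^ 2 + (q * u) ^ 2 := by
    rcases hne with h | h
    · have : q * u ≠ 0 := mul_ne_zero hq.ne' h
      positivity
    · positivity
  have hw : (v : ℂ) - ((q * u : ℝ) : ℂ) * Complex.I ≠ 0 := by
    intro h
    have h1 := congrArg Complex.re h
    have h2 := congrArg Complex.im h
    simp at h1 h2
    rcases h2 with h2 | h2
    · exact hq.ne' h2
    · rw [h1, h2] at hN; simp at hN
  have e : (((v + θ * u : ℝ) : ℂ) - (u : ℂ) * Complex.I) /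
      ((v : ℂ) - ((q * u : ℝ) : ℂ) * Complex.I) =
      ((((v + θ * u) * v + q * u ^ 2) / (v ^ 2 + (q * u) ^ 2) : ℝ) : ℂ) +
      (((u * ((v + θ * u) * q - v)) / (v ^ 2 + (q * u) ^ 2) : ℝ) : ℂ) * Complex.I := by
    obtain ⟨N, hNd⟩ : ∃ N : ℝ, N = v ^ 2 + (q * u) ^ 2 := ⟨_, rfl⟩
    rw [← hNd] at hN ⊢
    have hN' : (N : ℂ) ≠ 0 := by exact_mod_cast hN.ne'
    have hNc : (N : ℂ) = (v : ℂ) ^ 2 + (q * u) ^ 2 := by exact_mod_cast hNd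
    rw [div_eq_iff hw]
    push_cast
    field_simp
    linear_combination ((v : ℂ) + θ * u - u * Complex.I) * hNc +
      (u * ((v + θ * u) * q - v) * q * u : ℂ) * Complex.I_sq
  rw [e, Complex.mem_slitPlane_iff]
  simp only [Complex.add_re, Complex.ofReal_re, Complex.mul_re, Complex.I_re, mul_zero,
    Complex.ofReal_im, Complex.I_im, mul_one, sub_self, add_zero, Complex.add_im, Complex.mul_im,
    zero_add]
  by_cases hu : u = 0
  · left
    subst hu
    have hv : v ≠ 0 := by simpa using hne
    apply div_pos _ hN
    have : 0 < v ^ 2 := by positivity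
    nlinarith
  · by_cases hb : (v + θ * u) * q - v = 0
    · left
      apply div_pos _ hN
      have h1 : ((v + θ * u) * v + q * u ^ 2) * q = v ^ 2 + (q * u) ^ 2 := by
        linear_combination v * hb
      by_contra hcon
      push Not at hcon
      nlinarith
    · right
      exact div_ne_zero (mul_ne_zero hu hb) (ne_of_gt hN)

/-- Explicit hyperbolic solution. -/
lemma hyp_sol (c m k : ℝ) (hk0 : 0 < k) (hk : k ^ 2 = c * m) (u v : ℝ → ℝ) (a b : ℝ)
    (hc : 0 < c)
    (hu : ∀ σ, HasDerivAt u (c * v σ) σ) (hv : ∀ σ, HasDerivAt v (m * u σ) σ)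
    (hu0 : u 0 = a) (hv0 : v 0 = b) (τ : ℝ) (hτ : 0 ≤ τ) :
    u τ = a * Real.cosh (k * τ) + c * b / k * Real.sinh (k * τ) ∧
    v τ = k / c * a * Real.sinh (k * τ) + b * Real.cosh (k * τ) := by
  have hkk : ∀ σ : ℝ, HasDerivAt (fun σ : ℝ => k * σ) k σ := by
    intro σ
    simpa using (hasDerivAt_id σ).const_mul k
  have hm : m = k ^ 2 / c := by field_simp; linarith
  refine sl_unique c m τ u v
    (fun τ => a * Real.cosh (k * τ) + c * b / k * Real.sinh (k * τ))
    (fun τ => k / c * a * Real.sinh (k * τ) + b * Real.cosh (k * τ))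
    (fun σ _ => (hu σ).hasDerivWithinAt) (fun σ _ => (hv σ).hasDerivWithinAt) ?_ ?_
    (by simp [hu0]) (by simp [hv0]) τ ⟨hτ, le_rfl⟩
  · intro σ _
    refine HasDerivAt.hasDerivWithinAt ?_
    refine HasDerivAt.congr_deriv (((hkk σ).cosh.const_mul a).add
      ((hkk σ).sinh.const_mul (c * b / k))) ?_
    simp only [smul_eq_mul]
    field_simp
  · intro σ _
    refine HasDerivAt.hasDerivWithinAt ?_
    refine HasDerivAt.congr_deriv (((hkk σ).sinh.const_mul (k / c * a)).add
      ((hkk σ).cosh.const_mul b)) ?_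
    simp only [smul_eq_mul]
    rw [hm]
    field_simp

lemma tendsto_tanh_one : Filter.Tendsto Real.tanh Filter.atTop (nhds 1) := by
  have h : ∀ x : ℝ, Real.tanh x = 1 - 2 * (Real.exp (2 * x) + 1)⁻¹ := by
    intro x
    rw [Real.tanh_eq_sinh_div_cosh, Real.sinh_eq, Real.cosh_eq]
    have e2 : Real.exp (2 * x) = Real.exp x * Real.exp x := by rw [← Real.exp_add]; ring_nf
    rw [e2, Real.exp_neg]
    have := Real.exp_pos x
    field_simp
    ring
  have h2 : Filter.Tendsto (fun x : ℝ => Real.exp (2 * x) + 1) Filter.atTop Filter.atTop := by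
    refine Filter.tendsto_atTop_add_const_right _ _ ?_
    exact Real.tendsto_exp_atTop.comp (Filter.tendsto_id.const_mul_atTop (by norm_num))
  have h3 := (h2.inv_tendsto_atTop.const_mul 2).const_sub 1
  simp only [mul_zero, sub_zero] at h3
  exact h3.congr (fun x => (h x).symm)

/-- Argument of the hyperbolic solution tends to zero. -/
lemma hyp_arg (c θ a b τ : ℝ) (hc : 0 < c) (hτ : 0 < τ) (hab : 0 < a ∨ (a = 0 ∧ 0 < b)) :
    Filter.Tendsto (fun k : ℝ => Complex.arg
      (((k / c * a * Real.sinh (k * τ) + b * Real.cosh (k * τ) +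
        θ * (a * Real.cosh (k * τ) + c * b / k * Real.sinh (k * τ)) : ℝ) : ℂ) -
        ((a * Real.cosh (k * τ) + c * b / k * Real.sinh (k * τ) : ℝ) : ℂ) * Complex.I))
      Filter.atTop (nhds 0) := by
  have hT : Filter.Tendsto (fun k : ℝ => Real.tanh (k * τ)) Filter.atTop (nhds 1) :=
    tendsto_tanh_one.comp (Filter.tendsto_id.atTop_mul_const hτ)
  have hI : Filter.Tendsto (fun k : ℝ => c / k) Filter.atTop (nhds 0) :=
    Filter.Tendsto.div_atTop tendsto_const_nhds Filter.tendsto_id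
  have hsc : ∀ x : ℝ, Real.sinh x = Real.tanh x * Real.cosh x := by
    intro x
    rw [Real.tanh_eq_sinh_div_cosh]
    have := Real.cosh_pos x
    field_simp
  have harg : ∀ s : ℝ, 0 < s → Complex.arg (s : ℂ) = 0 := fun s hs =>
    Complex.arg_ofReal_of_nonneg hs.le
  have hcts : ∀ s : ℝ, 0 < s → Filter.Tendsto Complex.arg (nhds (s : ℂ)) (nhds 0) := by
    intro s hs
    rw [← harg s hs]
    exact Complex.continuousAt_arg (Complex.ofReal_mem_slitPlane.2 hs)
  rcases hab with ha | ⟨ha, hb⟩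
  · skip
    have hre : Filter.Tendsto (fun k : ℝ => (a * Real.tanh (k * τ) + c / k * b +
        θ * (c / k) * (a + c / k * b * Real.tanh (k * τ)))) Filter.atTop (nhds a) := by
      have := ((hT.const_mul a).add (hI.mul_const b)).add
        ((hI.const_mul θ).mul (((hI.mul_const b).mul hT).const_add a))
      simpa using this
    have him : Filter.Tendsto (fun k : ℝ => (c / k) * (a + c / k * b * Real.tanh (k * τ)))
        Filter.atTop (nhds 0) := by
      have := hI.mul (((hI.mul_const b).mul hT).const_add a)
      simpa using this
    have hz : Filter.Tendsto (fun k : ℝ => (((a * Real.tanh (k * τ) + c / k * b +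
        θ * (c / k) * (a + c / k * b * Real.tanh (k * τ)) : ℝ) : ℂ) -
        (((c / k) * (a + c / k * b * Real.tanh (k * τ)) : ℝ) : ℂ) * Complex.I))
        Filter.atTop (nhds (a : ℂ)) := by
      have h1 := (Complex.continuous_ofReal.tendsto a).comp hre
      have h2 := (((Complex.continuous_ofReal.tendsto 0).comp him).mul_const Complex.I)
      have h3 := h1.sub h2
      simp only [Complex.ofReal_zero, zero_mul, sub_zero] at h3
      exact h3
    have h := (hcts a ha).comp hz
    refine h.congr' ?_
    filter_upwards [Filter.eventually_gt_atTop 0] with k hk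
    have hpos : 0 < k / c * Real.cosh (k * τ) := by
      have := Real.cosh_pos (k * τ); positivity
    simp only [Function.comp]
    rw [← Complex.arg_real_mul _ hpos, hsc]
    congr 1
    have hc' : (c : ℂ) ≠ 0 := by exact_mod_cast hc.ne'
    have hk' : (k : ℂ) ≠ 0 := by exact_mod_cast hk.ne'
    push_cast
    field_simp
    try ring
  · subst ha
    have hre : Filter.Tendsto (fun k : ℝ => (b + θ * (c / k * b * Real.tanh (k * τ))))
        Filter.atTop (nhds b) := by
      have := (((hI.mul_const b).mul hT).const_mul θ).const_add b
      simpa using this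
    have him : Filter.Tendsto (fun k : ℝ => (c / k * b * Real.tanh (k * τ)))
        Filter.atTop (nhds 0) := by
      have := ((hI.mul_const b).mul hT)
      simpa using this
    have hz : Filter.Tendsto (fun k : ℝ => (((b + θ * (c / k * b * Real.tanh (k * τ)) : ℝ) : ℂ) -
        ((c / k * b * Real.tanh (k * τ) : ℝ) : ℂ) * Complex.I))
        Filter.atTop (nhds (b : ℂ)) := by
      have h1 := (Complex.continuous_ofReal.tendsto b).comp hre
      have h2 := (((Complex.continuous_ofReal.tendsto 0).comp him).mul_const Complex.I)
      have h3 := h1.sub h2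
      simp only [Complex.ofReal_zero, zero_mul, sub_zero] at h3
      exact h3
    have h := (hcts b hb).comp hz
    refine h.congr' ?_
    filter_upwards [Filter.eventually_gt_atTop 0] with k hk
    have hpos : 0 < Real.cosh (k * τ) := Real.cosh_pos (k * τ)
    simp only [Function.comp]
    rw [← Complex.arg_real_mul _ hpos, hsc]
    congr 1
    have hk' : (k : ℂ) ≠ 0 := by exact_mod_cast hk.ne'
    push_cast
    field_simp
    try ring

/-- The scalar problem with normalised sign. -/
lemma scalar_pos (c d e θ a b : ℝ) (hc : 0 < c) (he : 0 < e)
    (hab : 0 < a ∨ (a = 0 ∧ 0 < b)) :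
    ∃ ρ φ : ℝ → ℝ → ℝ, Continuous (fun p : ℝ × ℝ => ρ p.1 p.2) ∧
      Continuous (fun p : ℝ × ℝ => φ p.1 p.2) ∧ (∀ τ l, ρ τ l ≠ 0) ∧
      (∀ τ l, (slFlow c d e τ l (a, b)).2 + θ * (slFlow c d e τ l (a, b)).1
        = ρ τ l * Real.cos (φ τ l)) ∧
      (∀ τ l, -(slFlow c d e τ l (a, b)).1 = ρ τ l * Real.sin (φ τ l)) ∧
      (∀ τ, 0 < τ → Filter.Tendsto (fun l => φ τ l) Filter.atTop Filter.atBot) ∧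
      (∀ τ, 0 < τ → Filter.Tendsto (fun l => φ τ l) Filter.atBot (nhds 0)) := by
  obtain ⟨u, hu⟩ : ∃ u : ℝ → ℝ → ℝ, u = fun τ l => (slFlow c d e τ l (a, b)).1 := ⟨_, rfl⟩
  obtain ⟨v, hv⟩ : ∃ v : ℝ → ℝ → ℝ, v = fun τ l => (slFlow c d e τ l (a, b)).2 := ⟨_, rfl⟩
  have huc : Continuous (fun p : ℝ × ℝ => u p.1 p.2) := by
    rw [hu]; exact (slFlow_cont c d e (a, b)).fst
  have hvc : Continuous (fun p : ℝ × ℝ => v p.1 p.2) := by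
    rw [hv]; exact (slFlow_cont c d e (a, b)).snd
  have hud : ∀ l τ, HasDerivAt (fun σ => u σ l) (c * v τ l) τ := by
    intro l τ; rw [hu, hv]; exact slFlow_deriv1 c d e l τ (a, b)
  have hvd : ∀ l τ, HasDerivAt (fun σ => v σ l) ((d - l * e) * u τ l) τ := by
    intro l τ; rw [hu, hv]; exact slFlow_deriv2 c d e l τ (a, b)
  have hu0 : ∀ l, u 0 l = a := by intro l; simp [hu, slFlow_zero]
  have hv0 : ∀ l, v 0 l = b := by intro l; simp [hv, slFlow_zero]
  have hx : (a, b) ≠ (0 : ℝ × ℝ) := by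
    intro h
    rw [Prod.mk_eq_zero] at h
    rcases hab with h1 | h1 <;> linarith
  have huv : ∀ τ l, u τ l ≠ 0 ∨ v τ l ≠ 0 := by
    intro τ l
    by_contra hcon
    push Not at hcon
    apply slFlow_ne c d e τ l (a, b) hx
    rw [hu, hv] at hcon
    exact Prod.ext hcon.1 hcon.2
  set z : ℝ → ℝ → ℂ := fun τ l => ((v τ l + θ * u τ l : ℝ) : ℂ) - (u τ l : ℂ) * Complex.I with hz
  set z' : ℝ → ℝ → ℂ := fun τ l =>
    (((d - l * e) * u τ l + θ * (c * v τ l) : ℝ) : ℂ) - ((c * v τ l : ℝ) : ℂ) * Complex.I with hz'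
  have hzre : ∀ τ l, (z τ l).re = v τ l + θ * u τ l := by intro τ l; simp [hz]
  have hzim : ∀ τ l, (z τ l).im = - u τ l := by intro τ l; simp [hz]
  have hzne : ∀ τ l, z τ l ≠ 0 := by
    intro τ l h
    have h1 := congrArg Complex.re h
    have h2 := congrArg Complex.im h
    rw [hzre] at h1
    rw [hzim] at h2
    simp only [Complex.zero_re, Complex.zero_im, neg_eq_zero] at h1 h2
    rw [h2] at h1
    rcases huv τ l with h3 | h3
    · exact h3 h2
    · exact h3 (by simpa using h1)
  have hzd : ∀ l τ, HasDerivAt (fun σ => z σ l) (z' τ l) τ := by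
    intro l τ
    exact ((hvd l τ).add ((hud l τ).const_mul θ)).ofReal_comp.sub
      ((hud l τ).ofReal_comp.mul_const _)
  obtain ⟨L, hLc, hL0, hLd, hLz⟩ := exists_cont_log z z' (((b + θ * a : ℝ) : ℂ) - a * Complex.I)
    (by
      exact (Complex.continuous_ofReal.comp (hvc.add (huc.const_mul θ))).sub
        ((Complex.continuous_ofReal.comp huc).mul_const _))
    (by
      have hm : Continuous (fun p : ℝ × ℝ => d - p.2 * e) := by fun_prop
      exact (Complex.continuous_ofReal.comp ((hm.mul huc).add ((hvc.const_mul c).const_mul θ))).sub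
        ((Complex.continuous_ofReal.comp (hvc.const_mul c)).mul_const _))
    hzd hzne (by intro l; simp [hz, hu0, hv0])
  refine ⟨fun τ l => Real.exp (L τ l).re, fun τ l => (L τ l).im,
    Real.continuous_exp.comp (Complex.continuous_re.comp hLc), Complex.continuous_im.comp hLc,
    fun τ l => (Real.exp_pos _).ne', ?_, ?_, ?_, ?_⟩
  · intro τ l
    have h := hzre τ l
    rw [hLz, Complex.exp_re] at h
    rw [h, hu, hv]
  · intro τ l
    have h := hzim τ l
    rw [hLz, Complex.exp_im] at h
    rw [h, hu]
  · intro τ hτ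
    set A := (Complex.log (((b + θ * a : ℝ) : ℂ) - a * Complex.I)).im with hA
    have hin : Filter.Tendsto (fun l : ℝ => c * (l * e - d)) Filter.atTop Filter.atTop := by
      refine Filter.Tendsto.const_mul_atTop hc ?_
      exact Filter.tendsto_atTop_add_const_right _ (-d) (Filter.tendsto_id.atTop_mul_const he)
    have hb : Filter.Tendsto (fun l : ℝ => (A + 2 * Real.pi) +
        -(Real.sqrt (c * (l * e - d)) * τ)) Filter.atTop Filter.atBot := by
      refine Filter.tendsto_atBot_add_const_left _ _ ?_
      refine Filter.tendsto_neg_atTop_atBot.comp ?_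
      exact (Real.tendsto_sqrt_atTop.comp hin).atTop_mul_const hτ
    refine Filter.tendsto_atBot_mono' _ ?_ hb
    filter_upwards [hin.eventually_gt_atTop 0] with l hl
    set k := Real.sqrt (c * (l * e - d)) with hk
    have hk0 : 0 < k := Real.sqrt_pos.2 hl
    have hk2 : k ^ 2 = -(c * (d - l * e)) := by
      rw [hk, Real.sq_sqrt hl.le]; ring
    have hrot := rot_const c (d - l * e) k hc hk2 (fun σ => u σ l) (fun σ => v σ l) (hud l) (hvd l)
    set w0 : ℂ := (v 0 l : ℂ) - ((k / c * u 0 l : ℝ) : ℂ) * Complex.I with hw0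
    have hq : 0 < k / c := by positivity
    have hw0ne : w0 ≠ 0 := by
      intro h
      have h1 := quot_slit θ (k / c) (u 0 l) (v 0 l) hq (huv 0 l)
      rw [← hw0, h, div_zero] at h1
      exact Complex.zero_notMem_slitPlane h1
    have hF : ∀ σ ∈ Set.Icc 0 τ, z σ l * Complex.exp ((k * σ : ℝ) * Complex.I) / w0
        ∈ Complex.slitPlane := by
      intro σ _
      have h1 := quot_slit θ (k / c) (u σ l) (v σ l) hq (huv σ l)
      rw [← hrot σ, mul_div_mul_right _ _ (Complex.exp_ne_zero _)]
      exact h1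
    have hcmp := log_compare (fun σ => L σ l) (fun σ => z σ l) (fun σ => z' σ l) τ k hτ.le w0 hw0ne
      (hLd l) (hzd l) (fun σ => hzne σ l) hF
    have him := congrArg Complex.im hcmp
    simp only [Complex.sub_im, Complex.add_im, Complex.mul_im, Complex.ofReal_re, Complex.I_im,
      Complex.ofReal_im, Complex.I_re, mul_zero, mul_one, add_zero, hL0, Complex.log_im] at him
    have h1 := Complex.arg_le_pi (z τ l * Complex.exp ((k * τ : ℝ) * Complex.I) / w0)
    have h2 := Complex.neg_pi_lt_arg (z 0 l / w0)
    rw [hA, Complex.log_im]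
    linarith
  · intro τ hτ
    have hin : Filter.Tendsto (fun l : ℝ => Real.sqrt (c * (d - l * e)))
        Filter.atBot Filter.atTop := by
      refine Real.tendsto_sqrt_atTop.comp (Filter.Tendsto.const_mul_atTop hc ?_)
      refine Filter.tendsto_atTop_add_const_left _ d ?_
      exact Filter.tendsto_neg_atBot_atTop.comp (Filter.tendsto_id.atBot_mul_const he)
    refine ((hyp_arg c θ a b τ hc hτ hab).comp hin).congr' ?_
    have hpos : ∀ᶠ l : ℝ in Filter.atBot, 0 < Real.sqrt (c * (d - l * e)) ∧
        c * |b| < a * Real.sqrt (c * (d - l * e)) ∨ 0 < Real.sqrt (c * (d - l * e)) ∧ a = 0 := by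
      rcases hab with ha | ha
      · filter_upwards [hin.eventually_gt_atTop 0, hin.eventually_gt_atTop (c * |b| / a)] with l h1 h2
        left
        refine ⟨h1, ?_⟩
        rw [div_lt_iff₀ ha] at h2
        linarith
      · filter_upwards [hin.eventually_gt_atTop 0] with l h1
        exact Or.inr ⟨h1, ha.1⟩
    filter_upwards [hpos] with l hl
    simp only [Function.comp]
    set k := Real.sqrt (c * (d - l * e)) with hk
    have hk0 : 0 < k := by rcases hl with h | h <;> exact h.1
    have hk2 : k ^ 2 = c * (d - l * e) := by
      rw [hk, Real.sq_sqrt (Real.sqrt_pos.1 hk0).le]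
    have hsol : ∀ σ : ℝ, 0 ≤ σ → _ := fun σ hσ => hyp_sol c (d - l * e) k hk0 hk2 (fun σ => u σ l)
      (fun σ => v σ l) a b hc (hud l) (hvd l) (hu0 l) (hv0 l) σ hσ
    have hslit : ∀ σ ∈ Set.Icc 0 τ, z σ l ∈ Complex.slitPlane := by
      intro σ hσ
      rw [Complex.mem_slitPlane_iff, hzre, hzim]
      obtain ⟨h1, h2⟩ := hsol σ hσ.1
      have hch := Real.cosh_pos (k * σ)
      have hkσ : 0 ≤ k * σ := mul_nonneg hk0.le hσ.1
      have hsh : 0 ≤ Real.sinh (k * σ) := Real.sinh_nonneg_iff.2 hkσ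
      have hlt : Real.sinh (k * σ) < Real.cosh (k * σ) := Real.sinh_lt_cosh _
      rcases hl with ⟨_, hl⟩ | ⟨_, ha⟩
      · right
        apply ne_of_lt
        rw [neg_lt_zero, h1]
        have hb1 : -|b| ≤ b := neg_abs_le b
        have e1 : a * Real.cosh (k * σ) + c * b / k * Real.sinh (k * σ) =
            (a * k * Real.cosh (k * σ) + c * b * Real.sinh (k * σ)) / k := by field_simp
        rw [e1]
        apply div_pos _ hk0
        have e2 : c * |b| * Real.cosh (k * σ) < a * k * Real.cosh (k * σ) :=
          mul_lt_mul_of_pos_right hl hch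
        have e3 : c * |b| * Real.sinh (k * σ) ≤ c * |b| * Real.cosh (k * σ) :=
          mul_le_mul_of_nonneg_left hlt.le (by positivity)
        have e4 : c * (-|b|) * Real.sinh (k * σ) ≤ c * b * Real.sinh (k * σ) := by gcongr
        linarith
      · have hb : 0 < b := by rcases hab with h | h <;> linarith
        by_cases hs : Real.sinh (k * σ) = 0
        · left
          rw [h1, h2, ha, hs]
          simp
          positivity
        · right
          rw [h1, ha]
          have : c * b / k * Real.sinh (k * σ) ≠ 0 := mul_ne_zero (by positivity) hs
          simpa using this
    have hcmp := log_compare (fun σ => L σ l) (fun σ => z σ l) (fun σ => z' σ l) τ 0 hτ.le 1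
      one_ne_zero (hLd l) (hzd l) (fun σ => hzne σ l) (by simpa using hslit)
    have hz0 : z 0 l = ((b + θ * a : ℝ) : ℂ) - a * Complex.I := by simp [hz, hu0, hv0]
    simp only [hL0, hz0] at hcmp
    simp only [zero_mul, Complex.ofReal_zero, Complex.exp_zero, mul_one, div_one, add_zero,
      sub_self] at hcmp
    have hfin : L τ l = Complex.log (z τ l) := by linear_combination hcmp
    rw [hfin, Complex.log_im, hz]
    obtain ⟨h1, h2⟩ := hsol τ hτ.le
    simp only [h1, h2]

/-- The scalar problem. -/
lemma scalar_all (c d e θ a b : ℝ) (hc : 0 < c) (he : 0 < e)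
    (hab : a ≠ 0 ∨ b ≠ 0) :
    ∃ ρ φ : ℝ → ℝ → ℝ, Continuous (fun p : ℝ × ℝ => ρ p.1 p.2) ∧
      Continuous (fun p : ℝ × ℝ => φ p.1 p.2) ∧ (∀ τ l, ρ τ l ≠ 0) ∧
      (∀ τ l, (slFlow c d e τ l (a, b)).2 + θ * (slFlow c d e τ l (a, b)).1
        = ρ τ l * Real.cos (φ τ l)) ∧
      (∀ τ l, -(slFlow c d e τ l (a, b)).1 = ρ τ l * Real.sin (φ τ l)) ∧
      (∀ τ, 0 < τ → Filter.Tendsto (fun l => φ τ l) Filter.atTop Filter.atBot) ∧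
      (∀ τ, 0 < τ → Filter.Tendsto (fun l => φ τ l) Filter.atBot (nhds 0)) := by
  by_cases h : 0 < a ∨ (a = 0 ∧ 0 < b)
  · exact scalar_pos c d e θ a b hc he h
  · have h' : 0 < -a ∨ (-a = 0 ∧ 0 < -b) := by
      rcases lt_trichotomy a 0 with h1 | h1 | h1
      · left; linarith
      · right
        refine ⟨by simp [h1], ?_⟩
        rcases lt_trichotomy b 0 with h2 | h2 | h2
        · linarith
        · simp [h1, h2] at hab
        · exact absurd (Or.inr ⟨h1, h2⟩) h
      · exact absurd (Or.inl h1) h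
    obtain ⟨ρ, φ, h1, h2, h3, h4, h5, h6, h7⟩ := scalar_pos c d e θ (-a) (-b) hc he h'
    have hneg : ∀ τ l, slFlow c d e τ l (-a, -b) = - slFlow c d e τ l (a, b) := by
      intro τ l
      rw [← map_neg]; rfl
    refine ⟨fun τ l => - ρ τ l, φ, h1.neg, h2, fun τ l => neg_ne_zero.2 (h3 τ l), ?_, ?_, h6, h7⟩
    · intro τ l
      have := h4 τ l
      rw [hneg] at this
      simp only [Prod.fst_neg, Prod.snd_neg] at this
      linarith
    · intro τ l
      have := h5 τ l
      rw [hneg] at this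
      simp only [Prod.fst_neg] at this
      linarith

lemma exists_det_ne {n : ℕ} (α β : Mat n) (h1 : α * αᵀ + β * βᵀ = 1)
    (h2 : α * βᵀ = β * αᵀ) : ∃ x : ℝ, (α + x • β).det ≠ 0 := by
  by_contra hcon
  push Not at hcon
  let P : Polynomial ℝ := (α.map Polynomial.C + (Polynomial.X : Polynomial ℝ) •
    β.map Polynomial.C).det
  have hP : P = 0 := by
    apply Polynomial.funext
    intro x
    rw [Polynomial.eval_zero, ← hcon x]
    have := RingHom.map_det (Polynomial.evalRingHom x)
      (α.map Polynomial.C + (Polynomial.X : Polynomial ℝ) • β.map Polynomial.C)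
    rw [Polynomial.coe_evalRingHom] at this
    rw [this]
    congr 1
    ext i j
    simp
    exact mul_comm _ _
  have hPI : Polynomial.eval₂ Complex.ofRealHom Complex.I P =
      (α.map Complex.ofReal + Complex.I • β.map Complex.ofReal).det := by
    have := RingHom.map_det (Polynomial.eval₂RingHom Complex.ofRealHom Complex.I)
      (α.map Polynomial.C + (Polynomial.X : Polynomial ℝ) • β.map Polynomial.C)
    rw [Polynomial.coe_eval₂RingHom] at this
    rw [this]
    congr 1
    ext i j
    simp
    exact mul_comm _ _
  rw [hP, Polynomial.eval₂_zero] at hPI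
  have hm : ∀ A B : Mat n, (A * B).map Complex.ofReal =
      A.map Complex.ofReal * B.map Complex.ofReal := by
    intro A B
    exact Matrix.map_mul (f := Complex.ofRealHom)
  have hmul : (α.map Complex.ofReal + Complex.I • β.map Complex.ofReal) *
      (αᵀ.map Complex.ofReal - Complex.I • βᵀ.map Complex.ofReal) = 1 := by
    have e1 : α.map Complex.ofReal * αᵀ.map Complex.ofReal +
        β.map Complex.ofReal * βᵀ.map Complex.ofReal = 1 := by
      rw [← hm, ← hm]
      have := congrArg (fun M : Mat n => M.map Complex.ofReal) h1
      rw [Matrix.map_add _ (by simp)] at this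
      rw [this]
      exact Matrix.map_one _ (by simp) (by simp)
    have e2 : α.map Complex.ofReal * βᵀ.map Complex.ofReal =
        β.map Complex.ofReal * αᵀ.map Complex.ofReal := by
      rw [← hm, ← hm, h2]
    rw [add_mul, mul_sub, mul_sub, Matrix.mul_smul, Matrix.smul_mul, Matrix.smul_mul,
      Matrix.mul_smul, e2, smul_smul, Complex.I_mul_I, neg_one_smul, ← e1]
    abel
  have hdet := congrArg Matrix.det hmul
  rw [Matrix.det_mul, ← hPI, zero_mul, Matrix.det_one] at hdet
  exact zero_ne_one hdet

lemma exists_simult_diag {n : ℕ} (α β : Mat n) (h1 : α * αᵀ + β * βᵀ = 1)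
    (h2 : α * βᵀ = β * αᵀ) : ∃ (W R : Mat n) (a b : Fin n → ℝ), W.det ≠ 0 ∧ R * Rᵀ = 1 ∧
      Rᵀ * R = 1 ∧ α = W * Matrix.diagonal a * Rᵀ ∧ β = -(W * Matrix.diagonal b * Rᵀ) ∧
      ∀ i, a i ≠ 0 ∨ b i ≠ 0 := by
  obtain ⟨x, hx⟩ := exists_det_ne α β h1 h2
  obtain ⟨γ, hγ⟩ : ∃ γ : Mat n, γ = α + x • β := ⟨_, rfl⟩
  rw [← hγ] at hx
  have hu : IsUnit γ.det := isUnit_iff_ne_zero.2 hx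
  have hsym : γ * βᵀ = β * γᵀ := by
    rw [hγ, Matrix.transpose_add, Matrix.transpose_smul, add_mul, mul_add, h2,
      Matrix.smul_mul, Matrix.mul_smul]
  have hH : (γ⁻¹ * β).IsHermitian := by
    rw [Matrix.IsHermitian, Matrix.conjTranspose_eq_transpose_of_trivial, Matrix.transpose_mul,
      Matrix.transpose_nonsing_inv]
    have hu' : IsUnit γᵀ.det := by rwa [Matrix.det_transpose]
    calc βᵀ * γᵀ⁻¹ = γ⁻¹ * (γ * βᵀ) * γᵀ⁻¹ := by
          rw [Matrix.nonsing_inv_mul_cancel_left _ _ hu]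
      _ = γ⁻¹ * β * (γᵀ * γᵀ⁻¹) := by rw [hsym]; simp only [Matrix.mul_assoc]
      _ = γ⁻¹ * β := by rw [Matrix.mul_nonsing_inv _ hu', mul_one]
  let R : Mat n := (hH.eigenvectorUnitary : Mat n)
  have hR1 : R * Rᵀ = 1 := by
    have := (Matrix.mem_unitaryGroup_iff (A := R)).1 hH.eigenvectorUnitary.2
    rwa [Matrix.star_eq_conjTranspose, Matrix.conjTranspose_eq_transpose_of_trivial] at this
  have hR2 : Rᵀ * R = 1 := by
    have := (Matrix.mem_unitaryGroup_iff' (A := R)).1 hH.eigenvectorUnitary.2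
    rwa [Matrix.star_eq_conjTranspose, Matrix.conjTranspose_eq_transpose_of_trivial] at this
  have hspec : γ⁻¹ * β = R * Matrix.diagonal hH.eigenvalues * Rᵀ := by
    have := hH.spectral_theorem
    rw [Unitary.conjStarAlgAut_apply, Matrix.star_eq_conjTranspose,
      Matrix.conjTranspose_eq_transpose_of_trivial] at this
    exact this
  have hβ : β = γ * R * Matrix.diagonal hH.eigenvalues * Rᵀ := by
    calc β = γ * (γ⁻¹ * β) := by rw [Matrix.mul_nonsing_inv_cancel_left _ _ hu]
      _ = γ * (R * Matrix.diagonal hH.eigenvalues * Rᵀ) := congrArg (fun M => γ * M) hspec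
      _ = _ := by simp only [Matrix.mul_assoc]
  refine ⟨γ * R, R, fun i => 1 - x * hH.eigenvalues i, fun i => - hH.eigenvalues i, ?_, hR1, hR2,
    ?_, ?_, ?_⟩
  · rw [Matrix.det_mul]
    refine mul_ne_zero hx ?_
    intro h0
    have := congrArg Matrix.det hR1
    rw [Matrix.det_mul, h0, zero_mul, Matrix.det_one] at this
    exact zero_ne_one this
  · have hd : (Matrix.diagonal (fun i => 1 - x * hH.eigenvalues i) : Mat n) =
        1 - x • Matrix.diagonal hH.eigenvalues := by
      ext i j
      by_cases hij : i = j
      · subst hij; simp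
      · simp [hij]
    have hα : α = γ - x • β := by rw [hγ]; simp
    rw [hd, mul_sub, sub_mul, mul_one, Matrix.mul_smul, Matrix.smul_mul, ← hβ, Matrix.mul_assoc,
      hR1, mul_one]
    exact hα
  · have hd : (Matrix.diagonal (fun i => - hH.eigenvalues i) : Mat n) =
        - Matrix.diagonal hH.eigenvalues := by
      rw [← Matrix.diagonal_neg]
    rw [hd, mul_neg, neg_mul, neg_neg]
    exact hβ
  · intro i
    by_cases h : hH.eigenvalues i = 0
    · left; simp [h]
    · right; simpa using h

lemma mat_conj_pow {n : ℕ} (R : Mat n) (hR : Rᵀ * R = 1) (hR' : R * Rᵀ = 1) (x : Fin n → ℝ) (k : ℕ) :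
    (R * Matrix.diagonal x * Rᵀ) ^ k = R * Matrix.diagonal (x ^ k) * Rᵀ := by
  induction k with
  | zero => simp [hR']
  | succ k ih =>
    rw [pow_succ, ih]
    calc R * Matrix.diagonal (x ^ k) * Rᵀ * (R * Matrix.diagonal x * Rᵀ)
        = R * Matrix.diagonal (x ^ k) * (Rᵀ * R) * Matrix.diagonal x * Rᵀ := by
          simp only [Matrix.mul_assoc]
      _ = R * (Matrix.diagonal (x ^ k) * Matrix.diagonal x) * Rᵀ := by
          rw [hR, mul_one]; simp only [Matrix.mul_assoc]
      _ = _ := by rw [Matrix.diagonal_mul_diagonal]; rfl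

lemma conj_hasSum {n : ℕ} (R : Mat n) (hR : Rᵀ * R = 1) (hR' : R * Rᵀ = 1) (x y : Fin n → ℝ)
    (f : ℕ → ℝ) (g : ℕ → ℕ) (h : ∀ i, HasSum (fun k => f k * x i ^ g k) (y i)) :
    HasSum (fun k => f k • (R * Matrix.diagonal x * Rᵀ) ^ g k) (R * Matrix.diagonal y * Rᵀ) := by
  have h1 : HasSum (fun k => fun i => f k * x i ^ g k) y := Pi.hasSum.2 h
  have h2 := (h1.matrix_diagonal.mul_left R).mul_right Rᵀ
  have e : (fun k => f k • (R * Matrix.diagonal x * Rᵀ) ^ g k) =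
      (fun k => R * Matrix.diagonal (fun i => f k * x i ^ g k) * Rᵀ) := by
    funext k
    rw [mat_conj_pow R hR hR', ← Matrix.smul_mul, ← Matrix.mul_smul, ← Matrix.diagonal_smul]
    rfl
  rw [e]
  exact h2

lemma mcos_conj {n : ℕ} (R : Mat n) (hR : Rᵀ * R = 1) (hR' : R * Rᵀ = 1) (x : Fin n → ℝ) :
    mcos (R * Matrix.diagonal x * Rᵀ) = R * Matrix.diagonal (fun i => Real.cos (x i)) * Rᵀ := by
  refine (conj_hasSum R hR hR' x _ (fun k => (-1 : ℝ) ^ k / (Nat.factorial (2 * k) : ℝ))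
    (fun k => 2 * k) ?_).tsum_eq
  intro i
  convert Real.hasSum_cos (x i) using 2
  ring

lemma msin_conj {n : ℕ} (R : Mat n) (hR : Rᵀ * R = 1) (hR' : R * Rᵀ = 1) (x : Fin n → ℝ) :
    msin (R * Matrix.diagonal x * Rᵀ) = R * Matrix.diagonal (fun i => Real.sin (x i)) * Rᵀ := by
  refine (conj_hasSum R hR hR' x _ (fun k => (-1 : ℝ) ^ k / (Nat.factorial (2 * k + 1) : ℝ))
    (fun k => 2 * k + 1) ?_).tsum_eq
  intro i
  convert Real.hasSum_sin (x i) using 2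
  ring

lemma conj_eig {n : ℕ} (R : Mat n) (hR' : R * Rᵀ = 1) (x : Fin n → ℝ)
    (μ : ℝ) (h : (R * Matrix.diagonal x * Rᵀ - μ • (1 : Mat n)).det = 0) : ∃ i, x i = μ := by
  have e : R * Matrix.diagonal x * Rᵀ - μ • (1 : Mat n) =
      R * Matrix.diagonal (fun i => x i - μ) * Rᵀ := by
    have hd : (Matrix.diagonal (fun i => x i - μ) : Mat n) = Matrix.diagonal x - μ • 1 := by
      ext i j
      by_cases hij : i = j
      · subst hij; simp
      · simp [hij]
    rw [hd, mul_sub, sub_mul, Matrix.mul_smul, Matrix.smul_mul, mul_one, hR']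
  have hdR : R.det * Rᵀ.det = 1 := by rw [← Matrix.det_mul, hR', Matrix.det_one]
  rw [e, Matrix.det_mul, Matrix.det_mul, mul_right_comm, hdR, one_mul, Matrix.det_diagonal,
    Finset.prod_eq_zero_iff] at h
  obtain ⟨i, _, hi⟩ := h
  exact ⟨i, by linarith⟩

/-- The scalar-coefficient lemma: limits of the polar angle `φ(τ,λ)` as
`λ → ±∞` in the case `C₀ = cI`, `D = dI`, `E = eI`, `δ = θI`. -/
theorem polar_angle_limits_scalar_case
    (n : ℕ) (hn : 1 ≤ n) (T : EReal) (hT : 0 < T)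
    (S : Set ℝ) (hS : S = {τ : ℝ | 0 ≤ τ ∧ (τ : EReal) < T})
    (C₀ D E : ℝ → Mat n)
    (hC₀c : ContinuousOn C₀ S) (hDc : ContinuousOn D S) (hEc : ContinuousOn E S)
    (hC₀s : ∀ τ ∈ S, (C₀ τ)ᵀ = C₀ τ) (hDs : ∀ τ ∈ S, (D τ)ᵀ = D τ)
    (hEs : ∀ τ ∈ S, (E τ)ᵀ = E τ)
    (hC₀pos : ∀ τ ∈ S, (C₀ τ).PosDef) (hEpos : ∀ τ ∈ S, (E τ).PosDef)
    (Qc Pc Qs Ps : ℝ → ℝ → Mat n)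
    (hQc' : ∀ l : ℝ, ∀ τ ∈ S,
      HasDerivWithinAt (fun σ => Qc σ l) (C₀ τ * Pc τ l) S τ)
    (hPc' : ∀ l : ℝ, ∀ τ ∈ S,
      HasDerivWithinAt (fun σ => Pc σ l) ((D τ - l • E τ) * Qc τ l) S τ)
    (hQs' : ∀ l : ℝ, ∀ τ ∈ S,
      HasDerivWithinAt (fun σ => Qs σ l) (C₀ τ * Ps τ l) S τ)
    (hPs' : ∀ l : ℝ, ∀ τ ∈ S,
      HasDerivWithinAt (fun σ => Ps σ l) ((D τ - l • E τ) * Qs τ l) S τ)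
    (hQc0 : ∀ l : ℝ, Qc 0 l = 1) (hPs0 : ∀ l : ℝ, Ps 0 l = 1)
    (hQs0 : ∀ l : ℝ, Qs 0 l = 0) (hPc0 : ∀ l : ℝ, Pc 0 l = 0)
    (α₀ β₀ : Mat n)
    (hαβ1 : α₀ * α₀ᵀ + β₀ * β₀ᵀ = 1) (hαβ2 : α₀ * β₀ᵀ = β₀ * α₀ᵀ)
    (δ : Mat n) (hδ : δᵀ = δ)
    (Q₂ Q₁ : ℝ → ℝ → Mat n)
    (hQ₂def : ∀ τ l, Q₂ τ l =
      (α₀ * (Qc τ l)ᵀ - β₀ * (Qs τ l)ᵀ) * δ + α₀ * (Pc τ l)ᵀ - β₀ * (Ps τ l)ᵀ)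
    (hQ₁def : ∀ τ l, Q₁ τ l = -(α₀ * (Qc τ l)ᵀ) + β₀ * (Qs τ l)ᵀ)
    (c d e θ : ℝ) (hc : 0 < c) (he : 0 < e)
    (hscalar : ∀ τ ∈ S, C₀ τ = c • (1 : Mat n) ∧ D τ = d • (1 : Mat n) ∧
      E τ = e • (1 : Mat n))
    (hδθ : δ = θ • (1 : Mat n))
    (t : ℝ) (ht : 0 < t) (htT : (t : EReal) < T) :
    ∃ r φ : ℝ → ℝ → Mat n, ∃ φm : Mat n,
      ContinuousOn (fun p : ℝ × ℝ => r p.1 p.2)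
        (Set.Icc 0 t ×ˢ (Set.univ : Set ℝ)) ∧
      ContinuousOn (fun p : ℝ × ℝ => φ p.1 p.2)
        (Set.Icc 0 t ×ˢ (Set.univ : Set ℝ)) ∧
      (∀ τ ∈ Set.Icc 0 t, ∀ l : ℝ, (r τ l).det ≠ 0 ∧ (φ τ l)ᵀ = φ τ l ∧
        Q₂ τ l = r τ l * mcos (φ τ l) ∧ Q₁ τ l = r τ l * msin (φ τ l)) ∧
      φmᵀ = φm ∧
      (∀ μ : ℝ, (φm - μ • (1 : Mat n)).det = 0 → ∃ k : ℤ, μ = k * Real.pi) ∧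
      (∀ τ : ℝ, 0 < τ → τ ≤ t →
        (∀ M : ℝ, ∃ Λ : ℝ, ∀ l : ℝ, Λ ≤ l →
          ∀ μ : ℝ, (φ τ l - μ • (1 : Mat n)).det = 0 → μ < M) ∧
        Filter.Tendsto (fun l => φ τ l) Filter.atBot (nhds φm)) := by
  obtain ⟨W, R, a, b, hW, hR1, hR2, hα, hβ, hab⟩ := exists_simult_diag α₀ β₀ hαβ1 hαβ2
  choose ρ φ hρc hφc hρ0 hcos hsin htop hbot using
    fun i => scalar_all c d e θ (a i) (b i) hc he (hab i)
  have hIS : Set.Icc 0 t ⊆ S := by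
    intro τ hτ
    rw [hS]
    exact ⟨hτ.1, lt_of_le_of_lt (by exact_mod_cast hτ.2) htT⟩
  have hid : ∀ (x : ℝ × ℝ) (U V : ℝ → ℝ → Mat n),
      (∀ l : ℝ, ∀ τ ∈ S, HasDerivWithinAt (fun σ => U σ l) (C₀ τ * V τ l) S τ) →
      (∀ l : ℝ, ∀ τ ∈ S, HasDerivWithinAt (fun σ => V σ l) ((D τ - l • E τ) * U τ l) S τ) →
      (∀ l, U 0 l = x.1 • (1 : Mat n)) → (∀ l, V 0 l = x.2 • (1 : Mat n)) →
      ∀ τ ∈ Set.Icc 0 t, ∀ l, U τ l = (slFlow c d e τ l x).1 • (1 : Mat n) ∧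
        V τ l = (slFlow c d e τ l x).2 • (1 : Mat n) := by
    intro x U V hU hV hU0 hV0 τ hτ l
    refine sl_unique c (d - l * e) t (fun σ => U σ l) (fun σ => V σ l)
      (fun σ => (slFlow c d e σ l x).1 • (1 : Mat n))
      (fun σ => (slFlow c d e σ l x).2 • (1 : Mat n)) ?_ ?_ ?_ ?_ ?_ ?_ τ hτ
    · intro σ hσ
      have h := (hU l σ (hIS hσ)).mono hIS
      rw [(hscalar σ (hIS hσ)).1, Matrix.smul_mul, one_mul] at h
      exact h
    · intro σ hσ
      have h := (hV l σ (hIS hσ)).mono hIS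
      rw [(hscalar σ (hIS hσ)).2.1, (hscalar σ (hIS hσ)).2.2, smul_smul, ← sub_smul,
        Matrix.smul_mul, one_mul] at h
      exact h
    · intro σ _
      have h := ((slFlow_deriv1 c d e l σ x).smul_const (1 : Mat n)).hasDerivWithinAt
        (s := Set.Icc 0 t)
      rw [mul_smul] at h
      exact h
    · intro σ _
      have h := ((slFlow_deriv2 c d e l σ x).smul_const (1 : Mat n)).hasDerivWithinAt
        (s := Set.Icc 0 t)
      rw [mul_smul] at h
      exact h
    · simp only [slFlow_zero]; exact hU0 l
    · simp only [slFlow_zero]; exact hV0 l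
  have hC := hid (1, 0) Qc Pc hQc' hPc' (by simpa using hQc0) (by simpa using hPc0)
  have hSn := hid (0, 1) Qs Ps hQs' hPs' (by simpa using hQs0) (by simpa using hPs0)
  have hlin : ∀ τ l i, slFlow c d e τ l (a i, b i) =
      a i • slFlow c d e τ l (1, 0) + b i • slFlow c d e τ l (0, 1) := by
    intro τ l i
    rw [← map_smul, ← map_smul, ← map_add]
    simp
  have hcomb : ∀ p q : ℝ, α₀ * (p • (1 : Mat n))ᵀ - β₀ * (q • (1 : Mat n))ᵀ =
      W * Matrix.diagonal (fun i => a i * p + b i * q) * Rᵀ := by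
    intro p q
    have hd : (Matrix.diagonal (fun i => a i * p + b i * q) : Mat n) =
        p • Matrix.diagonal a + q • Matrix.diagonal b := by
      ext i j
      by_cases hij : i = j
      · subst hij; simp [mul_comm]
      · simp [hij]
    rw [hd, hα, hβ]
    simp only [Matrix.transpose_smul, Matrix.transpose_one, Matrix.mul_smul, mul_one, mul_add,
      add_mul, Matrix.smul_mul, smul_neg, sub_neg_eq_add]
  have hdetR : R.det ≠ 0 := by
    intro h0
    have := congrArg Matrix.det hR1
    rw [Matrix.det_mul, h0, zero_mul, Matrix.det_one] at this
    exact zero_ne_one this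
  have hprod : ∀ x y : Fin n → ℝ, W * Matrix.diagonal x * Rᵀ * (R * Matrix.diagonal y * Rᵀ) =
      W * Matrix.diagonal (fun i => x i * y i) * Rᵀ := by
    intro x y
    calc W * Matrix.diagonal x * Rᵀ * (R * Matrix.diagonal y * Rᵀ)
        = W * Matrix.diagonal x * (Rᵀ * R) * Matrix.diagonal y * Rᵀ := by
          simp only [Matrix.mul_assoc]
      _ = W * (Matrix.diagonal x * Matrix.diagonal y) * Rᵀ := by
          rw [hR2, mul_one]; simp only [Matrix.mul_assoc]
      _ = _ := by rw [Matrix.diagonal_mul_diagonal]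
  have hdiagc : ∀ (A B : Mat n), Continuous (fun x : Fin n → ℝ => A * Matrix.diagonal x * B) := by
    intro A B
    exact (continuous_const.matrix_mul continuous_id.matrix_diagonal).matrix_mul continuous_const
  refine ⟨fun τ l => W * Matrix.diagonal (fun i => ρ i τ l) * Rᵀ,
    fun τ l => R * Matrix.diagonal (fun i => φ i τ l) * Rᵀ, 0, ?_, ?_, ?_, ?_, ?_, ?_⟩
  · exact ((hdiagc W Rᵀ).comp (continuous_pi hρc)).continuousOn
  · exact ((hdiagc R Rᵀ).comp (continuous_pi hφc)).continuousOn
  · intro τ hτ l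
    obtain ⟨hqc, hpc⟩ := hC τ hτ l
    obtain ⟨hqs, hps⟩ := hSn τ hτ l
    refine ⟨?_, ?_, ?_, ?_⟩
    · rw [Matrix.det_mul, Matrix.det_mul, Matrix.det_transpose, Matrix.det_diagonal]
      exact mul_ne_zero (mul_ne_zero hW (Finset.prod_ne_zero_iff.2 fun i _ => hρ0 i τ l)) hdetR
    · simp only [Matrix.transpose_mul, Matrix.transpose_transpose, Matrix.diagonal_transpose,
        Matrix.mul_assoc]
    · rw [mcos_conj R hR2 hR1, hprod, hQ₂def, add_sub_assoc, hqc, hqs, hpc, hps, hcomb, hcomb, hδθ,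
        Matrix.mul_smul, mul_one, ← Matrix.smul_mul, ← Matrix.mul_smul, ← add_mul, ← mul_add]
      congr 2
      ext i j
      by_cases hij : i = j
      · subst hij
        have h := hcos i τ l
        rw [hlin] at h
        simp only [Prod.fst_add, Prod.snd_add, Prod.smul_fst, Prod.smul_snd, smul_eq_mul] at h
        simp only [Matrix.add_apply, Matrix.smul_apply, Matrix.diagonal_apply_eq, smul_eq_mul]
        linarith
      · simp [hij]
    · have hneg : -(α₀ * (Qc τ l)ᵀ) + β₀ * (Qs τ l)ᵀ = -(α₀ * (Qc τ l)ᵀ - β₀ * (Qs τ l)ᵀ) := by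
        abel
      rw [msin_conj R hR2 hR1, hprod, hQ₁def, hneg, hqc, hqs, hcomb, ← neg_mul, ← mul_neg]
      congr 2
      ext i j
      by_cases hij : i = j
      · subst hij
        have h := hsin i τ l
        rw [hlin] at h
        simp only [Prod.fst_add, Prod.smul_fst, smul_eq_mul] at h
        simp only [Matrix.neg_apply, Matrix.diagonal_apply_eq]
        linarith
      · simp [hij]
  · simp
  · intro μ hμ
    refine ⟨0, ?_⟩
    rw [zero_sub, ← neg_smul, Matrix.det_smul, Matrix.det_one, mul_one] at hμ
    have := pow_eq_zero_iff (by simp; omega) |>.1 hμ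
    simpa using this
  · intro τ hτ hτt
    constructor
    · intro M
      have hev : ∀ᶠ l in Filter.atTop, ∀ i, φ i τ l < M :=
        Filter.eventually_all.2 fun i => (htop i τ hτ).eventually_lt_atBot M
      obtain ⟨Λ, hΛ⟩ := Filter.eventually_atTop.1 hev
      refine ⟨Λ, fun l hl μ hμ => ?_⟩
      obtain ⟨i, hi⟩ := conj_eig R hR1 _ μ hμ
      rw [← hi]
      exact hΛ l hl i
    · have h1 : Filter.Tendsto (fun l => fun i => φ i τ l) Filter.atBot (nhds (0 : Fin n → ℝ)) :=
        tendsto_pi_nhds.2 fun i => hbot i τ hτ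
      have h2 := ((hdiagc R Rᵀ).tendsto 0).comp h1
      simpa [Function.comp_def] using h2
end
end

section
/- Let L₀, L₁, L₂ be real 2×2 matrices. Then det(L₀ + L₁ΦL₂) = 1 for every real 2×2 matrix Φ with det Φ = 1 if and only if det L₀ + (det L₁)(det L₂) = 1 and L₁*JL₀JL₂* = 0. Moreover, if these equivalent conditions hold, then one of the following three situations occurs: (a) det L₀ = 1, det L₁ = det L₂ = 0, L₁ ≠ 0 and L₂ ≠ 0; (b) det L₀ = 1 and (L₁ = 0 or L₂ = 0); (c) L₀ = 0 and (det L₁)(det L₂) = 1. -/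
open Matrix
noncomputable section
attribute [local instance] Matrix.normedAddCommGroup Matrix.normedSpace

/-- The `2×2` symplectic matrix `J = [[0,−1],[1,0]]`. -/
noncomputable def J2 : Matrix (Fin 2) (Fin 2) ℝ := !![0, -1; 1, 0]

theorem det_affine_aux (A B C P : Matrix (Fin 2) (Fin 2) ℝ) :
    (A + B * P * C).det = A.det + B.det * C.det * P.det
      - ((Bᵀ * J2 * A * J2 * Cᵀ) 0 0 * P 0 0 + (Bᵀ * J2 * A * J2 * Cᵀ) 0 1 * P 0 1
        + (Bᵀ * J2 * A * J2 * Cᵀ) 1 0 * P 1 0 + (Bᵀ * J2 * A * J2 * Cᵀ) 1 1 * P 1 1) := by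
  simp [Matrix.det_fin_two, Matrix.mul_apply, Fin.sum_univ_two, J2]
  ring

theorem J2_det : J2.det = 1 := by simp [J2, Matrix.det_fin_two]

theorem cancel_left_aux (A X : Matrix (Fin 2) (Fin 2) ℝ) (h : A.det ≠ 0) (hX : A * X = 0) :
    X = 0 := by
  have hu : IsUnit A.det := isUnit_iff_ne_zero.mpr h
  rw [← Matrix.nonsing_inv_mul_cancel_left A X hu, hX, Matrix.mul_zero]

theorem cancel_right_aux (A X : Matrix (Fin 2) (Fin 2) ℝ) (h : A.det ≠ 0) (hX : X * A = 0) :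
    X = 0 := by
  have hu : IsUnit A.det := isUnit_iff_ne_zero.mpr h
  rw [← Matrix.mul_nonsing_inv_cancel_right A X hu, hX, Matrix.zero_mul]

/-- Appendix proposition (`n = 1`): `L₀ + L₁ΦL₂` is symplectic (determinant one)
for every symplectic `Φ` iff `det L₀ + det L₁ · det L₂ = 1` and
`L₁*JL₀JL₂* = 0`; and then one of three situations occurs. -/
theorem affine_symplectic_two_by_two
    (L₀ L₁ L₂ : Matrix (Fin 2) (Fin 2) ℝ) :
    ((∀ Φ : Matrix (Fin 2) (Fin 2) ℝ, Φ.det = 1 → (L₀ + L₁ * Φ * L₂).det = 1) ↔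
      (L₀.det + L₁.det * L₂.det = 1 ∧ L₁ᵀ * J2 * L₀ * J2 * L₂ᵀ = 0)) ∧
    ((L₀.det + L₁.det * L₂.det = 1 ∧ L₁ᵀ * J2 * L₀ * J2 * L₂ᵀ = 0) →
      ((L₀.det = 1 ∧ L₁.det = 0 ∧ L₂.det = 0 ∧ L₁ ≠ 0 ∧ L₂ ≠ 0) ∨
        (L₀.det = 1 ∧ (L₁ = 0 ∨ L₂ = 0)) ∨
        (L₀ = 0 ∧ L₁.det * L₂.det = 1))) := by
  refine ⟨⟨fun h => ?_, fun ⟨h1, h2⟩ P hP => ?_⟩, fun ⟨h1, h2⟩ => ?_⟩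
  · have e1 := h !![1, 0; 0, 1] (by simp [Matrix.det_fin_two])
    have e2 := h !![-1, 0; 0, -1] (by simp [Matrix.det_fin_two])
    have e3 := h !![2, 0; 0, 1/2] (by simp [Matrix.det_fin_two])
    have e4 := h !![1, 1; 0, 1] (by simp [Matrix.det_fin_two])
    have e5 := h !![1, 0; 1, 1] (by simp [Matrix.det_fin_two])
    rw [det_affine_aux] at e1 e2 e3 e4 e5
    generalize L₁ᵀ * J2 * L₀ * J2 * L₂ᵀ = M at *
    simp only [Matrix.det_fin_two_of, Matrix.of_apply, Matrix.cons_val', Matrix.cons_val_zero,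
      Matrix.cons_val_one, Matrix.cons_val_fin_one] at e1 e2 e3 e4 e5
    refine ⟨by linarith, ?_⟩
    ext i j
    fin_cases i <;> fin_cases j <;> simp <;> linarith
  · rw [det_affine_aux, h2, hP]
    simpa using h1
  · have h3 := congrArg Matrix.det h2
    simp only [Matrix.det_mul, Matrix.det_transpose, J2_det, mul_one] at h3
    rw [Matrix.det_zero] at h3
    have hJ : J2.det ≠ 0 := by rw [J2_det]; exact one_ne_zero
    by_cases h0 : L₀.det = 0
    · have hd : L₁.det * L₂.det = 1 := by linarith
      have ha : L₁ᵀ.det ≠ 0 := by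
        rw [Matrix.det_transpose]; intro h; simp [h] at hd
      have hb : L₂ᵀ.det ≠ 0 := by
        rw [Matrix.det_transpose]; intro h; simp [h] at hd
      have k1 := cancel_right_aux _ _ hJ (cancel_right_aux _ _ hb h2)
      rw [Matrix.mul_assoc] at k1
      exact Or.inr (Or.inr ⟨cancel_left_aux _ _ hJ (cancel_left_aux _ _ ha k1), hd⟩)
    · have hd : L₁.det * L₂.det = 0 := by
        rw [mul_assoc] at h3
        exact (mul_eq_zero.mp (by linarith : L₀.det * (L₁.det * L₂.det) = 0)).resolve_left h0
      have h01 : L₀.det = 1 := by linarith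
      by_cases hz : L₁ = 0 ∨ L₂ = 0
      · exact Or.inr (Or.inl ⟨h01, hz⟩)
      · obtain ⟨z1, z2⟩ := not_or.mp hz
        refine Or.inl ⟨h01, ?_, ?_, z1, z2⟩
        · by_contra hne
          apply z2
          rw [← Matrix.det_transpose] at hne
          simp only [Matrix.mul_assoc] at h2
          exact Matrix.transpose_eq_zero.mp (cancel_left_aux _ _ hJ (cancel_left_aux _ _ h0
            (cancel_left_aux _ _ hJ (cancel_left_aux _ _ hne h2))))
        · by_contra hne
          apply z1
          rw [← Matrix.det_transpose] at hne
          exact Matrix.transpose_eq_zero.mp (cancel_right_aux _ _ hJ (cancel_right_aux _ _ h0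
            (cancel_right_aux _ _ hJ (cancel_right_aux _ _ hne h2))))
end
end
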